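/- Let q ≥ 2 be an integer and β > q, and let 𝒱 = {V₁,…,V_q} be a λ-partition of V with constant λ ∈ (0,1). There exist constants ε₀ > 0, γ₁ > 0, c₁ > 0 and C₁ > 0 such that for every configuration x ∈ Ω with ‖α(x) − m‖_∞ ≤ ε₀, every k ∈ [q], every r ≥ γ₁, and all sufficiently large n: if X′ is the result of one SW step from x, d(x,k) := |α₁(x) − α_{1,k}(x)|, d(X′,k) := |α₁(X′) − α_{1,k}(X′)|, and ξ̂^{(k)} := |d(X′,k) − (1 − 1/q)·θ(β·α₁(x))·d(x,k)|, then Pr(ξ̂^{(k)} ≥ r/√n) ≤ e^{−c₁ r} + C₁·r^{−2}. -/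

import Mathlib

open scoped Classical
open Finset

/-- Spin configurations on `n` vertices with `q` spins. -/
abbrev Conf (n q : ℕ) := Fin n → Fin q

/-- Number of vertices assigned spin `j`. -/
def cntN {n q : ℕ} (X : Conf n q) (j : Fin q) : ℕ :=
  (Finset.univ.filter (fun v => X v = j)).card

/-- Number of monochromatic pairs `{u,v}` (`u < v`, same spin). -/
def numMono {n q : ℕ} (σ : Conf n q) : ℕ :=
  (Finset.univ.filter (fun p : Fin n × Fin n => p.1 < p.2 ∧ σ p.1 = σ p.2)).card

/-- The mean-field `q`-state Potts measure: probability of `σ`. -/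
noncomputable def pottsProb (n q : ℕ) (β : ℝ) (σ : Conf n q) : ℝ :=
  Real.exp (β / n * numMono σ) / ∑ τ : Conf n q, Real.exp (β / n * numMono τ)

/-- The set of monochromatic pairs of a configuration. -/
def monoPairs {n q : ℕ} (σ : Conf n q) : Finset (Fin n × Fin n) :=
  Finset.univ.filter (fun p : Fin n × Fin n => p.1 < p.2 ∧ σ p.1 = σ p.2)

/-- The graph on `Fin n` whose edges are the pairs in `E`. -/
def graphOf {n : ℕ} (E : Finset (Fin n × Fin n)) : SimpleGraph (Fin n) :=
  SimpleGraph.fromRel (fun u v => (u, v) ∈ E)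

/-- Number of connected components of the graph `(V, E)`. -/
noncomputable def numComps {n : ℕ} (E : Finset (Fin n × Fin n)) : ℕ :=
  Nat.card (graphOf E).ConnectedComponent

/-- One-step transition probability of the Swendsen–Wang dynamics:
percolate on monochromatic pairs with probability `p = 1 - exp (-β/n)`,
then color each connected component uniformly at random. -/
noncomputable def swStep (n q : ℕ) (β : ℝ) (σ τ : Conf n q) : ℝ :=
  ∑ E ∈ (monoPairs σ).powerset,
    ((1 - Real.exp (-(β / n))) ^ E.card *
        Real.exp (-(β / n)) ^ ((monoPairs σ).card - E.card)) *
      (if ∀ u v : Fin n, (graphOf E).Reachable u v → τ u = τ v then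
        ((q : ℝ))⁻¹ ^ numComps E else 0)

/-- `t`-step transition probability of the Swendsen–Wang dynamics. -/
noncomputable def swProb (n q : ℕ) (β : ℝ) : ℕ → Conf n q → Conf n q → ℝ
  | 0, σ, τ => if σ = τ then 1 else 0
  | t + 1, σ, τ => ∑ η : Conf n q, swStep n q β σ η * swProb n q β t η τ

/-- Probability of observing the trajectory `ω 0, ω 1, …, ω (ℓ-1)` at times
`1, …, ℓ` for the SW dynamics started at `X₀`. -/
noncomputable def pathProb (n q : ℕ) (β : ℝ) (X₀ : Conf n q) (ℓ : ℕ)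
    (ω : Fin ℓ → Conf n q) : ℝ :=
  ∏ i : Fin ℓ, swStep n q β
    (if _h : 0 < (i : ℕ) then
        ω ⟨(i : ℕ) - 1, lt_of_le_of_lt (Nat.sub_le _ _) i.isLt⟩
      else X₀) (ω i)

/-- Total variation distance between two probability vectors on configurations. -/
noncomputable def tvDist {n q : ℕ} (f g : Conf n q → ℝ) : ℝ :=
  (∑ τ : Conf n q, |f τ - g τ|) / 2

/-- Mixing time `τ_mix(ε)` of the SW dynamics. -/
noncomputable def mixingTime (n q : ℕ) (β ε : ℝ) : ℕ :=
  sInf {t : ℕ | ∀ σ : Conf n q, tvDist (swProb n q β t σ) (pottsProb n q β) ≤ ε}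

/-- `theta lam` is the unique root in `(0,1)` of `exp (-lam * x) = 1 - x`
for `lam > 1`, and `0` for `lam ≤ 1`. -/
noncomputable def theta (lam : ℝ) : ℝ :=
  if lam ≤ 1 then 0
  else sSup {x : ℝ | x ∈ Set.Ioo (0 : ℝ) 1 ∧ Real.exp (-lam * x) = 1 - x}

/-- The drift function `F`. -/
noncomputable def F (q : ℕ) (β : ℝ) (x : ℝ) : ℝ :=
  1 / q + (1 - 1 / q) * theta (β * x) * x

/-- The unique fixed point of `F` in `(1/q, 1]` (for `β > q`). -/
noncomputable def aFix (q : ℕ) (β : ℝ) : ℝ :=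
  sSup {x : ℝ | x ∈ Set.Ioc (1 / (q : ℝ)) 1 ∧ F q β x = x}

/-- The cutoff constant `c(β,q) = (2 log (1 / F'(a)))⁻¹`. -/
noncomputable def cConst (q : ℕ) (β : ℝ) : ℝ :=
  (2 * Real.log (1 / deriv (F q β) (aFix q β)))⁻¹

/-- Fraction of vertices assigned spin `j`. -/
noncomputable def cntFrac {n q : ℕ} (X : Conf n q) : Fin q → ℝ :=
  fun j => (cntN X j : ℝ) / n

/-- The proportions vector `α(X)`: fractions of vertices of each spin,
sorted in nonincreasing order. -/
noncomputable def alphaVec {n q : ℕ} (X : Conf n q) : Fin q → ℝ :=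
  fun i => cntFrac X (Tuple.sort (cntFrac X) i.rev)

/-- `ℓ∞` distance between two vectors indexed by `Fin q`. -/
noncomputable def linf {q : ℕ} (f g : Fin q → ℝ) : ℝ :=
  ⨆ i : Fin q, |f i - g i|

/-- The vector `κ(b) = (b, (1-b)/(q-1), …, (1-b)/(q-1))`. -/
noncomputable def kappaVec (q : ℕ) (b : ℝ) : Fin q → ℝ :=
  fun i => if (i : ℕ) = 0 then b else (1 - b) / ((q : ℝ) - 1)

/-- The majority vector `m = (a, (1-a)/(q-1), …, (1-a)/(q-1))`. -/
noncomputable def mVec (q : ℕ) (β : ℝ) : Fin q → ℝ :=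
  kappaVec q (aFix q β)

/-- Index of the most common spin of `X` (least such index on ties). -/
noncomputable def domIdx {n q : ℕ} (X : Conf n q) : ℕ :=
  sInf {j : ℕ | ∃ hj : j < q, ∀ j' : Fin q, cntN X j' ≤ cntN X ⟨j, hj⟩}

/-- `α₁(X)`: fraction of vertices carrying the most common spin of `X`. -/
noncomputable def alpha1 {n q : ℕ} (X : Conf n q) : ℝ :=
  ((Finset.univ.filter (fun v : Fin n => (X v : ℕ) = domIdx X)).card : ℝ) / n

/-- `α_{1,k}(X)`: fraction of vertices of `Vk` carrying the most common spin of `X`. -/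
noncomputable def alpha1In {n q : ℕ} (X : Conf n q) (Vk : Finset (Fin n)) : ℝ :=
  ((Vk.filter (fun v => (X v : ℕ) = domIdx X)).card : ℝ) / Vk.card

/-- `P` is a partition of the vertex set into `q` classes. -/
def IsPartition {n q : ℕ} (P : Fin q → Finset (Fin n)) : Prop :=
  (∀ i j, i ≠ j → Disjoint (P i) (P j)) ∧ ∀ v : Fin n, ∃ i, v ∈ P i

/-- A `λ`-partition: a partition with all classes of size at least `λ n`. -/
def IsLamPartition {n q : ℕ} (lam : ℝ) (P : Fin q → Finset (Fin n)) : Prop :=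
  IsPartition P ∧ ∀ i, lam * n ≤ ((P i).card : ℝ)

/-- Projection: `projCnt P X i j` is the number of vertices of `P i`
assigned spin `j` in `X`. -/
def projCnt {n q : ℕ} (P : Fin q → Finset (Fin n)) (X : Conf n q) :
    Fin q → Fin q → ℕ :=
  fun i j => ((P i).filter (fun v => X v = j)).card

/-- All potential edges of the complete graph on `Fin n`. -/
def allPairs (n : ℕ) : Finset (Fin n × Fin n) :=
  Finset.univ.filter (fun p : Fin n × Fin n => p.1 < p.2)

/-- Probability of the edge set `E` under the Erdős–Rényi measure `G(n,p)`. -/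
noncomputable def erProb (n : ℕ) (p : ℝ) (E : Finset (Fin n × Fin n)) : ℝ :=
  p ^ E.card * (1 - p) ^ ((allPairs n).card - E.card)

/-- Size of the connected component of `v` in the graph `(V, E)`. -/
noncomputable def compCard {n : ℕ} (E : Finset (Fin n × Fin n)) (v : Fin n) : ℕ :=
  (Finset.univ.filter (fun u => (graphOf E).Reachable v u)).card

/-- `L₁`: size of the largest connected component. -/
noncomputable def L1 {n : ℕ} (E : Finset (Fin n × Fin n)) : ℕ :=
  Finset.univ.sup (fun v => compCard E v)

/-- Sum of the squares of the component sizes, `Σ_j L_j²`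
(computed as `Σ_v |C(v)|`). -/
noncomputable def sumCompSq {n : ℕ} (E : Finset (Fin n × Fin n)) : ℕ :=
  ∑ v : Fin n, compCard E v

/-- Expectation of `f` under the Erdős–Rényi measure `G(n,p)`. -/
noncomputable def erExp (n : ℕ) (p : ℝ) (f : Finset (Fin n × Fin n) → ℝ) : ℝ :=
  ∑ E ∈ (allPairs n).powerset, erProb n p E * f E

/-- Random-cluster weight of an edge set with parameters `q`, `p = 1 - exp (-β/n)`. -/
noncomputable def rcWeight (n q : ℕ) (β : ℝ) (E : Finset (Fin n × Fin n)) : ℝ :=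
  (1 - Real.exp (-(β / n))) ^ E.card *
    Real.exp (-(β / n)) ^ ((allPairs n).card - E.card) * (q : ℝ) ^ numComps E

/-- The mean-field random-cluster measure: probability of the edge set `E`. -/
noncomputable def rcProb (n q : ℕ) (β : ℝ) (E : Finset (Fin n × Fin n)) : ℝ :=
  rcWeight n q β E / ∑ B ∈ (allPairs n).powerset, rcWeight n q β B

/-- Expectation of `f E` when `E` is the random subset of `A` keeping each element independently
with probability `p`. -/
noncomputable def bernExp {α : Type*} (p : ℝ) (A : Finset α) (f : Finset α → ℝ) : ℝ :=
  ∑ E ∈ A.powerset, p ^ #E * (1 - p) ^ (#A - #E) * f E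

section bernExp

variable {α γ : Type*} {p : ℝ}

lemma bernExp_const (p c : ℝ) (A : Finset α) : bernExp p A (fun _ => c) = c := by
  rw [bernExp, ← Finset.sum_mul, Finset.sum_pow_mul_eq_add_pow]
  simp

lemma bernExp_mono (hp : p ∈ Set.Icc (0 : ℝ) 1) {A : Finset α} {f g : Finset α → ℝ}
    (h : ∀ E ⊆ A, f E ≤ g E) : bernExp p A f ≤ bernExp p A g := by
  refine Finset.sum_le_sum fun E hE => ?_
  have h1 : 0 ≤ 1 - p := by linarith [hp.2]
  have h0 := hp.1
  exact mul_le_mul_of_nonneg_left (h E (Finset.mem_powerset.1 hE)) (by positivity)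

lemma bernExp_congr {A : Finset α} {f g : Finset α → ℝ}
    (h : ∀ E ⊆ A, f E = g E) : bernExp p A f = bernExp p A g :=
  Finset.sum_congr rfl fun E hE => by rw [h E (Finset.mem_powerset.1 hE)]

lemma bernExp_nonneg (hp : p ∈ Set.Icc (0 : ℝ) 1) {A : Finset α} {f : Finset α → ℝ}
    (h : ∀ E ⊆ A, 0 ≤ f E) : 0 ≤ bernExp p A f := by
  simpa [bernExp_const] using bernExp_mono (f := fun _ => 0) hp h

lemma bernExp_add (A : Finset α) (f g : Finset α → ℝ) :
    bernExp p A (fun E => f E + g E) = bernExp p A f + bernExp p A g := by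
  simp only [bernExp, mul_add, Finset.sum_add_distrib]

lemma bernExp_mul_left (A : Finset α) (c : ℝ) (f : Finset α → ℝ) :
    bernExp p A (fun E => c * f E) = c * bernExp p A f := by
  simp only [bernExp, Finset.mul_sum]
  exact Finset.sum_congr rfl fun E _ => by ring

lemma bernExp_sum {ι : Type*} (s : Finset ι) (A : Finset α) (f : ι → Finset α → ℝ) :
    bernExp p A (fun E => ∑ i ∈ s, f i E) = ∑ i ∈ s, bernExp p A (f i) := by
  simp only [bernExp, Finset.mul_sum]
  exact Finset.sum_comm

lemma bernExp_image [DecidableEq γ] {A : Finset α} {g : α → γ} (hg : Set.InjOn g A)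
    (f : Finset γ → ℝ) :
    bernExp p (A.image g) f = bernExp p A (fun E => f (E.image g)) := by
  rw [bernExp, bernExp, Finset.powerset_image, Finset.sum_image]
  · refine Finset.sum_congr rfl fun E hE => ?_
    rw [Finset.card_image_of_injOn hg,
      Finset.card_image_of_injOn (hg.mono (by exact_mod_cast Finset.mem_powerset.1 hE))]
  · intro E hE F hF hEF
    have hE := Finset.mem_powerset.1 (Finset.mem_coe.1 hE)
    have hF := Finset.mem_powerset.1 (Finset.mem_coe.1 hF)
    refine Finset.coe_injective ((hg.image_eq_image_iff (by exact_mod_cast hE)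
      (by exact_mod_cast hF)).1 ?_)
    exact_mod_cast hEF

variable [DecidableEq α]

lemma bernExp_insert {A : Finset α} {a : α} (ha : a ∉ A) (f : Finset α → ℝ) :
    bernExp p (insert a A) f =
      (1 - p) * bernExp p A f + p * bernExp p A (fun E => f (insert a E)) := by
  rw [bernExp, Finset.sum_powerset_insert ha, bernExp, bernExp, Finset.mul_sum, Finset.mul_sum]
  congr 1 <;> refine Finset.sum_congr rfl fun E hE => ?_
  · have hE' := Finset.card_le_card (Finset.mem_powerset.1 hE)
    rw [Finset.card_insert_of_notMem ha, Nat.succ_sub hE', pow_succ]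
    ring
  · have haE : a ∉ E := fun h => ha (Finset.mem_powerset.1 hE h)
    rw [Finset.card_insert_of_notMem ha, Finset.card_insert_of_notMem haE, Nat.succ_sub_succ,
      pow_succ]
    ring

lemma bernExp_union {A B : Finset α} (h : Disjoint A B) (f : Finset α → ℝ) :
    bernExp p (A ∪ B) f = bernExp p B (fun F => bernExp p A (fun E => f (E ∪ F))) := by
  induction B using Finset.induction_on generalizing f with
  | empty => simp [bernExp]
  | insert b B hb ih =>
    rw [Finset.disjoint_insert_right] at h
    have hb' : b ∉ A ∪ B := by simp [h.1, hb]
    rw [Finset.union_insert, bernExp_insert hb', bernExp_insert hb, ih h.2, ih h.2]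
    simp only [Finset.union_insert]

/-- The law of the random subset of `A` restricted to `B ⊆ A`. -/
lemma bernExp_inter {A B : Finset α} (h : B ⊆ A) (f : Finset α → ℝ) :
    bernExp p A (fun E => f (E ∩ B)) = bernExp p B f := by
  have hd : Disjoint B (A \ B) := Finset.disjoint_sdiff
  rw [← Finset.union_sdiff_of_subset h, bernExp_union hd]
  have : ∀ F ⊆ A \ B, bernExp p B (fun E => f ((E ∪ F) ∩ B)) = bernExp p B f := fun F hF =>
    bernExp_congr fun E hE => by
      congr 1
      ext x
      have h1 := @hE x
      have h2 := @hF x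
      simp only [Finset.mem_sdiff] at h2
      simp only [Finset.mem_inter, Finset.mem_union]
      tauto
  rw [bernExp_congr this, bernExp_const]

end bernExp

section cluster

variable {V : Type*}

variable [Fintype V] {E : Finset (Sym2 V)}

/-- Vertices reachable from `R` through the edges in `E`. -/
noncomputable def cluster (E : Finset (Sym2 V)) (R : Finset V) : Finset V :=
  Finset.univ.filter
    (fun v => ∃ u ∈ R, Relation.ReflTransGen (fun a b => s(a, b) ∈ E) u v)

lemma mem_cluster {R : Finset V} {v : V} : v ∈ cluster E R ↔
    ∃ u ∈ R, Relation.ReflTransGen (fun a b => s(a, b) ∈ E) u v := by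
  simp [cluster]

lemma subset_cluster (E : Finset (Sym2 V)) (R : Finset V) : R ⊆ cluster E R :=
  fun v hv => mem_cluster.2 ⟨v, hv, .refl⟩

lemma mem_cluster_of_adj {R : Finset V} {a b : V} (ha : a ∈ cluster E R) (hab : s(a, b) ∈ E) :
    b ∈ cluster E R := by
  obtain ⟨u, hu, h⟩ := mem_cluster.1 ha
  exact mem_cluster.2 ⟨u, hu, h.tail hab⟩

lemma cluster_subset {R S : Finset V} (hR : R ⊆ S)
    (hS : ∀ a ∈ S, ∀ b, s(a, b) ∈ E → b ∈ S) : cluster E R ⊆ S := by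
  intro v hv
  obtain ⟨u, hu, h⟩ := mem_cluster.1 hv
  induction h with
  | refl => exact hR hu
  | tail h hab ih => exact hS _ (ih (mem_cluster.2 ⟨u, hu, h⟩)) _ hab

lemma cluster_empty (E : Finset (Sym2 V)) : cluster E ∅ = ∅ := by
  simp [cluster]

lemma mem_cluster_singleton {u v : V} : v ∈ cluster E {u} ↔
    Relation.ReflTransGen (fun a b => s(a, b) ∈ E) u v := by
  simp [mem_cluster]

lemma mem_cluster_comm {u v : V} : v ∈ cluster E {u} ↔ u ∈ cluster E {v} := by
  rw [mem_cluster_singleton, mem_cluster_singleton]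
  have : Std.Symm (fun a b : V => s(a, b) ∈ E) := ⟨fun a b h => by rwa [Sym2.eq_swap]⟩
  exact ⟨fun h => Std.Symm.symm _ _ h, fun h => Std.Symm.symm _ _ h⟩

lemma cluster_singleton_eq {u v : V} (h : v ∈ cluster E {u}) : cluster E {v} = cluster E {u} := by
  have key : ∀ {u v : V}, v ∈ cluster E {u} → cluster E {v} ⊆ cluster E {u} := fun h =>
    cluster_subset (Finset.singleton_subset_iff.2 h) fun a ha b hab => mem_cluster_of_adj ha hab
  exact (key h).antisymm (key (mem_cluster_comm.1 h))

lemma self_mem_cluster (E : Finset (Sym2 V)) (v : V) : v ∈ cluster E {v} :=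
  subset_cluster E _ (Finset.mem_singleton_self v)

end cluster

section exploration

variable {V : Type*} [DecidableEq V]

/-- Potential edges inside the vertex set `D`. -/
def edgesIn (D : Finset V) : Finset (Sym2 V) :=
  D.sym2.filter (fun e => ¬ e.IsDiag)

lemma mk_mem_edgesIn {D : Finset V} {a b : V} :
    s(a, b) ∈ edgesIn D ↔ a ∈ D ∧ b ∈ D ∧ a ≠ b := by
  simp [edgesIn, and_assoc]

lemma edgesIn_eq_union {D : Finset V} {w : V} (hw : w ∈ D) :
    edgesIn D = edgesIn (D.erase w) ∪ (D.erase w).image (fun v => s(w, v)) := by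
  ext e
  induction e with
  | _ a b =>
    simp only [Finset.mem_union, mk_mem_edgesIn, Finset.mem_image, Finset.mem_erase, Sym2.eq_iff]
    constructor
    · rintro ⟨ha, hb, hab⟩
      by_cases h1 : a = w
      · subst h1
        exact Or.inr ⟨b, ⟨Ne.symm hab, hb⟩, Or.inl ⟨rfl, rfl⟩⟩
      · by_cases h2 : b = w
        · subst h2
          exact Or.inr ⟨a, ⟨hab, ha⟩, Or.inr ⟨rfl, rfl⟩⟩
        · exact Or.inl ⟨⟨h1, ha⟩, ⟨h2, hb⟩, hab⟩
    · rintro (⟨⟨_, ha⟩, ⟨_, hb⟩, hab⟩ | ⟨v, ⟨hvw, hv⟩, ⟨rfl, rfl⟩ | ⟨rfl, rfl⟩⟩)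
      · exact ⟨ha, hb, hab⟩
      · exact ⟨hw, hv, Ne.symm hvw⟩
      · exact ⟨hv, hw, hvw⟩

lemma bernExp_edgesIn_erase {p : ℝ} {D : Finset V} {w : V} (hw : w ∈ D)
    (f : Finset (Sym2 V) → ℝ) :
    bernExp p (edgesIn D) f = bernExp p (D.erase w) (fun N =>
      bernExp p (edgesIn (D.erase w)) (fun E => f (E ∪ N.image (fun v => s(w, v))))) := by
  have hinj : Set.InjOn (fun v => s(w, v)) (D.erase w : Set V) := by
    intro a _ b _ h
    exact Sym2.congr_right.1 h
  have hd : Disjoint (edgesIn (D.erase w)) ((D.erase w).image (fun v => s(w, v))) := by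
    rw [Finset.disjoint_left]
    intro e he he'
    obtain ⟨v, -, rfl⟩ := Finset.mem_image.1 he'
    simpa using (mk_mem_edgesIn.1 he).1
  rw [edgesIn_eq_union hw, bernExp_union hd, bernExp_image (by exact_mod_cast hinj)]

variable [Fintype V] {E : Finset (Sym2 V)}

lemma cluster_union (E : Finset (Sym2 V)) (R T : Finset V) :
    cluster E (R ∪ T) = cluster E R ∪ cluster E T := by
  ext v
  simp only [mem_cluster, Finset.mem_union, or_and_right, exists_or]

lemma cluster_subset_of_edgesIn {D R : Finset V} (hE : E ⊆ edgesIn D) (hR : R ⊆ D) :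
    cluster E R ⊆ D :=
  cluster_subset hR fun _ _ _ hab => (mk_mem_edgesIn.1 (hE hab)).2.1

/-- Revealing the neighbours `N` of a root `w` and deleting `w`. -/
lemma cluster_star {D R N : Finset V} {w : V} (hw : w ∉ D) (hE : E ⊆ edgesIn D) :
    cluster (E ∪ N.image (fun v => s(w, v))) (insert w R) = insert w (cluster E (R ∪ N)) := by
  apply Finset.Subset.antisymm
  · refine cluster_subset (Finset.insert_subset_insert _
      (Finset.subset_union_left.trans (subset_cluster _ _))) ?_
    intro a ha b hab
    rcases Finset.mem_union.1 hab with hab | hab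
    · rcases Finset.mem_insert.1 ha with haw | ha
      · exact absurd (mk_mem_edgesIn.1 (hE hab)).1 (haw ▸ hw)
      · exact Finset.mem_insert_of_mem (mem_cluster_of_adj ha hab)
    · obtain ⟨v, hv, hvab⟩ := Finset.mem_image.1 hab
      rcases Sym2.eq_iff.1 hvab with ⟨rfl, rfl⟩ | ⟨rfl, rfl⟩
      · exact Finset.mem_insert_of_mem
          (subset_cluster _ _ (Finset.mem_union_right _ hv))
      · exact Finset.mem_insert_self _ _
  · have hw' : w ∈ cluster (E ∪ N.image (fun v => s(w, v))) (insert w R) :=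
      subset_cluster _ _ (Finset.mem_insert_self _ _)
    refine Finset.insert_subset hw' (cluster_subset (Finset.union_subset ?_ ?_) ?_)
    · exact (Finset.subset_insert _ _).trans (subset_cluster _ _)
    · intro v hv
      exact mem_cluster_of_adj hw'
        (Finset.mem_union_right _ (Finset.mem_image_of_mem _ hv))
    · exact fun a ha b hab => mem_cluster_of_adj ha (Finset.mem_union_left _ hab)

/-- Exploration bound: the probability that the cluster of `R` is exactly `U`. -/
lemma bernExp_cluster_eq_le {p : ℝ} (hp : p ∈ Set.Icc (0 : ℝ) 1) {D R U : Finset V}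
    (hRU : R ⊆ U) (hUD : U ⊆ D) :
    bernExp p (edgesIn D) (fun E => if cluster E R = U then 1 else 0) ≤
      (1 - (1 - p) ^ #U) ^ (#U - #R) * ((1 - p) ^ #U) ^ (#D - #U) := by
  have hp1 : 0 ≤ 1 - p := by linarith [hp.2]
  have hp1' : 1 - p ≤ 1 := by linarith [hp.1]
  induction hD : #D generalizing D R U with
  | zero =>
    have hU : #U = 0 := by have := Finset.card_le_card hUD; omega
    refine (bernExp_mono (g := fun _ => 1) hp fun E _ => by split_ifs <;> norm_num).trans ?_
    rw [bernExp_const, hU]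
    simp
  | succ m ih =>
    rcases R.eq_empty_or_nonempty with rfl | ⟨w, hwR⟩
    · rcases U.eq_empty_or_nonempty with rfl | hU
      · refine (bernExp_mono (g := fun _ => 1) hp fun E _ => by split_ifs <;> norm_num).trans ?_
        rw [bernExp_const]
        simp
      · refine (bernExp_mono (g := fun _ => 0) hp fun E _ => ?_).trans ?_
        · rw [cluster_empty, if_neg hU.ne_empty.symm]
        · rw [bernExp_const]
          have := pow_le_one₀ (n := #U) hp1 hp1'
          have : 0 ≤ 1 - (1 - p) ^ #U := by linarith
          positivity
    · have hwU := hRU hwR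
      have hwD := hUD hwU
      rw [bernExp_edgesIn_erase hwD]
      set D' := D.erase w with hD'
      have hD'c : #D' = m := by rw [hD', Finset.card_erase_of_mem hwD, hD]; rfl
      have hwD' : w ∉ D' := by simp [hD']
      set U' := U.erase w with hU'
      set R' := R.erase w with hR'
      have hR'R : insert w R' = R := Finset.insert_erase hwR
      have hU'c : #U' + 1 = #U := Finset.card_erase_add_one hwU
      have hR'c : #R' + 1 = #R := Finset.card_erase_add_one hwR
      have hUD₂ : U' ⊆ D' := Finset.erase_subset_erase _ hUD
      have hRU₂ : R' ⊆ U' := Finset.erase_subset_erase _ hRU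
      set s := (1 - p) ^ #U' with hs
      have hs1 : s ≤ 1 := pow_le_one₀ hp1 hp1'
      have hs0 : 0 ≤ s := by positivity
      have hs1' : 0 ≤ 1 - s := by linarith
      have hev : ∀ N ⊆ D', bernExp p (edgesIn D')
          (fun E => if cluster (E ∪ N.image (fun v => s(w, v))) R = U then 1 else 0) ≤
          if N ⊆ U' then (1 - s) ^ (#(U' \ R') - #(N \ R')) * s ^ (#D' - #U') else 0 := by
        intro N hN
        have h1 : ∀ E ⊆ edgesIn D',
            ((if cluster (E ∪ N.image (fun v => s(w, v))) R = U then 1 else 0 : ℝ) ≤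
              if cluster E (R' ∪ N) = U' then 1 else 0) := by
          intro E hE
          rw [← hR'R, cluster_star hwD' hE]
          split_ifs with h2 h3 <;> try norm_num
          apply h3
          rw [hU', ← h2, Finset.erase_insert]
          intro h
          exact hwD' (cluster_subset_of_edgesIn hE
            (Finset.union_subset (hRU₂.trans hUD₂) hN) h)
        refine (bernExp_mono hp h1).trans ?_
        split_ifs with hNU
        · refine (ih (Finset.union_subset hRU₂ hNU) hUD₂ hD'c).trans (le_of_eq ?_)
          rw [hD'c]
          congr 2
          rw [Finset.card_sdiff_of_subset hRU₂]
          have : #(R' ∪ N) = #R' + #(N \ R') := by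
            rw [← Finset.card_union_of_disjoint Finset.disjoint_sdiff,
              Finset.union_sdiff_self_eq_union]
          omega
        · refine (bernExp_mono (g := fun _ => 0) hp fun E _ => ?_).trans_eq (bernExp_const _ _ _)
          rw [if_neg]
          intro h
          exact hNU (h ▸ Finset.subset_union_right.trans (subset_cluster _ _))
      refine (bernExp_mono hp hev).trans ?_
      -- split `D'` into `(D' \ U') ∪ (U' \ R') ∪ R'`
      have hd1 : Disjoint R' (U' \ R') := Finset.disjoint_sdiff
      have hd2 : Disjoint U' (D' \ U') := Finset.disjoint_sdiff
      rw [← Finset.union_sdiff_of_subset hUD₂, bernExp_union hd2]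
      have hin : ∀ F ⊆ D' \ U', bernExp p U' (fun N => if N ∪ F ⊆ U' then
            (1 - s) ^ (#(U' \ R') - #((N ∪ F) \ R')) * s ^ (#(U' ∪ D' \ U') - #U') else 0) =
          (if F = ∅ then 1 else 0) *
            ((1 - (1 - p) * s) ^ (#U' - #R') * s ^ (#D' - #U')) := by
        intro F hF
        split_ifs with hFe
        · subst hFe
          have h2 : ∀ N ⊆ U', (if N ∪ ∅ ⊆ U' then
            (1 - s) ^ (#(U' \ R') - #((N ∪ ∅) \ R')) * s ^ (#(U' ∪ D' \ U') - #U') else 0) =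
            s ^ (#D' - #U') * (fun M : Finset V => (1 - s) ^ (#(U' \ R') - #M))
              (N ∩ (U' \ R')) := by
            intro N hN
            have h3 : N ∩ (U' \ R') = N \ R' := by
              rw [← Finset.inter_sdiff_assoc, Finset.inter_eq_left.2 hN]
            rw [Finset.union_empty, if_pos hN, Finset.union_sdiff_of_subset hUD₂, h3]
            ring
          rw [bernExp_congr h2, bernExp_mul_left,
            bernExp_inter (Finset.sdiff_subset (s := U') (t := R'))
              (fun M : Finset V => (1 - s) ^ (#(U' \ R') - #M)), one_mul, mul_comm]
          congr 1
          rw [bernExp]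
          have h4 : ∀ M ∈ (U' \ R').powerset, p ^ #M * (1 - p) ^ (#(U' \ R') - #M) *
              (1 - s) ^ (#(U' \ R') - #M) = p ^ #M * ((1 - p) * (1 - s)) ^ (#(U' \ R') - #M) := by
            intro M _
            rw [mul_pow]
            ring
          rw [Finset.sum_congr rfl h4, Finset.sum_pow_mul_eq_add_pow,
            Finset.card_sdiff_of_subset hRU₂]
          congr 1
          ring
        · rw [zero_mul]
          refine (bernExp_congr (g := fun _ => 0) fun N _ => if_neg fun h => hFe ?_).trans
            (bernExp_const _ _ _)
          refine Finset.eq_empty_of_forall_notMem fun x hx => ?_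
          exact (Finset.mem_sdiff.1 (hF hx)).2 (h (Finset.mem_union_right _ hx))
      have hzero : bernExp p (D' \ U') (fun F => if F = ∅ then (1 : ℝ) else 0) =
          (1 - p) ^ (#D' - #U') := by
        rw [bernExp, Finset.sum_eq_single ∅]
        · simp [Finset.card_sdiff_of_subset hUD₂]
        · intro F _ hF
          simp [hF]
        · simp
      rw [bernExp_congr hin]
      simp_rw [mul_comm (ite _ _ _)]
      rw [bernExp_mul_left, hzero, hD'c]
      have e1 : #U - #R = #U' - #R' := by omega
      have e2 : m + 1 - #U = m - #U' := by omega
      have e3 : (1 - p) ^ #U = (1 - p) * s := by rw [← hU'c, pow_succ, mul_comm]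
      rw [e1, e2, e3, mul_pow, mul_assoc, mul_comm (s ^ _)]

/-- The probability mass bound for the size of an explored cluster: `m` vertices, `r` roots,
final size `k`, each edge closed with probability `Q`. -/
noncomputable def exploreMass (Q : ℝ) (m r k : ℕ) : ℝ :=
  (m - r).choose (k - r) * ((1 - Q ^ k) ^ (k - r) * (Q ^ k) ^ (m - k))

lemma bernExp_card_cluster_le {p : ℝ} (hp : p ∈ Set.Icc (0 : ℝ) 1) {D R : Finset V}
    (hRD : R ⊆ D) (k : ℕ) :
    bernExp p (edgesIn D) (fun E => if #(cluster E R) = k then 1 else 0) ≤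
      exploreMass (1 - p) (#D) (#R) k := by
  set T := (D.powersetCard k).filter (fun U => R ⊆ U) with hT
  have h1 : ∀ E ⊆ edgesIn D, (if #(cluster E R) = k then 1 else 0 : ℝ) ≤
      ∑ U ∈ T, if cluster E R = U then 1 else 0 := by
    intro E hE
    split_ifs with h
    · rw [Finset.sum_ite_eq, if_pos]
      rw [hT, Finset.mem_filter, Finset.mem_powersetCard]
      exact ⟨⟨cluster_subset_of_edgesIn hE hRD, h⟩, subset_cluster _ _⟩
    · exact Finset.sum_nonneg fun U _ => by split_ifs <;> norm_num
  refine (bernExp_mono hp h1).trans ?_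
  rw [bernExp_sum]
  have h2 : ∀ U ∈ T, bernExp p (edgesIn D) (fun E => if cluster E R = U then (1 : ℝ) else 0) ≤
      (1 - (1 - p) ^ k) ^ (k - #R) * ((1 - p) ^ k) ^ (#D - k) := by
    intro U hU
    rw [hT, Finset.mem_filter, Finset.mem_powersetCard] at hU
    have := bernExp_cluster_eq_le hp hU.2 hU.1.1
    rwa [hU.1.2] at this
  refine (Finset.sum_le_card_nsmul _ _ _ h2).trans ?_
  rw [nsmul_eq_mul, exploreMass]
  have h3 : #T ≤ (#D - #R).choose (k - #R) := by
    rw [← Finset.card_sdiff_of_subset hRD, ← Finset.card_powersetCard]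
    refine Finset.card_le_card_of_injOn (fun U => U \ R) ?_ ?_
    · intro U hU
      rw [Finset.mem_coe, hT, Finset.mem_filter, Finset.mem_powersetCard] at hU
      rw [Finset.mem_coe, Finset.mem_powersetCard]
      refine ⟨Finset.sdiff_subset_sdiff hU.1.1 le_rfl, ?_⟩
      rw [Finset.card_sdiff_of_subset hU.2, hU.1.2]
    · intro U hU U' hU' h
      rw [Finset.mem_coe, hT, Finset.mem_filter] at hU hU'
      rw [← Finset.union_sdiff_of_subset hU.2, ← Finset.union_sdiff_of_subset hU'.2]
      exact congrArg (fun s => R ∪ s) h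
  have hp1 : 0 ≤ 1 - p := by linarith [hp.2]
  have h4 := pow_le_one₀ (n := k) hp1 (by linarith [hp.1])
  have h5 : 0 ≤ 1 - (1 - p) ^ k := by linarith
  gcongr

end exploration

section theta

lemma exp_neg_le_quadratic {y : ℝ} (hy : 0 ≤ y) : Real.exp (-y) ≤ 1 - y + y ^ 2 / 2 := by
  have h1 := Real.quadratic_le_exp_of_nonneg hy
  rw [Real.exp_neg]
  refine inv_le_of_inv_le₀ (by nlinarith [sq_nonneg (y - 1)]) (le_trans ?_ h1)
  rw [inv_le_comm₀ (by nlinarith [sq_nonneg (y - 1)]) (by positivity)]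
  rw [inv_le_iff_one_le_mul₀ (by positivity)]
  nlinarith [sq_nonneg (y ^ 2)]

/-- The chord bound for `κ ↦ 1 - exp (-L κ) - κ` beyond a point `δ` where it is positive. -/
lemma survival_chord {L δ t c : ℝ} (hδt : δ < t) (htδ : t ≤ 1 + δ)
    (ht : Real.exp (-L * t) = 1 - t) (hc : 0 ≤ c) (hδ : c ≤ 1 - Real.exp (-L * δ) - δ)
    {κ : ℝ} (hκ : δ ≤ κ) : c * |κ - t| ≤ |1 - Real.exp (-L * κ) - κ| := by
  have hconv : ∀ x y w : ℝ, 0 ≤ w → w ≤ 1 →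
      Real.exp (-L * (w * x + (1 - w) * y)) ≤
        w * Real.exp (-L * x) + (1 - w) * Real.exp (-L * y) := by
    intro x y w h0 h1
    have := convexOn_exp.2 (Set.mem_univ (-L * x)) (Set.mem_univ (-L * y)) h0
      (by linarith : 0 ≤ 1 - w) (by ring)
    simp only [smul_eq_mul] at this
    rwa [show -L * (w * x + (1 - w) * y) = w * (-L * x) + (1 - w) * (-L * y) by ring]
  rcases le_or_gt t κ with h | h
  · have hd : 0 < κ - δ := by linarith
    have h1 := hconv δ κ ((κ - t) / (κ - δ)) (by apply div_nonneg <;> linarith)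
      (by rw [div_le_one hd]; linarith)
    have h2 : (κ - t) / (κ - δ) * δ + (1 - (κ - t) / (κ - δ)) * κ = t := by field_simp; ring
    have h3 : 1 - (κ - t) / (κ - δ) = (t - δ) / (κ - δ) := by field_simp; ring
    rw [h2, ht, h3, div_mul_eq_mul_div, div_mul_eq_mul_div, ← add_div, le_div_iff₀ hd] at h1
    rw [abs_of_nonneg (by linarith : 0 ≤ κ - t)]
    refine le_trans ?_ (neg_le_abs _)
    have h4 : (κ - t) * c ≤ (t - δ) * -(1 - Real.exp (-L * κ) - κ) := by
      nlinarith [mul_le_mul_of_nonneg_left hδ (by linarith : 0 ≤ κ - t)]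
    have h5 : 0 ≤ -(1 - Real.exp (-L * κ) - κ) := by
      have : 0 ≤ (κ - t) * c := mul_nonneg (by linarith) hc
      by_contra hneg
      nlinarith
    nlinarith
  · have hd : 0 < t - δ := by linarith
    have h1 := hconv δ t ((t - κ) / (t - δ)) (by apply div_nonneg <;> linarith)
      (by rw [div_le_one hd]; linarith)
    have h2 : (t - κ) / (t - δ) * δ + (1 - (t - κ) / (t - δ)) * t = κ := by field_simp; ring
    have h3 : 1 - (t - κ) / (t - δ) = (κ - δ) / (t - δ) := by field_simp; ring
    rw [h2, ht, h3, div_mul_eq_mul_div, div_mul_eq_mul_div, ← add_div, le_div_iff₀ hd] at h1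
    rw [abs_of_neg (by linarith : κ - t < 0)]
    refine le_trans ?_ (le_abs_self _)
    have h4 : (t - κ) * c ≤ (t - δ) * (1 - Real.exp (-L * κ) - κ) := by
      nlinarith [mul_le_mul_of_nonneg_left hδ (by linarith : 0 ≤ t - κ)]
    have h5 : 0 ≤ 1 - Real.exp (-L * κ) - κ := by
      have : 0 ≤ (t - κ) * c := mul_nonneg (by linarith) hc
      by_contra hneg
      nlinarith
    nlinarith

lemma root_unique {L x y : ℝ} (hL : 0 < L) (hx : x ∈ Set.Ioo (0 : ℝ) 1)
    (hx' : Real.exp (-L * x) = 1 - x) (hy' : Real.exp (-L * y) = 1 - y) : ¬ x < y := by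
  intro hxy
  have hy : 0 < y := hx.1.trans hxy
  have h := strictConvexOn_exp.2 (Set.mem_univ (-L * y)) (Set.mem_univ 0)
    (by nlinarith : -L * y ≠ 0) (div_pos hx.1 hy) (by rw [sub_pos, div_lt_one hy]; exact hxy :
      0 < 1 - x / y) (by ring)
  simp only [smul_eq_mul, Real.exp_zero, hy'] at h
  have e1 : x / y * (-L * y) + (1 - x / y) * 0 = -L * x := by field_simp; ring
  have e2 : x / y * (1 - y) + (1 - x / y) * 1 = 1 - x := by field_simp; ring
  rw [e1, e2, hx'] at h
  exact lt_irrefl _ h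

/-- Uniform properties of `theta` on a compact interval `[ℓ, β]` of `(1, ∞)`. -/
lemma theta_spec {l β δ L : ℝ} (hl : 1 < l) (hlL : l ≤ L) (hLβ : L ≤ β) (hδ : 0 < δ)
    (hδ' : δ ≤ (l - 1) / β ^ 2) :
    δ < theta L ∧ theta L < 1 ∧ Real.exp (-L * theta L) = 1 - theta L ∧
      ∀ κ, δ ≤ κ → δ * (l - 1) / 2 * |κ - theta L| ≤ |1 - Real.exp (-L * κ) - κ| := by
  have hL : 1 < L := by linarith
  have hβ : 1 < β := by linarith
  rw [le_div_iff₀ (by positivity)] at hδ'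
  have hδ1 : δ < 1 := by nlinarith
  have hpos : δ * (l - 1) / 2 ≤ 1 - Real.exp (-L * δ) - δ := by
    have h1 := exp_neg_le_quadratic (y := L * δ) (by positivity)
    rw [← neg_mul] at h1
    have h2 : L ^ 2 ≤ β ^ 2 := by gcongr
    have h3 : δ * L ^ 2 ≤ l - 1 := le_trans (by gcongr) hδ'
    nlinarith [mul_le_mul_of_nonneg_left h3 hδ.le, mul_le_mul_of_nonneg_left hlL hδ.le]
  have hc : 0 < δ * (l - 1) / 2 := by
    have : 0 < l - 1 := by linarith
    positivity
  obtain ⟨t, ht, ht0⟩ : ∃ t ∈ Set.Icc δ 1, 1 - Real.exp (-L * t) - t = 0 := by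
    have hcont : ContinuousOn (fun t : ℝ => 1 - Real.exp (-L * t) - t) (Set.Icc δ 1) := by
      fun_prop
    have := intermediate_value_Icc' hδ1.le hcont
    have hmem : (0 : ℝ) ∈ Set.Icc (1 - Real.exp (-L * 1) - 1) (1 - Real.exp (-L * δ) - δ) :=
      ⟨by have := Real.exp_pos (-L * 1); linarith, by linarith⟩
    obtain ⟨t, h1, h2⟩ := this hmem
    exact ⟨t, h1, h2⟩
  have hδt : δ < t := by
    rcases ht.1.lt_or_eq with h | h
    · exact h
    · rw [← h] at ht0
      linarith
  have hroot : Real.exp (-L * t) = 1 - t := by linarith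
  have ht1 : t < 1 := by have := Real.exp_pos (-L * t); linarith
  have htheta : theta L = t := by
    rw [theta, if_neg (not_le.2 hL)]
    have : {x : ℝ | x ∈ Set.Ioo (0 : ℝ) 1 ∧ Real.exp (-L * x) = 1 - x} = {t} := by
      ext x
      simp only [Set.mem_ofPred_eq, Set.mem_singleton_iff]
      constructor
      · rintro ⟨hx, hx'⟩
        rcases lt_trichotomy x t with h | h | h
        · exact absurd h (root_unique (by linarith) hx hx' hroot)
        · exact h
        · exact absurd h (root_unique (by linarith) ⟨hδ.trans hδt, ht1⟩ hroot hx')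
      · rintro rfl
        exact ⟨⟨hδ.trans hδt, ht1⟩, hroot⟩
    rw [this, csSup_singleton]
  rw [htheta]
  exact ⟨hδt, ht1, hroot, fun κ hκ => survival_chord hδt (by linarith) hroot hc.le hpos hκ⟩

lemma exp_neg_sub_le {x y : ℝ} (hx : 0 ≤ x) (hy : 0 ≤ y) :
    |Real.exp (-x) - Real.exp (-y)| ≤ |x - y| := by
  have key : ∀ {x y : ℝ}, 0 ≤ x → x ≤ y → Real.exp (-x) - Real.exp (-y) ≤ y - x := by
    intro x y hx hxy
    have h1 : Real.exp (-y) = Real.exp (-x) * Real.exp (-(y - x)) := by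
      rw [← Real.exp_add]; ring_nf
    have h2 := Real.one_sub_le_exp_neg (y - x)
    have h3 : Real.exp (-x) ≤ 1 := Real.exp_le_one_iff.2 (by linarith)
    have h4 := Real.exp_pos (-x)
    rw [h1]
    nlinarith
  rcases le_total x y with h | h
  · rw [abs_of_nonneg (by simpa using h), abs_of_nonpos (by linarith)]
    linarith [key hx h]
  · rw [abs_of_nonpos (by simpa using h), abs_of_nonneg (by linarith)]
    linarith [key hy h]

lemma continuousOn_theta {l β : ℝ} (hl : 1 < l) : ContinuousOn theta (Set.Icc l β) := by
  rcases le_or_gt l β with hlβ | hlβ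
  swap
  · rw [Set.Icc_eq_empty (not_le.2 hlβ)]
    exact continuousOn_empty _
  have hβ : 0 < β := by linarith
  set δ := (l - 1) / β ^ 2 with hδ
  have hl1 : 0 < l - 1 := by linarith
  have hδ0 : 0 < δ := by positivity
  have hc : 0 < δ * (l - 1) / 2 := by positivity
  have hlip : ∀ x ∈ Set.Icc l β, ∀ y ∈ Set.Icc l β,
      dist (theta x) (theta y) ≤ (δ * (l - 1) / 2)⁻¹ * dist x y := by
    intro x hx y hy
    obtain ⟨h1, h2, h3, -⟩ := theta_spec hl hx.1 hx.2 hδ0 le_rfl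
    obtain ⟨-, -, -, h4⟩ := theta_spec hl hy.1 hy.2 hδ0 le_rfl
    have h5 := h4 _ h1.le
    have e : 1 - Real.exp (-y * theta x) - theta x =
        Real.exp (-(x * theta x)) - Real.exp (-(y * theta x)) := by
      rw [← neg_mul, ← neg_mul, h3]; ring
    have hθ : 0 < theta x := hδ0.trans h1
    rw [e] at h5
    have h6 := h5.trans (exp_neg_sub_le (x := x * theta x) (y := y * theta x)
      (mul_nonneg (by linarith [hx.1]) hθ.le) (mul_nonneg (by linarith [hy.1]) hθ.le))
    rw [← sub_mul, abs_mul, abs_of_pos hθ] at h6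
    rw [Real.dist_eq, Real.dist_eq, inv_mul_eq_div, le_div_iff₀ hc]
    nlinarith [abs_nonneg (x - y)]
  exact (LipschitzOnWith.of_dist_le_mul
    (K := ⟨(δ * (l - 1) / 2)⁻¹, by positivity⟩) hlip).continuousOn

lemma aFix_spec {q : ℕ} (hq : 2 ≤ q) {β : ℝ} (hβ : (q : ℝ) < β) :
    1 / (q : ℝ) < aFix q β ∧ aFix q β ≤ 1 ∧ F q β (aFix q β) = aFix q β := by
  have hq2 : (2 : ℝ) ≤ q := by exact_mod_cast hq
  have hq0 : (0 : ℝ) < q := by linarith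
  have hl : 1 < β / q := by rwa [one_lt_div hq0]
  have hβ0 : 0 < β := by linarith
  have hq1 : 1 / (q : ℝ) < 1 := by rw [div_lt_one hq0]; linarith
  have hmaps : ∀ x ∈ Set.Icc (1 / (q : ℝ)) 1, β * x ∈ Set.Icc (β / q) β := by
    intro x hx
    constructor
    · rw [div_eq_mul_one_div]; exact mul_le_mul_of_nonneg_left hx.1 hβ0.le
    · nlinarith [hx.2]
  have hth : ∀ x ∈ Set.Icc (1 / (q : ℝ)) 1, 0 < theta (β * x) ∧ theta (β * x) < 1 := by
    intro x hx
    have hl1 : 0 < β / q - 1 := by linarith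
    have hδ0 : 0 < (β / q - 1) / β ^ 2 := by positivity
    obtain ⟨h1, h2, -⟩ := theta_spec hl (hmaps x hx).1 (hmaps x hx).2 hδ0 le_rfl
    exact ⟨hδ0.trans h1, h2⟩
  have hcont : ContinuousOn (F q β) (Set.Icc (1 / (q : ℝ)) 1) := by
    have h1 : ContinuousOn (fun x => theta (β * x)) (Set.Icc (1 / (q : ℝ)) 1) :=
      (continuousOn_theta hl).comp (by fun_prop) hmaps
    unfold F
    exact (continuousOn_const.add ((continuousOn_const.mul h1).mul continuousOn_id))
  have hq1' : 0 < 1 - 1 / (q : ℝ) := by linarith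
  have hlo : 1 / (q : ℝ) < F q β (1 / q) := by
    have := (hth (1 / q) ⟨le_rfl, hq1.le⟩).1
    unfold F
    have : 0 < (1 - 1 / (q : ℝ)) * theta (β * (1 / q)) * (1 / q) := by positivity
    linarith
  have hhi : F q β 1 < 1 := by
    have := (hth 1 ⟨hq1.le, le_rfl⟩).2
    unfold F
    nlinarith
  set S := {x : ℝ | x ∈ Set.Ioc (1 / (q : ℝ)) 1 ∧ F q β x = x} with hS
  have hSeq : S = Set.Icc (1 / (q : ℝ)) 1 ∩ (fun x => F q β x - x) ⁻¹' {0} := by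
    ext x
    simp only [hS, Set.mem_ofPred_eq, Set.mem_inter_iff, Set.mem_preimage, Set.mem_singleton_iff,
      sub_eq_zero]
    constructor
    · rintro ⟨h1, h2⟩
      exact ⟨⟨h1.1.le, h1.2⟩, h2⟩
    · rintro ⟨h1, h2⟩
      refine ⟨⟨lt_of_le_of_ne h1.1 ?_, h1.2⟩, h2⟩
      rintro rfl
      linarith
  have hcont' : ContinuousOn (fun x => F q β x - x) (Set.Icc (1 / (q : ℝ)) 1) :=
    hcont.sub continuousOn_id
  have hclosed : IsCompact S := by
    rw [hSeq]
    exact isCompact_Icc.of_isClosed_subset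
      (hcont'.preimage_isClosed_of_isClosed isClosed_Icc isClosed_singleton)
      Set.inter_subset_left
  have hne : S.Nonempty := by
    obtain ⟨x, hx, hx0⟩ := intermediate_value_Icc' hq1.le hcont'
      (⟨by linarith, by linarith⟩ : (0 : ℝ) ∈ Set.Icc (F q β 1 - 1) (F q β (1 / q) - 1 / q))
    rw [hSeq]
    exact ⟨x, hx, hx0⟩
  have hmem : aFix q β ∈ S := hclosed.sSup_mem hne
  exact ⟨hmem.1.1, hmem.1.2, hmem.2⟩

/-- In the majority phase the non-dominant spin classes are strictly subcritical. -/
lemma minority_subcritical {q : ℕ} (hq : 2 ≤ q) {β : ℝ} (hβ : (q : ℝ) < β) :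
    β * ((1 - aFix q β) / ((q : ℝ) - 1)) < 1 := by
  obtain ⟨h1, h2, h3⟩ := aFix_spec hq hβ
  set a := aFix q β
  have hq2 : (2 : ℝ) ≤ q := by exact_mod_cast hq
  have hq0 : (0 : ℝ) < q := by linarith
  have hβ0 : 0 < β := by linarith
  have hl : 1 < β / q := by rwa [one_lt_div hq0]
  have hl1 : 0 < β / q - 1 := by linarith
  have hδ0 : 0 < (β / q - 1) / β ^ 2 := by positivity
  have ha1 : β / q ≤ β * a := by
    rw [div_eq_mul_one_div]; exact mul_le_mul_of_nonneg_left h1.le hβ0.le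
  obtain ⟨ht0, ht1, ht, -⟩ := theta_spec hl ha1 (by nlinarith) hδ0 le_rfl
  set t := theta (β * a) with htdef
  have ht0' : 0 < t := hδ0.trans ht0
  have hF : 1 / (q : ℝ) + (1 - 1 / q) * t * a = a := h3
  have hb : (1 - a) / ((q : ℝ) - 1) = a * (1 - t) := by
    have : (q : ℝ) - 1 ≠ 0 := by linarith
    field_simp at hF ⊢
    linarith
  rw [hb, ← mul_assoc]
  have h1t : 0 < 1 - t := by linarith
  have hlog : β * a * t = Real.log (1 - t)⁻¹ := by
    rw [Real.log_inv, ← ht, Real.log_exp]; ring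
  have hlt := Real.log_lt_sub_one_of_pos (inv_pos.2 h1t) (by
    intro h
    rw [inv_eq_iff_eq_inv, inv_one] at h
    linarith)
  rw [← hlog] at hlt
  have e : (1 - t)⁻¹ - 1 = t * (1 - t)⁻¹ := by field_simp; ring
  rw [e, mul_comm, mul_lt_mul_iff_right₀ ht0', ← one_div, lt_div_iff₀ h1t] at hlt
  exact hlt

end theta

section mass

lemma exploreMass_tilt {s z : ℝ} (hs : s ∈ Set.Icc (0 : ℝ) 1) (hz : 0 < z) {N j : ℕ}
    (hj : j ≤ N) :
    N.choose j * (s ^ j * (1 - s) ^ (N - j)) ≤ z⁻¹ ^ j * Real.exp (-(N * s * (1 - z))) := by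
  have hs1 : 0 ≤ 1 - s := by linarith [hs.2]
  have hs0 := hs.1
  have h1 : (s * z) ^ j * (1 - s) ^ (N - j) * N.choose j ≤ (s * z + (1 - s)) ^ N := by
    rw [add_pow]
    exact Finset.single_le_sum (f := fun i => (s * z) ^ i * (1 - s) ^ (N - i) * (N.choose i : ℝ))
      (fun i _ => by positivity) (Finset.mem_range.2 (by omega))
  have h2 : (s * z + (1 - s)) ^ N ≤ Real.exp (-(N * s * (1 - z))) := by
    rw [show -(N * s * (1 - z)) = N * (s * z - s) by ring, Real.exp_nat_mul]
    refine pow_le_pow_left₀ (by positivity) ?_ _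
    linarith [Real.add_one_le_exp (s * z - s)]
  have h3 : N.choose j * (s ^ j * (1 - s) ^ (N - j)) =
      z⁻¹ ^ j * ((s * z) ^ j * (1 - s) ^ (N - j) * N.choose j) := by
    have : z⁻¹ ^ j * z ^ j = 1 := by rw [← mul_pow, inv_mul_cancel₀ hz.ne', one_pow]
    rw [mul_pow]
    linear_combination (-(N.choose j * (s ^ j * (1 - s) ^ (N - j)))) * this
  rw [h3]
  exact mul_le_mul_of_nonneg_left (h1.trans h2) (by positivity)

lemma exploreMass_nonneg {Q : ℝ} (hQ : Q ∈ Set.Icc (0 : ℝ) 1) (m r k : ℕ) :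
    0 ≤ exploreMass Q m r k := by
  have h0 := hQ.1
  have h1 := pow_le_one₀ (n := k) hQ.1 hQ.2
  have h2 : 0 ≤ 1 - Q ^ k := by linarith
  unfold exploreMass
  positivity

lemma exp_neg_mem_Icc {y : ℝ} (hy : 0 ≤ y) : Real.exp (-y) ∈ Set.Icc (0 : ℝ) 1 :=
  ⟨(Real.exp_pos _).le, Real.exp_le_one_iff.2 (by linarith)⟩

lemma sub_one_sub_log_pos {x : ℝ} (hx : 0 < x) (hx1 : x ≠ 1) : 0 < x - 1 - Real.log x := by
  linarith [Real.log_lt_sub_one_of_pos hx hx1]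

lemma small_drift {l β δ : ℝ} (hl : 1 < l) (hβ : 1 < β) (hδ0 : 0 ≤ δ)
    (hδ : δ * (2 * l * (1 + β)) ≤ l - 1) :
    δ ≤ 1 / 2 ∧ δ * β / 2 ≤ 1 / 2 ∧ (l + 1) / 2 ≤ l * ((1 - δ) * (1 - δ * β / 2)) := by
  have h1 : l * (δ * (1 + β)) ≤ (l - 1) / 2 := by linarith
  have h2 : 0 ≤ δ * β := by positivity
  have h3 : δ * (1 + β) ≤ 1 / 2 := by
    by_contra hcon
    push Not at hcon
    have := mul_lt_mul_of_pos_left hcon (by linarith : 0 < l)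
    linarith
  have h4 : 1 - δ * (1 + β) ≤ (1 - δ) * (1 - δ * β / 2) := by
    have : 0 ≤ δ * (δ * β) := by positivity
    linarith
  refine ⟨by linarith, by linarith, ?_⟩
  have := mul_le_mul_of_nonneg_left h4 (by linarith : 0 ≤ l)
  linarith

/-- Clusters of intermediate size are exponentially unlikely in the supercritical regime. -/
lemma exploreMass_small {l β δ y : ℝ} (hl : 1 < l) (hδ0 : 0 ≤ δ)
    (hδ : δ ≤ (l - 1) / (2 * l * (1 + β))) {m r k : ℕ} (hy : 0 ≤ y) (hly : l ≤ y * m)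
    (hyβ : y * m ≤ β) (hrk : r ≤ k) (hkm : k ≤ m) (hk : (k : ℝ) ≤ δ * m) :
    exploreMass (Real.exp (-y)) m r k ≤
      Real.exp (-((((l + 1) / 2) - 1 - Real.log ((l + 1) / 2)) * k)) := by
  set l2 := (l + 1) / 2 with hl2
  have hl2' : 1 < l2 := by rw [hl2]; linarith
  have hβ : 1 < β := by linarith
  have hQ := exp_neg_mem_Icc hy
  set s := 1 - Real.exp (-y) ^ k with hs
  have hs1 : 1 - s = Real.exp (-y) ^ k := by rw [hs]; ring
  have hpow := pow_le_one₀ (n := k) hQ.1 hQ.2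
  have hpow0 := pow_nonneg hQ.1 k
  have hsI : s ∈ Set.Icc (0 : ℝ) 1 := ⟨by linarith, by linarith⟩
  have h1 := exploreMass_tilt hsI (z := l2⁻¹) (by positivity) (N := m - r) (j := k - r) (by omega)
  have h2 : m - r - (k - r) = m - k := by omega
  have h3 : exploreMass (Real.exp (-y)) m r k ≤
      l2 ^ (k - r) * Real.exp (-((m - r : ℕ) * s * (1 - l2⁻¹))) := by
    rw [inv_inv, h2, hs1] at h1
    exact h1
  refine h3.trans ?_
  have hl0 : 0 < l2 := by linarith
  have h4 : l2 ^ (k - r) ≤ Real.exp (k * Real.log l2) := by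
    rw [Real.exp_nat_mul, Real.exp_log hl0]
    exact pow_le_pow_right₀ hl2'.le (by omega)
  -- lower bound for the mean
  have h5 : y * k - (y * k) ^ 2 / 2 ≤ s := by
    have := exp_neg_le_quadratic (y := y * k) (by positivity)
    have e : Real.exp (-y) ^ k = Real.exp (-(y * k)) := by rw [← Real.exp_nat_mul]; ring_nf
    rw [hs, e]; linarith
  have hyk : y * k ≤ δ * β := by
    calc y * k ≤ y * (δ * m) := by gcongr
      _ = δ * (y * m) := by ring
      _ ≤ δ * β := by gcongr
  have hyk0 : 0 ≤ y * k := by positivity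
  have h6 : y * k * (1 - δ * β / 2) ≤ s := by nlinarith
  have hδ' : δ * (2 * l * (1 + β)) ≤ l - 1 := by
    rwa [le_div_iff₀ (by positivity)] at hδ
  have hN : (1 - δ) * m ≤ ((m - r : ℕ) : ℝ) := by
    rw [Nat.cast_sub (by omega)]
    have : (r : ℝ) ≤ k := by exact_mod_cast hrk
    linarith
  obtain ⟨hδ1, hδβ, a3⟩ := small_drift hl hβ hδ0 hδ'
  have h7 : l2 * k ≤ (m - r : ℕ) * s := by
    have hk0 : (0 : ℝ) ≤ k := by positivity
    have a1 : (1 - δ) * m * (y * k * (1 - δ * β / 2)) ≤ (m - r : ℕ) * s :=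
      mul_le_mul hN h6 (mul_nonneg hyk0 (by linarith)) (Nat.cast_nonneg _)
    have a2 : l * ((1 - δ) * (1 - δ * β / 2)) ≤ y * m * ((1 - δ) * (1 - δ * β / 2)) :=
      mul_le_mul_of_nonneg_right hly (mul_nonneg (by linarith) (by linarith))
    have a4 := mul_le_mul_of_nonneg_right (a3.trans a2) hk0
    calc l2 * k ≤ _ := a4
      _ = (1 - δ) * m * (y * k * (1 - δ * β / 2)) := by ring
      _ ≤ _ := a1
  have hz : 0 ≤ 1 - l2⁻¹ := by
    have := inv_le_one_of_one_le₀ hl2'.le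
    linarith
  have h8 : Real.exp (-((m - r : ℕ) * s * (1 - l2⁻¹))) ≤ Real.exp (-(l2 * k * (1 - l2⁻¹))) :=
    Real.exp_le_exp.2 (neg_le_neg (mul_le_mul_of_nonneg_right h7 hz))
  refine (mul_le_mul h4 h8 (Real.exp_pos _).le (Real.exp_pos _).le).trans (le_of_eq ?_)
  rw [← Real.exp_add]
  congr 1
  field_simp
  ring

/-- Exponential decay of cluster sizes in the subcritical regime. -/
lemma exploreMass_subcritical {μ y : ℝ} (hμ0 : 0 < μ) (hμ1 : μ < 1) {m k : ℕ} (hy : 0 ≤ y)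
    (hym : y * m ≤ μ) (hk : 1 ≤ k) (hkm : k ≤ m) :
    exploreMass (Real.exp (-y)) m 1 k ≤
      μ⁻¹ * Real.exp (-((μ - 1 - Real.log μ) * k)) := by
  have hQ := exp_neg_mem_Icc hy
  set s := 1 - Real.exp (-y) ^ k with hs
  have hs1 : 1 - s = Real.exp (-y) ^ k := by rw [hs]; ring
  have hpow := pow_le_one₀ (n := k) hQ.1 hQ.2
  have hpow0 := pow_nonneg hQ.1 k
  have hsI : s ∈ Set.Icc (0 : ℝ) 1 := ⟨by linarith, by linarith⟩
  have h1 := exploreMass_tilt hsI (z := μ⁻¹) (by positivity) (N := m - 1) (j := k - 1) (by omega)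
  have h2 : m - 1 - (k - 1) = m - k := by omega
  have h3 : exploreMass (Real.exp (-y)) m 1 k ≤
      μ ^ (k - 1) * Real.exp (-((m - 1 : ℕ) * s * (1 - μ⁻¹))) := by
    rw [inv_inv, h2, hs1] at h1
    exact h1
  refine h3.trans ?_
  have h4 : μ ^ (k - 1) = μ⁻¹ * Real.exp (k * Real.log μ) := by
    rw [Real.exp_nat_mul, Real.exp_log hμ0]
    obtain ⟨k', rfl⟩ := Nat.exists_eq_add_of_le hk
    rw [Nat.add_sub_cancel_left, pow_add, pow_one, inv_mul_cancel_left₀ hμ0.ne']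
  have h5 : s ≤ y * k := by
    have := Real.one_sub_le_exp_neg (y * k)
    have e : Real.exp (-y) ^ k = Real.exp (-(y * k)) := by rw [← Real.exp_nat_mul]; ring_nf
    rw [hs, e]; linarith
  have h6 : (m - 1 : ℕ) * s ≤ μ * k := by
    have : ((m - 1 : ℕ) : ℝ) ≤ m := by exact_mod_cast Nat.sub_le _ _
    calc (m - 1 : ℕ) * s ≤ m * (y * k) := mul_le_mul this h5 hsI.1 (by positivity)
      _ = y * m * k := by ring
      _ ≤ μ * k := by gcongr
  have hz : 0 ≤ μ⁻¹ - 1 := by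
    have := (one_le_inv₀ hμ0).2 hμ1.le
    linarith
  have h8 : Real.exp (-((m - 1 : ℕ) * s * (1 - μ⁻¹))) ≤ Real.exp (μ * k * (μ⁻¹ - 1)) :=
    Real.exp_le_exp.2 (by nlinarith [mul_le_mul_of_nonneg_right h6 hz])
  rw [h4, mul_assoc]
  refine mul_le_mul_of_nonneg_left ?_ (by positivity)
  refine (mul_le_mul_of_nonneg_left h8 (Real.exp_pos _).le).trans (le_of_eq ?_)
  rw [← Real.exp_add]
  congr 1
  field_simp
  ring

/-- Pinsker-type comparison of a Bernoulli likelihood with its maximum. -/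
lemma bernoulli_likelihood_le {s : ℝ} (hs : s ∈ Set.Ioo (0 : ℝ) 1) {N j : ℕ} (hj0 : 0 < j)
    (hj : j ≤ N) :
    s ^ j * (1 - s) ^ (N - j) ≤ ((j : ℝ) / N) ^ j * (1 - (j : ℝ) / N) ^ (N - j) *
      Real.exp (-(N * ((j : ℝ) / N - s) ^ 2 / 2)) := by
  obtain ⟨hs0, hs1⟩ := hs
  have hN : (0 : ℝ) < N := by exact_mod_cast hj0.trans_le hj
  rcases hj.eq_or_lt with rfl | hjN
  · rw [div_self hN.ne', Nat.sub_self, pow_zero, pow_zero, one_pow, mul_one, mul_one, one_mul]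
    rw [show -(j * (1 - s) ^ 2 / 2) = j * (-((1 - s) ^ 2 / 2)) by ring, Real.exp_nat_mul]
    refine pow_le_pow_left₀ hs0.le ?_ _
    have := Real.one_sub_le_exp_neg ((1 - s) ^ 2 / 2)
    nlinarith
  · set x := (j : ℝ) / N with hx
    have hj0' : (0 : ℝ) < j := by exact_mod_cast hj0
    have hx0 : 0 < x := by positivity
    have hx1 : x < 1 := by rw [hx, div_lt_one hN]; exact_mod_cast hjN
    have hx1' : 0 < 1 - x := by linarith
    have hs1' : 0 < 1 - s := by linarith
    have ej : (j : ℝ) = N * x := by rw [hx]; field_simp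
    have eNj : ((N - j : ℕ) : ℝ) = N * (1 - x) := by rw [Nat.cast_sub hj, ej]; ring
    rw [← Real.log_le_log_iff (by positivity) (by positivity),
      Real.log_mul (by positivity) (Real.exp_pos _).ne', Real.log_mul (by positivity)
      (by positivity), Real.log_mul (by positivity) (by positivity), Real.log_exp,
      Real.log_pow, Real.log_pow, Real.log_pow, Real.log_pow, eNj, ej]
    set u := √x
    set u' := √(1 - x)
    set v := √s
    set v' := √(1 - s)
    have hu : 0 < u := Real.sqrt_pos.2 hx0
    have hu' : 0 < u' := Real.sqrt_pos.2 hx1'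
    have hv : 0 < v := Real.sqrt_pos.2 hs0
    have hv' : 0 < v' := Real.sqrt_pos.2 hs1'
    have eu : x = u ^ 2 := (Real.sq_sqrt hx0.le).symm
    have eu' : 1 - x = u' ^ 2 := (Real.sq_sqrt hx1'.le).symm
    have ev : s = v ^ 2 := (Real.sq_sqrt hs0.le).symm
    have ev' : 1 - s = v' ^ 2 := (Real.sq_sqrt hs1'.le).symm
    have key : ∀ {u v w t : ℝ}, 0 < u → 0 < v → w = u ^ 2 → t = v ^ 2 →
        w * Real.log t ≤ w * Real.log w + 2 * (u * v - u ^ 2) := by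
      intro u v w t hu hv hw ht
      have h1 := Real.log_le_sub_one_of_pos (div_pos hv hu)
      rw [Real.log_div hv.ne' hu.ne'] at h1
      have h2 := mul_le_mul_of_nonneg_left h1 (by positivity : 0 ≤ 2 * u ^ 2)
      have h3 : 2 * u ^ 2 * (v / u - 1) = 2 * (u * v - u ^ 2) := by field_simp
      rw [hw, ht, Real.log_pow, Real.log_pow]
      push_cast
      linarith
    have k1 := key hu hv eu ev
    have k2 := key hu' hv' eu' ev'
    have k3 : (x - s) ^ 2 ≤ 2 * ((u - v) ^ 2 + (u' - v') ^ 2) := by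
      have a1 : (x - s) ^ 2 = (u - v) ^ 2 * (u + v) ^ 2 := by rw [eu, ev]; ring
      have a2 : (x - s) ^ 2 = (u' - v') ^ 2 * (u' + v') ^ 2 := by
        rw [show x - s = (1 - s) - (1 - x) by ring, eu', ev']; ring
      have b1 : (u + v) ^ 2 ≤ 4 := by nlinarith [sq_nonneg (u - v)]
      have b2 : (u' + v') ^ 2 ≤ 4 := by nlinarith [sq_nonneg (u' - v')]
      nlinarith [mul_le_mul_of_nonneg_left b1 (sq_nonneg (u - v)),
        mul_le_mul_of_nonneg_left b2 (sq_nonneg (u' - v'))]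
    have k4 : x * Real.log s + (1 - x) * Real.log (1 - s) ≤
        x * Real.log x + (1 - x) * Real.log (1 - x) - (x - s) ^ 2 / 2 := by
      nlinarith
    have := mul_le_mul_of_nonneg_left k4 hN.le
    linarith

lemma bernoulli_mass_le_one {x : ℝ} (hx : x ∈ Set.Icc (0 : ℝ) 1) {N j : ℕ} (hj : j ≤ N) :
    N.choose j * (x ^ j * (1 - x) ^ (N - j)) ≤ 1 := by
  have := exploreMass_tilt hx one_pos hj
  simpa using this

lemma factorial_le_stirling {N : ℕ} (hN : 1 ≤ N) :
    (N.factorial : ℝ) ≤ Real.exp 1 * √N * (N / Real.exp 1) ^ N := by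
  obtain ⟨k, rfl⟩ := Nat.exists_eq_add_of_le' hN
  have h := Stirling.stirlingSeq'_antitone (Nat.zero_le k)
  simp only [Function.comp, Nat.succ_eq_add_one, zero_add, Stirling.stirlingSeq_one] at h
  rw [Stirling.stirlingSeq, div_le_iff₀ (by positivity)] at h
  refine h.trans (le_of_eq ?_)
  rw [Real.sqrt_mul (by norm_num)]
  have : (√2 : ℝ) ≠ 0 := by positivity
  field_simp

/-- Local limit bound for the binomial mass at its mean. -/
lemma bernoulli_mass_le_sqrt {N j : ℕ} (hj0 : 0 < j) (hj : j < N) :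
    N.choose j * (((j : ℝ) / N) ^ j * (1 - (j : ℝ) / N) ^ (N - j)) ≤
      √(N / (j * (N - j : ℕ))) := by
  obtain ⟨i, hi⟩ := Nat.exists_eq_add_of_lt hj
  set i' := i + 1 with hi'
  have hN : N = j + i' := by omega
  have hNj : N - j = i' := by omega
  rw [hNj]
  have hi0 : 0 < i' := by omega
  have j0 : (0 : ℝ) < j := by exact_mod_cast hj0
  have i0 : (0 : ℝ) < i' := by exact_mod_cast hi0
  have N0 : (0 : ℝ) < N := by exact_mod_cast (by omega : 0 < N)
  have hc : (N.choose j : ℝ) * (j.factorial * i'.factorial) = N.factorial := by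
    have := Nat.choose_mul_factorial_mul_factorial hj.le
    rw [hNj] at this
    rw [← mul_assoc]
    exact_mod_cast this
  have hx : 1 - (j : ℝ) / N = i' / N := by
    have : (N : ℝ) = j + i' := by exact_mod_cast hN
    field_simp
    linarith
  rw [hx]
  have hfj := Stirling.le_factorial_stirling j
  have hfi := Stirling.le_factorial_stirling i'
  have hfN := factorial_le_stirling (by omega : 1 ≤ N)
  set e := Real.exp 1 with he
  have e0 : 0 < e := Real.exp_pos 1
  set A := ((j : ℝ) / e) ^ j with hA
  set B := ((i' : ℝ) / e) ^ i' with hB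
  have hA0 : 0 < A := by positivity
  have hB0 : 0 < B := by positivity
  have hkey : ((N : ℝ) / e) ^ N * (((j : ℝ) / N) ^ j * ((i' : ℝ) / N) ^ i') = A * B := by
    have h1 : ((N : ℝ) / e) ^ N = ((N : ℝ) / e) ^ j * ((N : ℝ) / e) ^ i' := by
      rw [← pow_add, ← hN]
    rw [h1, mul_mul_mul_comm, ← mul_pow, ← mul_pow]
    congr 2 <;> field_simp
  have hpi : √(2 * Real.pi * j) * √(2 * Real.pi * i') = 2 * Real.pi * √(j * i') := by
    rw [← Real.sqrt_mul (by positivity),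
      show 2 * Real.pi * j * (2 * Real.pi * i') = (2 * Real.pi) ^ 2 * (j * i') by ring,
      Real.sqrt_mul (by positivity), Real.sqrt_sq (by positivity)]
  have hlow : 2 * Real.pi * √(j * i') * (A * B) ≤ j.factorial * i'.factorial := by
    have := mul_le_mul hfj hfi (by positivity) (by positivity)
    calc 2 * Real.pi * √(j * i') * (A * B)
        = √(2 * Real.pi * j) * √(2 * Real.pi * i') * (A * B) := by rw [hpi]
      _ = √(2 * Real.pi * j) * A * (√(2 * Real.pi * i') * B) := by ring
      _ ≤ _ := this
  set T := (((j : ℝ) / N) ^ j * ((i' : ℝ) / N) ^ i') with hT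
  have hT0 : 0 < T := by positivity
  have hup : (N.choose j : ℝ) * T * (2 * Real.pi * √(j * i') * (A * B)) ≤
      e * √N * (A * B) := by
    calc (N.choose j : ℝ) * T * (2 * Real.pi * √(j * i') * (A * B))
        ≤ (N.choose j : ℝ) * T * (j.factorial * i'.factorial) := by gcongr
      _ = N.factorial * T := by rw [← hc]; ring
      _ ≤ e * √N * (N / e) ^ N * T := by gcongr
      _ = e * √N * (A * B) := by rw [← hkey]; ring
  have hup2 : (N.choose j : ℝ) * T * (2 * Real.pi * √(j * i')) ≤ e * √N := by
    rw [← mul_assoc] at hup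
    exact le_of_mul_le_mul_right hup (by positivity)
  have he3 : e ≤ 2 * Real.pi := by
    have := Real.exp_one_lt_d9
    have := Real.pi_gt_three
    rw [he]; linarith
  rw [Real.sqrt_div (by positivity), le_div_iff₀ (by positivity)]
  have hs0 : 0 ≤ √(N : ℝ) := Real.sqrt_nonneg _
  have h3 : 2 * Real.pi * ((N.choose j : ℝ) * T * √(j * i')) ≤ 2 * Real.pi * √N := by
    nlinarith
  exact le_of_mul_le_mul_left h3 (by positivity)

lemma sum_cauchy_kernel_le {s : ℝ} (hs : 1 ≤ s) (τ : ℝ) (K : ℕ) :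
    ∑ k ∈ Finset.range K, s ^ 2 / (s + |k - τ|) ^ 2 ≤ 8 * s := by
  set Ψ : ℝ → ℝ := fun y => y / (s + |y|) with hΨ
  have hstep : ∀ y : ℝ, s / (s + |y|) ^ 2 ≤ 4 * (Ψ (y + 1) - Ψ y) := by
    intro y
    simp only [hΨ]
    rcases le_or_gt 0 y with h | h
    · rw [abs_of_nonneg h, abs_of_nonneg (by linarith : 0 ≤ y + 1), div_sub_div _ _ (by positivity)
        (by positivity), ← mul_div_assoc, div_le_div_iff₀ (by positivity) (by positivity)]
      nlinarith [mul_nonneg (mul_nonneg (by linarith : 0 ≤ s) (by linarith : 0 ≤ s + y))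
        (by linarith : 0 ≤ 3 * (s + y) - 1)]
    · rw [abs_of_neg h]
      rcases le_or_gt (y + 1) 0 with h1 | h1
      · rw [abs_of_nonpos h1, div_sub_div _ _ (by linarith) (by linarith), ← mul_div_assoc,
          div_le_div_iff₀ (pow_pos (by linarith) 2) (mul_pos (by linarith) (by linarith))]
        have h2 : 0 < s + -y := by linarith
        nlinarith [mul_pos (mul_pos (by linarith : 0 < s) h2) h2, mul_pos (by linarith : 0 < s) h2]
      · rw [abs_of_pos h1]
        have h2 : s / (s + -y) ^ 2 ≤ 1 / s := by
          rw [div_le_div_iff₀ (pow_pos (by linarith) 2) (by linarith)]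
          nlinarith
        have h3 : (y + 1) / (s + 1) ≤ (y + 1) / (s + (y + 1)) := by
          apply div_le_div_of_nonneg_left <;> linarith
        have h4 : -y / (s + 1) ≤ -y / (s + -y) := by
          apply div_le_div_of_nonneg_left <;> linarith
        have h5 : 1 / s ≤ 4 * (1 / (s + 1)) := by
          rw [← mul_div_assoc, div_le_div_iff₀ (by linarith) (by linarith)]
          linarith
        have h6 : (y + 1) / (s + 1) + -y / (s + 1) = 1 / (s + 1) := by
          rw [← add_div]; ring_nf
        have h7 : y / (s + -y) = -(-y / (s + -y)) := by rw [neg_div, neg_neg]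
        rw [h7]
        linarith
  have hΨ1 : ∀ y, |Ψ y| ≤ 1 := by
    intro y
    simp only [hΨ]
    have h0 : 0 < s + |y| := by have := abs_nonneg y; linarith
    rw [abs_div, abs_of_pos h0, div_le_one h0]
    linarith
  have h1 : ∀ k ∈ Finset.range K, s ^ 2 / (s + |k - τ|) ^ 2 ≤
      4 * s * (Ψ ((k + 1 : ℕ) - τ) - Ψ (k - τ)) := by
    intro k _
    have := mul_le_mul_of_nonneg_left (hstep (k - τ)) (by linarith : 0 ≤ s)
    rw [show ((k + 1 : ℕ) : ℝ) - τ = k - τ + 1 by push_cast; ring]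
    calc s ^ 2 / (s + |k - τ|) ^ 2 = s * (s / (s + |k - τ|) ^ 2) := by ring
      _ ≤ _ := this
      _ = _ := by ring
  refine (Finset.sum_le_sum h1).trans ?_
  rw [← Finset.mul_sum, Finset.sum_range_sub (fun k : ℕ => Ψ (k - τ))]
  have a := abs_le.1 (hΨ1 (K - τ))
  have b := abs_le.1 (hΨ1 ((0 : ℕ) - τ))
  nlinarith

end mass

section secondMoment

lemma exp_neg_le_inv {t : ℝ} (ht : 0 < t) : Real.exp (-t) ≤ 1 / t := by
  rw [Real.exp_neg, ← one_div]
  exact one_div_le_one_div_of_le ht (by linarith [Real.add_one_le_exp t])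

/-- Gaussian comparison of the cluster-size bound with a binomial mass at its mean. -/
lemma exploreMass_le_gauss {l β δ y : ℝ} (hl : 1 < l) (hδ0 : 0 < δ) (hδ : δ ≤ (l - 1) / β ^ 2)
    {m r k : ℕ} (hm : 4 / δ ≤ m) (hm4 : 4 ≤ m) (hr : r ≤ 2) (hly : l ≤ y * m) (hyβ : y * m ≤ β)
    (hk : δ * m ≤ k) (hkm : k ≤ m) :
    exploreMass (Real.exp (-y)) m r k ≤
      (m - r).choose (k - r) * ((((k - r : ℕ) : ℝ) / (m - r : ℕ)) ^ (k - r) *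
        (1 - ((k - r : ℕ) : ℝ) / (m - r : ℕ)) ^ (m - r - (k - r))) *
      (Real.exp 1 * Real.exp (-((δ * (l - 1) / 2) ^ 2 / 8 * (k - theta (y * m) * m) ^ 2 / m))) := by
  obtain ⟨-, -, -, hθ⟩ := theta_spec hl hly hyβ hδ0 hδ
  set θ := theta (y * m)
  set c0 := δ * (l - 1) / 2 with hc0
  have hc0' : 0 < c0 := by rw [hc0]; have : 0 < l - 1 := by linarith
                           positivity
  have hm4' : (4 : ℝ) ≤ m := by exact_mod_cast hm4
  have hm0 : (0 : ℝ) < m := by linarith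
  have hy0 : 0 < y := by
    by_contra hcon
    push Not at hcon
    nlinarith
  have hk4 : (4 : ℝ) ≤ k := by
    rw [div_le_iff₀ hδ0] at hm
    linarith
  have hk4' : 4 ≤ k := by exact_mod_cast hk4
  have hr' : (r : ℝ) ≤ 2 := by exact_mod_cast hr
  have hkm' : (k : ℝ) ≤ m := by exact_mod_cast hkm
  have hs : 1 - Real.exp (-y) ^ k ∈ Set.Ioo (0 : ℝ) 1 := by
    have h1 : 0 < Real.exp (-y) ^ k := by positivity
    have h2 : Real.exp (-y) ^ k < 1 :=
      pow_lt_one₀ (Real.exp_pos _).le (Real.exp_lt_one_iff.2 (by linarith)) (by omega)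
    exact ⟨by linarith, by linarith⟩
  have hL := bernoulli_likelihood_le hs (N := m - r) (j := k - r) (by omega) (by omega)
  have hNj : m - r - (k - r) = m - k := by omega
  have e1 : Real.exp (-y) ^ k = Real.exp (-(y * m) * (k / m)) := by
    rw [← Real.exp_nat_mul]; congr 1; field_simp
  have hκ := hθ (k / m) (by rwa [le_div_iff₀ hm0])
  rw [← e1] at hκ
  set s := 1 - Real.exp (-y) ^ k with hsdef
  set x := ((k - r : ℕ) : ℝ) / (m - r : ℕ) with hx
  have hN : ((m - r : ℕ) : ℝ) = m - r := Nat.cast_sub (by omega)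
  have hj : ((k - r : ℕ) : ℝ) = k - r := Nat.cast_sub (by omega)
  have hr0 : (0 : ℝ) ≤ r := Nat.cast_nonneg _
  have hN0 : (0 : ℝ) < m - r := by linarith
  have hxκ : (k / m - x) ^ 2 ≤ (2 / m) ^ 2 := by
    have e : (k : ℝ) / m - x = r / m * ((m - k) / (m - r)) := by
      rw [hx, hN, hj]; field_simp; ring
    have h1 : (m - k : ℝ) / (m - r) ≤ 1 := by rw [div_le_one hN0]; linarith
    have h0 : 0 ≤ (m - k : ℝ) / (m - r) := div_nonneg (by linarith) hN0.le
    have h2 : (r : ℝ) / m ≤ 2 / m := by gcongr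
    rw [e]
    refine pow_le_pow_left₀ (by positivity) ?_ 2
    calc _ ≤ (r : ℝ) / m * 1 := by gcongr
      _ ≤ _ := by linarith
  have hκs : (c0 * ((k - θ * m) / m)) ^ 2 ≤ (s - k / m) ^ 2 := by
    rw [← sq_abs (s - k / m), ← sq_abs (c0 * _), abs_mul, abs_of_pos hc0']
    refine pow_le_pow_left₀ (by positivity) ?_ 2
    have : (k - θ * m) / m = k / m - θ := by field_simp
    rw [this]
    exact hκ
  have hxs : (c0 * ((k - θ * m) / m)) ^ 2 / 2 - (2 / m) ^ 2 ≤ (x - s) ^ 2 := by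
    nlinarith [sq_nonneg ((x - s) - (k / m - x))]
  have hexp : c0 ^ 2 / 8 * (k - θ * m) ^ 2 / m - 1 ≤ (m - r : ℕ) * (x - s) ^ 2 / 2 := by
    rw [hN]
    have h1 : ((m : ℝ) - r) * ((c0 * ((k - θ * m) / m)) ^ 2 / 2 - (2 / m) ^ 2) ≤
        (m - r) * (x - s) ^ 2 := mul_le_mul_of_nonneg_left hxs hN0.le
    have h2 : (m : ℝ) / 2 * ((c0 * ((k - θ * m) / m)) ^ 2 / 2) ≤
        (m - r) * ((c0 * ((k - θ * m) / m)) ^ 2 / 2) :=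
      mul_le_mul_of_nonneg_right (by linarith) (by positivity)
    have h3 : ((m : ℝ) - r) * (2 / m) ^ 2 ≤ m * (2 / m) ^ 2 :=
      mul_le_mul_of_nonneg_right (by linarith) (by positivity)
    have h4 : (m : ℝ) * (2 / m) ^ 2 = 4 / m := by field_simp; ring
    have h5 : (4 : ℝ) / m ≤ 1 := by rw [div_le_one hm0]; exact hm4'
    have h6 : (m : ℝ) / 2 * ((c0 * ((k - θ * m) / m)) ^ 2 / 2) =
        2 * (c0 ^ 2 / 8 * (k - θ * m) ^ 2 / m) := by field_simp; ring
    linarith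
  have hs1 : Real.exp (-y) ^ k = 1 - s := by rw [hsdef]; ring
  rw [exploreMass, hs1, show 1 - (1 - s) = s by ring, ← hNj, mul_assoc]
  refine mul_le_mul_of_nonneg_left (hL.trans ?_) (Nat.cast_nonneg _)
  have hx1 : 0 ≤ 1 - x := by
    rw [hx, hN, hj]
    have : (k - r : ℝ) / (m - r) ≤ 1 := by rw [div_le_one hN0]; linarith
    linarith
  refine mul_le_mul_of_nonneg_left ?_ (by positivity)
  rw [← Real.exp_add]
  exact Real.exp_le_exp.2 (by linarith)

/-- Local Gaussian bound for the sizes of large clusters. -/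
lemma exploreMass_le_local {l β δ : ℝ} (hl : 1 < l) (hδ0 : 0 < δ) (hδ : δ ≤ (l - 1) / β ^ 2) :
    ∃ c K : ℝ, 0 < c ∧ 0 < K ∧ ∀ (y : ℝ) (m r k : ℕ), 4 / δ ≤ m → 4 ≤ m → r ≤ 2 → l ≤ y * m →
      y * m ≤ β → δ * m ≤ k → k ≤ m → exploreMass (Real.exp (-y)) m r k ≤
        K / √m * Real.exp (-(c * (k - theta (y * m) * m) ^ 2 / m)) := by
  set c1 := (δ * (l - 1) / 2) ^ 2 / 8 with hc1
  have hl0 : 0 < l - 1 := by linarith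
  have hc1' : 0 < c1 := by rw [hc1]; positivity
  set h := Real.exp (-β) / 2 with hh
  have hh0 : 0 < h := by rw [hh]; positivity
  refine ⟨c1 / 2, Real.exp 1 * (√(2 / (δ * h)) + 1 / (c1 / 2 * h ^ 2)), by positivity,
    by positivity, ?_⟩
  intro y m r k hm hm4 hr hly hyβ hk hkm
  have hgauss := exploreMass_le_gauss hl hδ0 hδ hm hm4 hr hly hyβ hk hkm
  obtain ⟨hθδ, hθ1, hθe, -⟩ := theta_spec hl hly hyβ hδ0 hδ
  set θ := theta (y * m)
  set d := k - θ * m with hd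
  rw [← hc1] at hgauss
  have hm4' : (4 : ℝ) ≤ m := by exact_mod_cast hm4
  have hm0 : (0 : ℝ) < m := by linarith
  have hk4 : (4 : ℝ) ≤ k := by
    rw [div_le_iff₀ hδ0] at hm
    linarith
  have hk4' : 4 ≤ k := by exact_mod_cast hk4
  have hr' : (r : ℝ) ≤ 2 := by exact_mod_cast hr
  have hkm' : (k : ℝ) ≤ m := by exact_mod_cast hkm
  have hr0 : (0 : ℝ) ≤ r := Nat.cast_nonneg _
  have hN : ((m - r : ℕ) : ℝ) = m - r := Nat.cast_sub (by omega)
  have hj : ((k - r : ℕ) : ℝ) = k - r := Nat.cast_sub (by omega)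
  set G := ((m - r).choose (k - r) : ℝ) * ((((k - r : ℕ) : ℝ) / (m - r : ℕ)) ^ (k - r) *
        (1 - ((k - r : ℕ) : ℝ) / (m - r : ℕ)) ^ (m - r - (k - r))) with hG
  have hsm : 0 < √(m : ℝ) := Real.sqrt_pos.2 hm0
  have key : G * Real.exp (-(c1 * d ^ 2 / m)) ≤ (√(2 / (δ * h)) + 1 / (c1 / 2 * h ^ 2)) / √m *
      Real.exp (-(c1 / 2 * d ^ 2 / m)) := by
    rcases le_or_gt (h * m) (m - k) with hc | hc
    · have h1 : G ≤ √(2 / (δ * h)) / √m := by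
        have hlt : k - r < m - r := by
          have h1 : (0 : ℝ) < m - k := lt_of_lt_of_le (by positivity) hc
          have : (k : ℝ) < m := by linarith
          have : k < m := by exact_mod_cast this
          omega
        refine (bernoulli_mass_le_sqrt (by omega) hlt).trans ?_
        rw [← Real.sqrt_div (by positivity)]
        apply Real.sqrt_le_sqrt
        have hNj : m - r - (k - r) = m - k := by omega
        rw [hNj, hN, hj, Nat.cast_sub hkm, div_div]
        have h2 : δ * m / 2 ≤ k - r := by linarith
        have h3 : (δ * m / 2) * (h * m) ≤ (k - r) * (m - k) :=
          mul_le_mul h2 hc (by positivity) (by linarith)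
        calc ((m : ℝ) - r) / ((k - r) * (m - k)) ≤ m / ((δ * m / 2) * (h * m)) := by
              apply div_le_div₀ hm0.le (by linarith) (by positivity) h3
          _ = 2 / (δ * h * m) := by field_simp
      have h2 : Real.exp (-(c1 * d ^ 2 / m)) ≤ Real.exp (-(c1 / 2 * d ^ 2 / m)) := by
        apply Real.exp_le_exp.2
        have : 0 ≤ c1 * d ^ 2 / m := by positivity
        have e : c1 / 2 * d ^ 2 / m = c1 * d ^ 2 / m / 2 := by ring
        linarith
      refine mul_le_mul (h1.trans ?_) h2 (Real.exp_pos _).le (by positivity)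
      gcongr
      have : 0 ≤ 1 / (c1 / 2 * h ^ 2) := by positivity
      linarith
    · have hθh : 2 * h ≤ 1 - θ := by
        rw [← hθe, hh, mul_div_cancel₀ _ two_ne_zero]
        apply Real.exp_le_exp.2
        have : y * m * θ ≤ y * m * 1 :=
          mul_le_mul_of_nonneg_left hθ1.le (by linarith)
        linarith
      have hdh : h * m ≤ d := by
        have := mul_le_mul_of_nonneg_right hθh hm0.le
        rw [hd]
        linarith
      have hG1 : G ≤ 1 := by
        apply bernoulli_mass_le_one _ (by omega)
        have hN0 : (0 : ℝ) < m - r := by linarith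
        refine ⟨by positivity, ?_⟩
        rw [hN, hj, div_le_one hN0]
        linarith
      have h1 : Real.exp (-(c1 / 2 * d ^ 2 / m)) ≤ 1 / (c1 / 2 * h ^ 2) / √m := by
        have h2 : (h * m) ^ 2 ≤ d ^ 2 := pow_le_pow_left₀ (by positivity) hdh 2
        have h3 : c1 / 2 * h ^ 2 * m ≤ c1 / 2 * d ^ 2 / m := by
          rw [le_div_iff₀ hm0]
          nlinarith
        have h4 : √(m : ℝ) ≤ m := Real.sqrt_le_iff.2 ⟨hm0.le, by nlinarith⟩
        have h5 : 0 < c1 / 2 * h ^ 2 * m := by positivity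
        refine (Real.exp_le_exp.2 (neg_le_neg h3)).trans ((exp_neg_le_inv h5).trans ?_)
        rw [div_div (1 : ℝ)]
        exact one_div_le_one_div_of_le (by positivity)
          (mul_le_mul_of_nonneg_left h4 (by positivity))
      have e : Real.exp (-(c1 * d ^ 2 / m)) =
          Real.exp (-(c1 / 2 * d ^ 2 / m)) * Real.exp (-(c1 / 2 * d ^ 2 / m)) := by
        rw [← Real.exp_add]; congr 1; ring
      rw [e]
      calc _ ≤ 1 * (Real.exp (-(c1 / 2 * d ^ 2 / m)) * Real.exp (-(c1 / 2 * d ^ 2 / m))) := by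
            gcongr
        _ ≤ 1 / (c1 / 2 * h ^ 2) / √m * Real.exp (-(c1 / 2 * d ^ 2 / m)) := by
            rw [one_mul]; gcongr
        _ ≤ _ := by
            gcongr
            have : 0 ≤ √(2 / (δ * h)) := Real.sqrt_nonneg _
            linarith
  calc _ ≤ G * (Real.exp 1 * Real.exp (-(c1 * d ^ 2 / m))) := hgauss
    _ = Real.exp 1 * (G * Real.exp (-(c1 * d ^ 2 / m))) := by ring
    _ ≤ Real.exp 1 * _ := mul_le_mul_of_nonneg_left key (Real.exp_pos _).le
    _ = _ := by ring

lemma sq_mul_exp_le {c s d : ℝ} (hc : 0 < c) (hs : 0 < s) :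
    d ^ 2 * Real.exp (-(c * d ^ 2 / s ^ 2)) ≤
      (2 / c + 4 / c ^ 2) * s ^ 2 * (s ^ 2 / (s + |d|) ^ 2) := by
  have h0 : 0 < s + |d| := by have := abs_nonneg d; linarith
  set u := c * d ^ 2 / s ^ 2 with hu
  have hu0 : 0 ≤ u := by positivity
  have hd : d ^ 2 = u * s ^ 2 / c := by rw [hu]; field_simp
  have hq := Real.quadratic_le_exp_of_nonneg hu0
  have h1 : (s + |d|) ^ 2 ≤ 2 * s ^ 2 * (1 + u / c) := by
    have : (s + |d|) ^ 2 ≤ 2 * s ^ 2 + 2 * d ^ 2 := by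
      rw [← sq_abs d]; nlinarith [sq_nonneg (s - |d|)]
    refine this.trans (le_of_eq ?_)
    rw [hd]; field_simp
  have h2 : u * (1 + u / c) * 2 / c ≤ (2 / c + 4 / c ^ 2) * Real.exp u := by
    have e : (u * (1 + u / c)) * 2 / c = 2 / c * u + 4 / c ^ 2 * (u ^ 2 / 2) := by
      field_simp; ring
    rw [e, add_mul]
    gcongr <;> nlinarith
  rw [Real.exp_neg, ← div_eq_mul_inv, ← mul_div_assoc, div_le_div_iff₀ (Real.exp_pos _)
    (by positivity)]
  calc d ^ 2 * (s + |d|) ^ 2 ≤ d ^ 2 * (2 * s ^ 2 * (1 + u / c)) := by gcongr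
    _ = s ^ 2 * s ^ 2 * (u * (1 + u / c) * 2 / c) := by rw [hd]; field_simp
    _ ≤ s ^ 2 * s ^ 2 * ((2 / c + 4 / c ^ 2) * Real.exp u) := by gcongr
    _ = _ := by ring

/-- Second moment of the deviation of large cluster sizes. -/
lemma exploreMass_second_moment {l β δ : ℝ} (hl : 1 < l) (hδ0 : 0 < δ)
    (hδ : δ ≤ (l - 1) / β ^ 2) :
    ∃ C : ℝ, 0 < C ∧ ∀ (y : ℝ) (m r : ℕ), 4 / δ ≤ m → 4 ≤ m → r ≤ 2 → l ≤ y * m → y * m ≤ β →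
      ∑ k ∈ Finset.range (m + 1), (if δ * m ≤ k then
        (k - theta (y * m) * m) ^ 2 * exploreMass (Real.exp (-y)) m r k else 0) ≤ C * m := by
  obtain ⟨c, K, hc, hK, hloc⟩ := exploreMass_le_local hl hδ0 hδ
  refine ⟨K * (2 / c + 4 / c ^ 2) * 8, by positivity, ?_⟩
  intro y m r hm hm4 hr hly hyβ
  have hm4' : (4 : ℝ) ≤ m := by exact_mod_cast hm4
  have hm0 : (0 : ℝ) < m := by linarith
  set s := √(m : ℝ) with hs
  have hs2 : s ^ 2 = m := Real.sq_sqrt hm0.le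
  have hs1 : 1 ≤ s := by rw [hs, Real.one_le_sqrt]; linarith
  have hs0 : 0 < s := by linarith
  have hterm : ∀ k ∈ Finset.range (m + 1), (if δ * m ≤ k then
        (k - theta (y * m) * m) ^ 2 * exploreMass (Real.exp (-y)) m r k else 0) ≤
      K * (2 / c + 4 / c ^ 2) * s * (s ^ 2 / (s + |k - theta (y * m) * m|) ^ 2) := by
    intro k hk
    split_ifs with h
    · have h1 := hloc y m r k hm hm4 hr hly hyβ h (by simpa [Nat.lt_succ_iff] using hk)
      have h2 := sq_mul_exp_le (d := k - theta (y * m) * m) hc hs0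
      rw [hs2] at h2
      calc _ ≤ (k - theta (y * m) * m) ^ 2 *
            (K / s * Real.exp (-(c * (k - theta (y * m) * m) ^ 2 / m))) := by gcongr
        _ = K / s * ((k - theta (y * m) * m) ^ 2 *
            Real.exp (-(c * (k - theta (y * m) * m) ^ 2 / m))) := by ring
        _ ≤ K / s * _ := mul_le_mul_of_nonneg_left h2 (by positivity)
        _ = _ := by rw [← hs2]; field_simp
    · positivity
  refine (Finset.sum_le_sum hterm).trans ?_
  rw [← Finset.mul_sum]
  refine (mul_le_mul_of_nonneg_left (sum_cauchy_kernel_le hs1 _ _) (by positivity)).trans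
    (le_of_eq ?_)
  rw [← hs2]; ring

end secondMoment

section percolation

variable {V : Type*} [DecidableEq V] [Fintype V]

lemma one_sub_exp_neg_mem_Icc {y : ℝ} (hy : 0 ≤ y) : 1 - Real.exp (-y) ∈ Set.Icc (0 : ℝ) 1 := by
  have h := exp_neg_mem_Icc hy
  exact ⟨by linarith [h.2], by linarith [h.1]⟩

/-- Expectations of functions of a cluster size are bounded by the exploration masses. -/
lemma bernExp_card_cluster_apply_le {y : ℝ} (hy : 0 ≤ y) {D R : Finset V} (hRD : R ⊆ D)
    {φ : ℕ → ℝ} (hφ : ∀ k, 0 ≤ φ k) :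
    bernExp (1 - Real.exp (-y)) (edgesIn D) (fun E => φ #(cluster E R)) ≤
      ∑ k ∈ Finset.Icc #R #D, φ k * exploreMass (Real.exp (-y)) #D #R k := by
  have hp := one_sub_exp_neg_mem_Icc hy
  have h1 : bernExp (1 - Real.exp (-y)) (edgesIn D) (fun E => φ #(cluster E R)) =
      bernExp (1 - Real.exp (-y)) (edgesIn D) (fun E => ∑ k ∈ Finset.Icc #R #D,
        φ k * if #(cluster E R) = k then 1 else 0) := by
    refine bernExp_congr fun E hE => ?_
    have hmem : #(cluster E R) ∈ Finset.Icc #R #D := Finset.mem_Icc.2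
      ⟨Finset.card_le_card (subset_cluster E R),
        Finset.card_le_card (cluster_subset_of_edgesIn hE hRD)⟩
    simp only [mul_ite, mul_one, mul_zero]
    rw [Finset.sum_ite_eq, if_pos hmem]
  rw [h1, bernExp_sum]
  refine Finset.sum_le_sum fun k _ => ?_
  rw [bernExp_mul_left]
  have := bernExp_card_cluster_le hp hRD k
  rw [sub_sub_cancel] at this
  exact mul_le_mul_of_nonneg_left this (hφ k)

lemma sum_nat_mul_exp_le {c : ℝ} (hc : 0 < c) : ∃ C : ℝ, 0 < C ∧ ∀ s : Finset ℕ,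
    ∑ k ∈ s, (k : ℝ) * Real.exp (-(c * k)) ≤ C := by
  have hs : Summable fun k : ℕ => (k : ℝ) * Real.exp (-(c * k)) := by
    simpa using Real.summable_pow_mul_exp_neg_nat_mul 1 hc
  refine ⟨(∑' k : ℕ, (k : ℝ) * Real.exp (-(c * k))) + 1, ?_, fun s => ?_⟩
  · have : 0 ≤ ∑' k : ℕ, (k : ℝ) * Real.exp (-(c * k)) := tsum_nonneg fun k => by positivity
    linarith
  · have := hs.sum_le_tsum s (fun k _ => by positivity)
    linarith

lemma subcritical_cluster_sum {μ : ℝ} (hμ0 : 0 < μ) (hμ1 : μ < 1) :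
    ∃ C : ℝ, 0 < C ∧
    ∀ (V : Type) [DecidableEq V] [Fintype V] (y : ℝ) (D : Finset V),
      0 ≤ y → y * #D ≤ μ →
      bernExp (1 - Real.exp (-y)) (edgesIn D) (fun E => ∑ v ∈ D, (#(cluster E {v}) : ℝ)) ≤
        C * #D := by
  have hc := sub_one_sub_log_pos hμ0 hμ1.ne
  obtain ⟨C, hC, hsum⟩ := sum_nat_mul_exp_le hc
  refine ⟨μ⁻¹ * C, by positivity, fun V _ _ y D hy hyD => ?_⟩
  rw [bernExp_sum, mul_comm, ← nsmul_eq_mul]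
  refine Finset.sum_le_card_nsmul _ _ _ fun v hv => ?_
  refine (bernExp_card_cluster_apply_le (φ := fun k => (k : ℝ)) hy
    (Finset.singleton_subset_iff.2 hv) (fun k => Nat.cast_nonneg k)).trans ?_
  have hterm : ∀ k ∈ Finset.Icc #{v} #D, (k : ℝ) * exploreMass (Real.exp (-y)) #D #{v} k ≤
      μ⁻¹ * (k * Real.exp (-((μ - 1 - Real.log μ) * k))) := by
    intro k hk
    rw [Finset.card_singleton, Finset.mem_Icc] at hk
    rw [Finset.card_singleton]
    have := exploreMass_subcritical hμ0 hμ1 hy hyD hk.1 hk.2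
    calc _ ≤ (k : ℝ) * (μ⁻¹ * Real.exp (-((μ - 1 - Real.log μ) * k))) := by gcongr
      _ = _ := by ring
  refine (Finset.sum_le_sum hterm).trans ?_
  rw [← Finset.mul_sum]
  exact mul_le_mul_of_nonneg_left (hsum _) (by positivity)

/-- Constants for which the supercritical estimates below hold. -/
structure Supercritical (l β δ : ℝ) : Prop where
  one_lt : 1 < l
  pos : 0 < δ
  le_root : δ ≤ (l - 1) / β ^ 2
  le_small : 2 * δ ≤ (l - 1) / (2 * l * (1 + β))

lemma Supercritical.exists {l β : ℝ} (hl : 1 < l) (hβ : 1 < β) : ∃ δ, Supercritical l β δ := by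
  have h0 : 0 < l - 1 := by linarith
  refine ⟨(l - 1) / (4 * l * (1 + β) ^ 2), hl, by positivity, ?_, ?_⟩
  · apply div_le_div_of_nonneg_left h0.le (by positivity)
    nlinarith
  · rw [← mul_div_assoc, div_le_div_iff₀ (by positivity) (by positivity)]
    have : 0 ≤ (l - 1) * (l * (1 + β)) * (4 * (β)) := by positivity
    nlinarith

variable {l β δ : ℝ}

lemma Supercritical.small_sum (h : Supercritical l β δ) : ∃ C : ℝ, 0 < C ∧
    ∀ (V : Type) [DecidableEq V] [Fintype V] (y : ℝ) (D : Finset V),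
      0 ≤ y → l ≤ y * #D → y * #D ≤ β → ∀ v ∈ D,
      bernExp (1 - Real.exp (-y)) (edgesIn D) (fun E =>
        if δ * #D ≤ #(cluster E {v}) then 0 else (#(cluster E {v}) : ℝ)) ≤ C := by
  have hc := sub_one_sub_log_pos (x := (l + 1) / 2) (by linarith [h.one_lt])
    (by linarith [h.one_lt])
  obtain ⟨C, hC, hsum⟩ := sum_nat_mul_exp_le hc
  refine ⟨C, hC, fun V _ _ y D hy hly hyβ v hv => ?_⟩
  refine (bernExp_card_cluster_apply_le (φ := fun k => if δ * #D ≤ k then 0 else (k : ℝ)) hy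
    (Finset.singleton_subset_iff.2 hv) (fun k => by split_ifs <;> positivity)).trans ?_
  refine (Finset.sum_le_sum fun k hk => ?_).trans (hsum (Finset.Icc #{v} #D))
  rw [Finset.mem_Icc] at hk
  split_ifs with hkD
  · rw [zero_mul]; positivity
  · refine mul_le_mul_of_nonneg_left ?_ (Nat.cast_nonneg k)
    have hD : (0 : ℝ) ≤ #D := Nat.cast_nonneg _
    exact exploreMass_small h.one_lt (by linarith [h.pos]) h.le_small hy hly hyβ hk.1 hk.2
      (by nlinarith [h.pos])

lemma Supercritical.large_sq (h : Supercritical l β δ) : ∃ C M : ℝ, 0 < C ∧ 4 ≤ M ∧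
    ∀ (V : Type) [DecidableEq V] [Fintype V] (y : ℝ) (D : Finset V),
      0 ≤ y → M ≤ #D → l ≤ y * #D → y * #D ≤ β →
      ∀ R ⊆ D, #R ≤ 2 →
      bernExp (1 - Real.exp (-y)) (edgesIn D) (fun E =>
        if δ * #D ≤ #(cluster E R) then ((#(cluster E R) : ℝ) - theta (y * #D) * #D) ^ 2 else 0) ≤
        C * #D := by
  obtain ⟨C, hC, hsum⟩ := exploreMass_second_moment h.one_lt h.pos h.le_root
  refine ⟨C, 4 + 4 / δ, hC, ?_, fun V _ _ y D hy hM hly hyβ R hR hR2 => ?_⟩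
  · have := h.pos
    have : 0 < 4 / δ := by positivity
    linarith
  have hδ : 0 < 4 / δ := by have := h.pos; positivity
  have hD4 : (4 : ℝ) ≤ #D := by linarith
  refine (bernExp_card_cluster_apply_le
    (φ := fun k => if δ * #D ≤ k then ((k : ℝ) - theta (y * #D) * #D) ^ 2 else 0) hy
    hR (fun k => by split_ifs <;> positivity)).trans ?_
  refine le_trans ?_ (hsum y #D #R (by linarith) (by exact_mod_cast hD4) hR2 hly hyβ)
  refine (Finset.sum_le_sum_of_subset_of_nonneg (t := Finset.range (#D + 1)) ?_ ?_).trans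
    (le_of_eq ?_)
  · intro k hk
    rw [Finset.mem_Icc] at hk
    rw [Finset.mem_range]; omega
  · intro k _ _
    have := exploreMass_nonneg (exp_neg_mem_Icc hy) #D #R k
    split_ifs <;> positivity
  · refine Finset.sum_congr rfl fun k _ => ?_
    rw [ite_mul, zero_mul]

/-- Some cluster of a growing chain of root sets has intermediate size when all clusters are
small. -/
lemma exists_intermediate_cluster {D : Finset V} {t : ℝ} (ht : 0 < t) (htD : t ≤ #D)
    {E : Finset (Sym2 V)} (hsmall : ∀ v ∈ D, (#(cluster E {v}) : ℝ) < t) :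
    ∃ i ∈ Finset.range (#D + 1), t ≤ #(cluster E (D.toList.take i).toFinset) ∧
      (#(cluster E (D.toList.take i).toFinset) : ℝ) ≤ 2 * t := by
  have hex : ∃ i, t ≤ #(cluster E (D.toList.take i).toFinset) := by
    refine ⟨#D, htD.trans ?_⟩
    rw [List.take_of_length_le (by simp), Finset.toList_toFinset]
    exact_mod_cast Finset.card_le_card (subset_cluster E D)
  have hspec := Nat.find_spec hex
  set i := Nat.find hex with hi
  have hiD : i ≤ #D := Nat.find_min' hex (by
    rw [List.take_of_length_le (by simp), Finset.toList_toFinset]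
    exact htD.trans (by exact_mod_cast Finset.card_le_card (subset_cluster E D)))
  refine ⟨i, Finset.mem_range.2 (by omega), hspec, ?_⟩
  rcases Nat.eq_zero_or_pos i with h0 | h0
  · rw [h0] at hspec
    simp [cluster_empty] at hspec
    linarith
  · obtain ⟨j, hj⟩ := Nat.exists_eq_add_of_le' h0
    have hlt : (#(cluster E (D.toList.take j).toFinset) : ℝ) < t := by
      have := Nat.find_min hex (m := j) (by omega)
      linarith [not_le.1 this]
    have hjl : j < D.toList.length := by simp; omega
    rw [hj, List.take_add_one, List.toFinset_append, cluster_union, List.getElem?_eq_getElem hjl]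
    have hv : D.toList[j] ∈ D := Finset.mem_toList.1 (List.getElem_mem _)
    have h2 := hsmall _ hv
    have h3 : (#(cluster E (D.toList.take j).toFinset ∪
        cluster E (some D.toList[j]).toList.toFinset) : ℝ) ≤
        #(cluster E (D.toList.take j).toFinset) + #(cluster E {D.toList[j]}) := by
      have := Finset.card_union_le (cluster E (D.toList.take j).toFinset)
        (cluster E (some D.toList[j]).toList.toFinset)
      have e : (some D.toList[j]).toList.toFinset = {D.toList[j]} := by simp
      rw [e] at this ⊢
      exact_mod_cast this
    linarith

lemma Supercritical.exists_large (h : Supercritical l β δ) : ∃ C : ℝ, 0 < C ∧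
    ∀ (V : Type) [DecidableEq V] [Fintype V] (y : ℝ) (D : Finset V),
      0 ≤ y → 1 ≤ #D → l ≤ y * #D → y * #D ≤ β →
      bernExp (1 - Real.exp (-y)) (edgesIn D) (fun E =>
        if ∀ v ∈ D, (#(cluster E {v}) : ℝ) < δ * #D then 1 else 0) ≤ C / #D := by
  have hc := sub_one_sub_log_pos (x := (l + 1) / 2) (by linarith [h.one_lt])
    (by linarith [h.one_lt])
  set c := (l + 1) / 2 - 1 - Real.log ((l + 1) / 2) with hcdef
  have hδ := h.pos
  have hl := h.one_lt
  refine ⟨24 / (c * δ) ^ 3, by positivity, fun V _ _ y D hy hD1 hly hyβ => ?_⟩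
  have hD : (1 : ℝ) ≤ #D := by exact_mod_cast hD1
  have hδD : δ * #D ≤ #D := by
    have h1 := h.le_small
    have h2 : 0 ≤ 2 * l * (1 + β) := by
      have : 1 < β := by linarith
      positivity
    have hβ : 1 < β := by linarith
    rw [le_div_iff₀ (by positivity)] at h1
    have : δ ≤ 1 := by
      by_contra hcon
      push Not at hcon
      nlinarith [mul_lt_mul_of_pos_right hcon (by positivity : 0 < 2 * l * (1 + β))]
    nlinarith
  have hp := one_sub_exp_neg_mem_Icc hy
  have hroot : ∀ i, (D.toList.take i).toFinset ⊆ D := fun i v hv =>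
    Finset.mem_toList.1 (List.mem_of_mem_take (List.mem_toFinset.1 hv))
  calc _ ≤ bernExp (1 - Real.exp (-y)) (edgesIn D) (fun E => ∑ i ∈ Finset.range (#D + 1),
        if δ * #D ≤ #(cluster E (D.toList.take i).toFinset) ∧
          (#(cluster E (D.toList.take i).toFinset) : ℝ) ≤ 2 * (δ * #D) then 1 else 0) := by
        refine bernExp_mono hp fun E _ => ?_
        split_ifs with hE
        · obtain ⟨i, hi, h1, h2⟩ := exists_intermediate_cluster (by positivity) hδD hE
          refine le_trans (le_of_eq ?_) (Finset.single_le_sum (f := fun i =>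
            if δ * #D ≤ #(cluster E (D.toList.take i).toFinset) ∧
              (#(cluster E (D.toList.take i).toFinset) : ℝ) ≤ 2 * (δ * #D) then (1 : ℝ) else 0)
            (fun i _ => by positivity) hi)
          rw [if_pos ⟨h1, h2⟩]
        · exact Finset.sum_nonneg fun i _ => by positivity
    _ ≤ ∑ i ∈ Finset.range (#D + 1), (#D + 1) * Real.exp (-(c * (δ * #D))) := by
        rw [bernExp_sum]
        refine Finset.sum_le_sum fun i _ => ?_
        refine (bernExp_card_cluster_apply_le (φ := fun k => if δ * #D ≤ k ∧
          (k : ℝ) ≤ 2 * (δ * #D) then 1 else 0) hy (hroot i)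
          (fun k => by positivity)).trans ?_
        refine (Finset.sum_le_card_nsmul _ _ (Real.exp (-(c * (δ * #D)))) fun k hk => ?_).trans ?_
        · rw [Finset.mem_Icc] at hk
          split_ifs with hkD
          · rw [one_mul]
            refine (exploreMass_small hl (by linarith) h.le_small hy hly hyβ hk.1 hk.2
              (by linarith [hkD.2])).trans (Real.exp_le_exp.2 ?_)
            rw [← hcdef]
            exact neg_le_neg (mul_le_mul_of_nonneg_left hkD.1 hc.le)
          · rw [zero_mul]; positivity
        · rw [nsmul_eq_mul]
          refine mul_le_mul_of_nonneg_right ?_ (Real.exp_pos _).le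
          rw [Nat.card_Icc]
          exact_mod_cast Nat.sub_le _ _
    _ ≤ _ := by
        rw [Finset.sum_const, Finset.card_range, nsmul_eq_mul, Nat.cast_add, Nat.cast_one]
        have hD0 : (0 : ℝ) < #D := by linarith
        set t := c * (δ * #D) with ht
        have ht0 : 0 < t := by positivity
        have hexp : Real.exp (-t) ≤ 6 / t ^ 3 := by
          have := Real.pow_div_factorial_le_exp t ht0.le 3
          rw [Real.exp_neg, inv_eq_one_div, div_le_div_iff₀ (Real.exp_pos _) (by positivity)]
          norm_num [Nat.factorial] at this
          linarith
        calc ((#D : ℝ) + 1) * ((#D + 1) * Real.exp (-t)) ≤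
            (2 * #D) * ((2 * #D) * (6 / t ^ 3)) := by
              gcongr <;> linarith
          _ = _ := by rw [ht]; field_simp; norm_num

end percolation

section giant

variable {V : Type*}

lemma edgesIn_image_perm [DecidableEq V] {D : Finset V} (σ : Equiv.Perm V)
    (hσ : ∀ v, σ v ∈ D ↔ v ∈ D) :
    (edgesIn D).image (Sym2.map σ) = edgesIn D := by
  ext e
  induction e with
  | _ a b =>
    rw [Finset.mem_image, mk_mem_edgesIn]
    constructor
    · rintro ⟨e, he, heq⟩
      induction e with
      | _ c d =>
        rw [mk_mem_edgesIn] at he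
        rw [Sym2.map_mk, Sym2.eq_iff] at heq
        rcases heq with ⟨rfl, rfl⟩ | ⟨rfl, rfl⟩
        · exact ⟨(hσ _).2 he.1, (hσ _).2 he.2.1, fun h => he.2.2 (σ.injective h)⟩
        · exact ⟨(hσ _).2 he.2.1, (hσ _).2 he.1, fun h => he.2.2 (σ.injective h.symm)⟩
    · rintro ⟨ha, hb, hab⟩
      refine ⟨s(σ.symm a, σ.symm b), mk_mem_edgesIn.2 ⟨?_, ?_, ?_⟩, by simp⟩
      · rw [← hσ]; simpa
      · rw [← hσ]; simpa
      · simpa using hab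

lemma map_mem_image_iff [DecidableEq V] (σ : Equiv.Perm V) {E : Finset (Sym2 V)} {a b : V} :
    s(σ a, σ b) ∈ E.image (Sym2.map σ) ↔ s(a, b) ∈ E := by
  rw [← Sym2.map_mk, (Sym2.map.injective σ.injective).mem_finset_image]

variable [Fintype V]

/-- Vertices of `D` lying in clusters of size at least `t`. -/
noncomputable def largeSet (D : Finset V) (t : ℝ) (E : Finset (Sym2 V)) : Finset V :=
  D.filter (fun v => t ≤ #(cluster E {v}))

lemma mem_largeSet {D : Finset V} {t : ℝ} {E : Finset (Sym2 V)} {v : V} :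
    v ∈ largeSet D t E ↔ v ∈ D ∧ t ≤ #(cluster E {v}) := by
  simp [largeSet]

/-- There is exactly one large cluster. -/
def HasGiant (D : Finset V) (t : ℝ) (E : Finset (Sym2 V)) : Prop :=
  (largeSet D t E).Nonempty ∧ ∀ u ∈ largeSet D t E, ∀ v ∈ largeSet D t E, v ∈ cluster E {u}

lemma cluster_disjoint {E : Finset (Sym2 V)} {u v : V} (h : v ∉ cluster E {u}) :
    Disjoint (cluster E {u}) (cluster E {v}) := by
  rw [Finset.disjoint_left]
  intro w hw hw'
  rw [← cluster_singleton_eq hw, mem_cluster_comm] at h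
  exact h hw'

/-- Squared deviation of the cluster size of `R` when the cluster is large. -/
noncomputable def largeDev (t s : ℝ) (R : Finset V) (E : Finset (Sym2 V)) : ℝ :=
  if t ≤ #(cluster E R) then ((#(cluster E R) : ℝ) - s) ^ 2 else 0

lemma largeDev_nonneg (t s : ℝ) (R : Finset V) (E : Finset (Sym2 V)) : 0 ≤ largeDev t s R E := by
  unfold largeDev; positivity

variable [DecidableEq V] {l β δ : ℝ}

lemma HasGiant.largeSet_eq {D : Finset V} {t : ℝ} {E : Finset (Sym2 V)} (h : HasGiant D t E)
    (hE : E ⊆ edgesIn D) {v : V} (hv : v ∈ largeSet D t E) :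
    largeSet D t E = cluster E {v} := by
  apply Finset.Subset.antisymm
  · exact fun u hu => h.2 v hv u hu
  · intro u hu
    have hv' := mem_largeSet.1 hv
    rw [mem_largeSet, cluster_singleton_eq hu]
    exact ⟨cluster_subset_of_edgesIn hE (Finset.singleton_subset_iff.2 hv'.1) hu, hv'.2⟩

lemma sq_le_largeDev {t s : ℝ} (ht : 0 ≤ t) (hts : t ≤ s) {E : Finset (Sym2 V)} {u v : V}
    (hu : t ≤ #(cluster E {u})) (hv : t ≤ #(cluster E {v})) (h : v ∉ cluster E {u}) :
    t ^ 2 ≤ 3 * (largeDev t s {u} E + largeDev t s {v} E + largeDev t s ({u} ∪ {v}) E) := by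
  have hc : (#(cluster E ({u} ∪ {v})) : ℝ) = #(cluster E {u}) + #(cluster E {v}) := by
    rw [cluster_union, Finset.card_union_of_disjoint (cluster_disjoint h), Nat.cast_add]
  rw [largeDev, largeDev, largeDev, if_pos hu, if_pos hv, if_pos (by rw [hc]; linarith), hc]
  set a := (#(cluster E {u}) : ℝ)
  set b := (#(cluster E {v}) : ℝ)
  nlinarith [sq_nonneg (a - s - (b - s)), sq_nonneg (a - s + (a + b - s)),
    sq_nonneg (b - s + (a + b - s))]

lemma two_large_le {D : Finset V} {t s : ℝ} (ht : 0 < t) (hts : t ≤ s)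
    {E : Finset (Sym2 V)} (hE : E ⊆ edgesIn D) :
    (if ∃ u ∈ largeSet D t E, ∃ v ∈ largeSet D t E, v ∉ cluster E {u} then 1 else 0) ≤
      3 / t ^ 4 * ∑ u ∈ D, ∑ v ∈ D,
        (largeDev t s {u} E + largeDev t s {v} E + largeDev t s ({u} ∪ {v}) E) := by
  have hnn : ∀ u v, 0 ≤ largeDev t s {u} E + largeDev t s {v} E + largeDev t s ({u} ∪ {v}) E :=
    fun u v => add_nonneg (add_nonneg (largeDev_nonneg _ _ _ _) (largeDev_nonneg _ _ _ _))
      (largeDev_nonneg _ _ _ _)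
  split_ifs with h
  · obtain ⟨u0, hu0, v0, hv0, hd⟩ := h
    rw [mem_largeSet] at hu0 hv0
    have hsub : ∀ {w}, w ∈ D → cluster E {w} ⊆ D := fun hw =>
      cluster_subset_of_edgesIn hE (Finset.singleton_subset_iff.2 hw)
    have h1 : ∑ u ∈ cluster E {u0}, ∑ v ∈ cluster E {v0}, t ^ 2 / 3 ≤ ∑ u ∈ D, ∑ v ∈ D,
        (largeDev t s {u} E + largeDev t s {v} E + largeDev t s ({u} ∪ {v}) E) := by
      refine (Finset.sum_le_sum fun u hu => Finset.sum_le_sum fun v hv => ?_).trans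
        ((Finset.sum_le_sum fun u _ => Finset.sum_le_sum_of_subset_of_nonneg (hsub hv0.1)
          (fun v _ _ => hnn u v)).trans (Finset.sum_le_sum_of_subset_of_nonneg (hsub hu0.1)
          (fun u _ _ => Finset.sum_nonneg fun v _ => hnn u v)))
      have hcu := cluster_singleton_eq hu
      have hcv := cluster_singleton_eq hv
      have := sq_le_largeDev (u := u) (v := v) ht.le hts (by rw [hcu]; exact hu0.2)
        (by rw [hcv]; exact hv0.2) (by
          intro hvu
          rw [hcu] at hvu
          exact Finset.disjoint_left.1 (cluster_disjoint hd) hvu hv)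
      linarith
    rw [Finset.sum_const, Finset.sum_const, nsmul_eq_mul, nsmul_eq_mul] at h1
    have h2 : t * (t * (t ^ 2 / 3)) ≤ #(cluster E {u0}) * (#(cluster E {v0}) * (t ^ 2 / 3)) :=
      mul_le_mul hu0.2 (mul_le_mul_of_nonneg_right hv0.2 (by positivity)) (by positivity)
        (by positivity)
    rw [div_mul_eq_mul_div, le_div_iff₀ (by positivity)]
    linarith
  · exact mul_nonneg (by positivity)
      (Finset.sum_nonneg fun u _ => Finset.sum_nonneg fun v _ => hnn u v)

lemma Supercritical.giant (h : Supercritical l β δ) : ∃ C M : ℝ, 0 < C ∧ 4 ≤ M ∧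
    ∀ (V : Type) [DecidableEq V] [Fintype V] (y : ℝ) (D : Finset V),
      0 ≤ y → M ≤ #D → l ≤ y * #D → y * #D ≤ β →
      bernExp (1 - Real.exp (-y)) (edgesIn D) (fun E =>
        if HasGiant D (δ * #D) E then 0 else 1) ≤ C / #D := by
  obtain ⟨C1, hC1, hex⟩ := h.exists_large
  obtain ⟨C2, M, hC2, hM4, hsq⟩ := h.large_sq
  have hδ := h.pos
  refine ⟨C1 + 9 * C2 / δ ^ 4, M, by positivity, hM4, fun V _ _ y D hy hM hly hyβ => ?_⟩
  have hp := one_sub_exp_neg_mem_Icc hy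
  have hD0 : (0 : ℝ) < #D := by linarith
  obtain ⟨hθ, -⟩ := theta_spec h.one_lt hly hyβ hδ h.le_root
  have hD1 : 1 ≤ #D := by
    have : (0 : ℝ) < #D := hD0
    exact_mod_cast this
  have h1 := hex V y D hy hD1 hly hyβ
  have hX : ∀ R ⊆ D, #R ≤ 2 → bernExp (1 - Real.exp (-y)) (edgesIn D)
      (largeDev (δ * #D) (theta (y * #D) * #D) R) ≤ C2 * #D := fun R hR hR2 =>
    hsq V y D hy hM hly hyβ R hR hR2
  have h2 : bernExp (1 - Real.exp (-y)) (edgesIn D) (fun E =>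
      if ∃ u ∈ largeSet D (δ * #D) E, ∃ v ∈ largeSet D (δ * #D) E, v ∉ cluster E {u}
        then 1 else 0) ≤ 9 * C2 / δ ^ 4 / #D := by
    refine (bernExp_mono hp fun E hE => two_large_le (s := theta (y * #D) * #D)
      (by positivity) (by gcongr) hE).trans ?_
    rw [bernExp_mul_left, bernExp_sum]
    have : ∑ u ∈ D, bernExp (1 - Real.exp (-y)) (edgesIn D) (fun E => ∑ v ∈ D,
        (largeDev (δ * #D) (theta (y * #D) * #D) {u} E +
          largeDev (δ * #D) (theta (y * #D) * #D) {v} E +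
          largeDev (δ * #D) (theta (y * #D) * #D) ({u} ∪ {v}) E)) ≤
        ∑ u ∈ D, ∑ v ∈ D, (3 * (C2 * #D)) := by
      refine Finset.sum_le_sum fun u hu => ?_
      rw [bernExp_sum]
      refine Finset.sum_le_sum fun v hv => ?_
      rw [bernExp_add, bernExp_add]
      have a := hX {u} (by simpa using hu) (by simp)
      have b := hX {v} (by simpa using hv) (by simp)
      have c := hX ({u} ∪ {v}) (Finset.union_subset (by simpa using hu) (by simpa using hv))
        ((Finset.card_union_le _ _).trans (by simp))
      linarith
    refine (mul_le_mul_of_nonneg_left this (by positivity)).trans (le_of_eq ?_)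
    simp only [Finset.sum_const, nsmul_eq_mul]
    field_simp
    norm_num
  refine (bernExp_mono hp (g := fun E => (if ∀ v ∈ D, (#(cluster E {v}) : ℝ) < δ * #D then 1 else 0)
    + (if ∃ u ∈ largeSet D (δ * #D) E, ∃ v ∈ largeSet D (δ * #D) E, v ∉ cluster E {u}
        then 1 else 0)) fun E _ => ?_).trans ?_
  · by_cases ha : ∀ v ∈ D, (#(cluster E {v}) : ℝ) < δ * #D
    · rw [if_pos ha]; split_ifs <;> norm_num
    by_cases hb : ∃ u ∈ largeSet D (δ * #D) E, ∃ v ∈ largeSet D (δ * #D) E, v ∉ cluster E {u}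
    · rw [if_neg ha, if_pos hb]; split_ifs <;> norm_num
    have hg : HasGiant D (δ * #D) E := by
      push Not at ha hb
      obtain ⟨v, hv, hv'⟩ := ha
      exact ⟨⟨v, mem_largeSet.2 ⟨hv, hv'⟩⟩, hb⟩
    rw [if_pos hg]
    positivity
  · rw [bernExp_add, add_div]
    exact add_le_add h1 h2

lemma Supercritical.largeSet_sq (h : Supercritical l β δ) : ∃ C M : ℝ, 0 < C ∧ 4 ≤ M ∧
    ∀ (V : Type) [DecidableEq V] [Fintype V] (y : ℝ) (D : Finset V),
      0 ≤ y → M ≤ #D → l ≤ y * #D → y * #D ≤ β →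
      bernExp (1 - Real.exp (-y)) (edgesIn D) (fun E =>
        ((#(largeSet D (δ * #D) E) : ℝ) - theta (y * #D) * #D) ^ 2) ≤ C * #D := by
  obtain ⟨C1, M1, hC1, hM1, hg⟩ := h.giant
  obtain ⟨C2, M2, hC2, hM2, hsq⟩ := h.large_sq
  have hδ := h.pos
  refine ⟨C1 + C2 / δ, max M1 M2, by positivity, hM1.trans (le_max_left _ _),
    fun V _ _ y D hy hM hly hyβ => ?_⟩
  have hp := one_sub_exp_neg_mem_Icc hy
  have hD0 : (0 : ℝ) < #D := by have := hM1.trans (le_max_left M1 M2); linarith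
  obtain ⟨hθ, hθ1, -⟩ := theta_spec h.one_lt hly hyβ hδ h.le_root
  have h1 := hg V y D hy ((le_max_left _ _).trans hM) hly hyβ
  set t := δ * #D with ht
  have ht0 : 0 < t := by positivity
  set s := theta (y * #D) * #D with hs
  have hs0 : 0 ≤ s := mul_nonneg (by linarith) hD0.le
  have hsD : s ≤ #D := by rw [hs]; nlinarith
  refine (bernExp_mono hp (g := fun E => (#D : ℝ) ^ 2 * (if HasGiant D t E then 0 else 1) +
    t⁻¹ * ∑ v ∈ D, largeDev t s {v} E) fun E hE => ?_).trans ?_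
  · have hnn : 0 ≤ t⁻¹ * ∑ v ∈ D, largeDev t s {v} E :=
      mul_nonneg (by positivity) (Finset.sum_nonneg fun v _ => largeDev_nonneg _ _ _ _)
    by_cases hG : HasGiant D t E
    · rw [if_pos hG, mul_zero, zero_add]
      obtain ⟨v0, hv0⟩ := hG.1
      have heq := hG.largeSet_eq hE hv0
      have ht' : t ≤ #(largeSet D t E) := by rw [heq]; exact (mem_largeSet.1 hv0).2
      have h2 : ∑ v ∈ largeSet D t E, ((#(largeSet D t E) : ℝ) - s) ^ 2 ≤
          ∑ v ∈ D, largeDev t s {v} E := by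
        refine le_trans (Finset.sum_le_sum fun v hv => ?_) (Finset.sum_le_sum_of_subset_of_nonneg
          (Finset.filter_subset _ _) (fun v _ _ => largeDev_nonneg _ _ _ _))
        rw [hG.largeSet_eq hE hv, largeDev, if_pos (mem_largeSet.1 hv).2]
      rw [Finset.sum_const, nsmul_eq_mul] at h2
      rw [inv_mul_eq_div, le_div_iff₀ ht0]
      have := mul_le_mul_of_nonneg_right ht' (sq_nonneg ((#(largeSet D t E) : ℝ) - s))
      linarith
    · rw [if_neg hG, mul_one]
      have hL : (#(largeSet D t E) : ℝ) ≤ #D := by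
        exact_mod_cast Finset.card_le_card (Finset.filter_subset _ _)
      have hL0 : (0 : ℝ) ≤ #(largeSet D t E) := Nat.cast_nonneg _
      have : ((#(largeSet D t E) : ℝ) - s) ^ 2 ≤ (#D : ℝ) ^ 2 := by
        apply sq_le_sq'  <;> linarith
      linarith
  · rw [bernExp_add, bernExp_mul_left, bernExp_mul_left, bernExp_sum]
    have h3 : ∑ v ∈ D, bernExp (1 - Real.exp (-y)) (edgesIn D) (largeDev t s {v}) ≤
        ∑ v ∈ D, C2 * #D := Finset.sum_le_sum fun v hv =>
      hsq V y D hy ((le_max_right _ _).trans hM) hly hyβ {v} (by simpa using hv) (by simp)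
    rw [Finset.sum_const, nsmul_eq_mul] at h3
    have h4 := mul_le_mul_of_nonneg_left h1 (by positivity : 0 ≤ (#D : ℝ) ^ 2)
    have h5 := mul_le_mul_of_nonneg_left h3 (by positivity : 0 ≤ t⁻¹)
    refine (add_le_add h4 h5).trans (le_of_eq ?_)
    rw [ht]; field_simp

lemma cluster_image_perm (σ : Equiv.Perm V) (E : Finset (Sym2 V)) (v : V) :
    cluster (E.image (Sym2.map σ)) {σ v} = (cluster E {v}).image σ := by
  apply Finset.Subset.antisymm
  · refine cluster_subset (by simpa using self_mem_cluster E v) fun a ha b hab => ?_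
    obtain ⟨c, hc, rfl⟩ := Finset.mem_image.1 ha
    obtain ⟨d, rfl⟩ := σ.surjective b
    exact Finset.mem_image_of_mem _ (mem_cluster_of_adj hc ((map_mem_image_iff σ).1 hab))
  · have : cluster E {v} ⊆ (cluster (E.image (Sym2.map σ)) {σ v}).image σ.symm := by
      refine cluster_subset (Finset.singleton_subset_iff.2 (Finset.mem_image.2
        ⟨σ v, self_mem_cluster _ _, by simp⟩)) fun a ha b hab => ?_
      obtain ⟨c, hc, rfl⟩ := Finset.mem_image.1 ha
      refine Finset.mem_image.2 ⟨σ b, mem_cluster_of_adj hc ?_, by simp⟩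
      have := (map_mem_image_iff σ).2 hab
      simpa using this
    intro w hw
    obtain ⟨c, hc, rfl⟩ := Finset.mem_image.1 hw
    obtain ⟨d, hd, rfl⟩ := Finset.mem_image.1 (this hc)
    simpa using hd

lemma mem_largeSet_image_perm {D : Finset V} (σ : Equiv.Perm V) (hσ : ∀ v, σ v ∈ D ↔ v ∈ D)
    (t : ℝ) (E : Finset (Sym2 V)) (v : V) :
    σ v ∈ largeSet D t (E.image (Sym2.map σ)) ↔ v ∈ largeSet D t E := by
  rw [mem_largeSet, mem_largeSet, hσ, cluster_image_perm,
    Finset.card_image_of_injective _ σ.injective]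

lemma bernExp_pair_eq {p : ℝ} {D : Finset V} (t : ℝ) {u v v' : V} (hv : v ∈ D) (hv' : v' ∈ D)
    (huv : u ≠ v) (huv' : u ≠ v') :
    bernExp p (edgesIn D) (fun E => if u ∈ largeSet D t E ∧ v ∈ largeSet D t E then 1 else 0) =
    bernExp p (edgesIn D) (fun E => if u ∈ largeSet D t E ∧ v' ∈ largeSet D t E then 1 else 0) := by
  set σ := Equiv.swap v v' with hσdef
  have hσ : ∀ w, σ w ∈ D ↔ w ∈ D := by
    intro w
    rw [hσdef, Equiv.swap_apply_def]
    split_ifs with h1 h2 <;> simp_all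
  have hu : σ u = u := Equiv.swap_apply_of_ne_of_ne huv huv'
  have hv1 : σ v = v' := Equiv.swap_apply_left _ _
  conv_rhs => rw [← edgesIn_image_perm σ hσ, bernExp_image (Sym2.map.injective σ.injective).injOn]
  refine bernExp_congr fun E _ => ?_
  have h1 := mem_largeSet_image_perm σ hσ t E u
  have h2 := mem_largeSet_image_perm σ hσ t E v
  rw [hu] at h1
  rw [hv1] at h2
  simp only [h1, h2]

/-- A centred weight has small second moment on the exchangeable set of large vertices. -/
lemma bernExp_largeSet_centred {p : ℝ} (hp : p ∈ Set.Icc (0 : ℝ) 1) {D : Finset V} (t : ℝ)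
    {w : V → ℝ} (hw : ∑ v ∈ D, w v = 0) :
    bernExp p (edgesIn D) (fun E => (∑ v ∈ largeSet D t E, w v) ^ 2) ≤ ∑ v ∈ D, w v ^ 2 := by
  set H : V → V → ℝ := fun u v => bernExp p (edgesIn D) (fun E =>
    if u ∈ largeSet D t E ∧ v ∈ largeSet D t E then 1 else 0) with hH
  have hH0 : ∀ u v, 0 ≤ H u v := fun u v => bernExp_nonneg hp fun E _ => by positivity
  have hH1 : ∀ u v, H u v ≤ 1 := fun u v => by
    refine (bernExp_mono hp (g := fun _ => 1) fun E _ => ?_).trans (bernExp_const _ _ _).le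
    split_ifs <;> norm_num
  have h1 : bernExp p (edgesIn D) (fun E => (∑ v ∈ largeSet D t E, w v) ^ 2) =
      ∑ u ∈ D, ∑ v ∈ D, w u * w v * H u v := by
    simp only [hH, ← bernExp_mul_left, ← bernExp_sum]
    refine bernExp_congr fun E _ => ?_
    have : ∑ v ∈ largeSet D t E, w v = ∑ v ∈ D, if v ∈ largeSet D t E then w v else 0 := by
      rw [← Finset.sum_filter]
      congr 1
      ext v
      simp only [Finset.mem_filter, mem_largeSet]
      tauto
    rw [this, sq, Finset.sum_mul_sum]
    refine Finset.sum_congr rfl fun u _ => Finset.sum_congr rfl fun v _ => ?_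
    split_ifs <;> simp_all
  rw [h1]
  refine Finset.sum_le_sum fun u hu => ?_
  obtain ⟨b, hb0, hb⟩ : ∃ b : ℝ, 0 ≤ b ∧ ∀ v ∈ D, u ≠ v → H u v = b := by
    by_cases hex : ∃ v ∈ D, u ≠ v
    · obtain ⟨v', hv', huv'⟩ := hex
      exact ⟨H u v', hH0 _ _, fun v hv huv => bernExp_pair_eq t hv hv' huv huv'⟩
    · push Not at hex
      exact ⟨0, le_rfl, fun v hv huv => absurd (hex v hv) huv⟩
  have h2 : ∑ v ∈ D, w u * w v * H u v = w u ^ 2 * (H u u - b) := by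
    have h3 : ∀ v ∈ D, w u * w v * H u v = w u * b * w v +
        if v = u then w u * w v * (H u u - b) else 0 := by
      intro v hv
      split_ifs with h
      · subst h; ring
      · rw [hb v hv (Ne.symm h)]; ring
    rw [Finset.sum_congr rfl h3, Finset.sum_add_distrib, ← Finset.mul_sum, hw,
      Finset.sum_ite_eq' D u, if_pos hu]
    ring
  rw [h2]
  nlinarith [hH1 u u, sq_nonneg (w u)]

/-- Concentration of linear statistics of the giant component. -/
lemma Supercritical.largeSet_weight (h : Supercritical l β δ) : ∃ C M : ℝ, 0 < C ∧ 4 ≤ M ∧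
    ∀ (V : Type) [DecidableEq V] [Fintype V] (y : ℝ) (D : Finset V),
      0 ≤ y → M ≤ #D → l ≤ y * #D → y * #D ≤ β →
      ∀ (w : V → ℝ) (K : ℝ), (∀ v, |w v| ≤ K) →
      bernExp (1 - Real.exp (-y)) (edgesIn D) (fun E =>
        (∑ v ∈ largeSet D (δ * #D) E, w v - theta (y * #D) * ∑ v ∈ D, w v) ^ 2) ≤
        C * K ^ 2 * #D := by
  obtain ⟨C, M, hC, hM4, hsq⟩ := h.largeSet_sq
  refine ⟨2 * C + 8, M, by positivity, hM4, fun V _ _ y D hy hM hly hyβ w K hK => ?_⟩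
  have hp := one_sub_exp_neg_mem_Icc hy
  have hD0 : (0 : ℝ) < #D := by linarith
  have h1 := hsq V y D hy hM hly hyβ
  set t := δ * #D
  set a := (∑ v ∈ D, w v) / #D with ha
  have haD : a * #D = ∑ v ∈ D, w v := by rw [ha]; field_simp
  have haK : |a| ≤ K := by
    rw [ha, abs_div, Nat.abs_cast, div_le_iff₀ hD0]
    refine (Finset.abs_sum_le_sum_abs _ _).trans ((Finset.sum_le_card_nsmul _ _ K
      fun v _ => hK v).trans ?_)
    rw [nsmul_eq_mul, mul_comm]
  have hK0 : 0 ≤ K := (abs_nonneg a).trans haK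
  have hcen : ∑ v ∈ D, (w v - a) = 0 := by
    rw [Finset.sum_sub_distrib, Finset.sum_const, nsmul_eq_mul, mul_comm, haD, sub_self]
  have h2 := bernExp_largeSet_centred hp t hcen
  have h3 : ∑ v ∈ D, (w v - a) ^ 2 ≤ #D * (4 * K ^ 2) := by
    rw [← nsmul_eq_mul]
    refine Finset.sum_le_card_nsmul _ _ _ fun v _ => ?_
    have h4 : |w v - a| ≤ 2 * K := (abs_sub _ _).trans (by linarith [hK v])
    calc (w v - a) ^ 2 = |w v - a| ^ 2 := (sq_abs _).symm
      _ ≤ (2 * K) ^ 2 := pow_le_pow_left₀ (abs_nonneg _) h4 2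
      _ = _ := by ring
  refine (bernExp_mono hp (g := fun E => 2 * K ^ 2 * ((#(largeSet D t E) : ℝ) -
    theta (y * #D) * #D) ^ 2 + 2 * (∑ v ∈ largeSet D t E, (w v - a)) ^ 2) fun E _ => ?_).trans ?_
  · have e : ∑ v ∈ largeSet D t E, w v - theta (y * #D) * ∑ v ∈ D, w v =
        a * (#(largeSet D t E) - theta (y * #D) * #D) + ∑ v ∈ largeSet D t E, (w v - a) := by
      rw [Finset.sum_sub_distrib, Finset.sum_const, nsmul_eq_mul, ← haD]; ring
    rw [e]
    set X := (#(largeSet D t E) : ℝ) - theta (y * #D) * #D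
    set Y := ∑ v ∈ largeSet D t E, (w v - a)
    have h5 : a ^ 2 ≤ K ^ 2 := by
      rw [← sq_abs]; exact pow_le_pow_left₀ (abs_nonneg _) haK 2
    nlinarith [sq_nonneg (a * X - Y), mul_le_mul_of_nonneg_right h5 (sq_nonneg X)]
  · rw [bernExp_add, bernExp_mul_left, bernExp_mul_left]
    have h6 := mul_le_mul_of_nonneg_left h1 (by positivity : 0 ≤ 2 * K ^ 2)
    have h7 := h2.trans h3
    nlinarith

end giant

section coloring

variable {V : Type*} [Fintype V] {q : ℕ}

/-- Colorings that are constant on the clusters of `E`. -/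
noncomputable def clusterColorings (q : ℕ) (E : Finset (Sym2 V)) : Finset (V → Fin q) :=
  Finset.univ.filter (fun τ => ∀ u, ∀ v ∈ cluster E {u}, τ v = τ u)

lemma mem_clusterColorings {E : Finset (Sym2 V)} {τ : V → Fin q} :
    τ ∈ clusterColorings q E ↔ ∀ u, ∀ v ∈ cluster E {u}, τ v = τ u := by
  simp [clusterColorings]

/-- Expectation over a uniformly random coloring of the clusters. -/
noncomputable def colorExp (E : Finset (Sym2 V)) (h : (V → Fin q) → ℝ) : ℝ :=
  (#(clusterColorings q E) : ℝ)⁻¹ * ∑ τ ∈ clusterColorings q E, h τ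

lemma colorExp_mono {E : Finset (Sym2 V)} {h h' : (V → Fin q) → ℝ}
    (hle : ∀ τ ∈ clusterColorings q E, h τ ≤ h' τ) : colorExp E h ≤ colorExp E h' :=
  mul_le_mul_of_nonneg_left (Finset.sum_le_sum hle) (by positivity)

lemma colorExp_add (E : Finset (Sym2 V)) (h h' : (V → Fin q) → ℝ) :
    colorExp E (fun τ => h τ + h' τ) = colorExp E h + colorExp E h' := by
  rw [colorExp, Finset.sum_add_distrib, mul_add]; rfl

lemma colorExp_mul_left (E : Finset (Sym2 V)) (c : ℝ) (h : (V → Fin q) → ℝ) :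
    colorExp E (fun τ => c * h τ) = c * colorExp E h := by
  rw [colorExp, ← Finset.mul_sum, mul_left_comm]; rfl

lemma colorExp_sum {ι : Type*} (s : Finset ι) (E : Finset (Sym2 V)) (h : ι → (V → Fin q) → ℝ) :
    colorExp E (fun τ => ∑ i ∈ s, h i τ) = ∑ i ∈ s, colorExp E (h i) := by
  rw [colorExp, Finset.sum_comm, Finset.mul_sum]; rfl

/-- Shift the color of one cluster. -/
noncomputable def shiftCluster (E : Finset (Sym2 V)) (u : V) (c : Fin q) (τ : V → Fin q) :
    V → Fin q :=
  fun v => if v ∈ cluster E {u} then τ v + c else τ v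

lemma shiftCluster_mem {E : Finset (Sym2 V)} (u : V) (c : Fin q) {τ : V → Fin q}
    (hτ : τ ∈ clusterColorings q E) : shiftCluster E u c τ ∈ clusterColorings q E := by
  rw [mem_clusterColorings] at hτ ⊢
  intro a b hb
  have : b ∈ cluster E {u} ↔ a ∈ cluster E {u} := by
    rw [mem_cluster_comm (u := u), mem_cluster_comm (u := u), cluster_singleton_eq hb]
  simp only [shiftCluster, this, hτ a b hb]

variable [NeZero q]

lemma colorExp_const (E : Finset (Sym2 V)) (c : ℝ) :
    colorExp E (fun _ : V → Fin q => c) = c := by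
  have hne : (clusterColorings q E).Nonempty :=
    ⟨fun _ => 0, mem_clusterColorings.2 fun _ _ _ => rfl⟩
  have : (#(clusterColorings q E) : ℝ) ≠ 0 := by
    exact_mod_cast (Finset.card_pos.2 hne).ne'
  rw [colorExp, Finset.sum_const, nsmul_eq_mul, inv_mul_cancel_left₀ this]

lemma shiftCluster_shiftCluster_neg (E : Finset (Sym2 V)) (u : V) (c : Fin q) (τ : V → Fin q) :
    shiftCluster E u c (shiftCluster E u (-c) τ) = τ := by
  funext v
  simp only [shiftCluster]
  split_ifs <;> simp

lemma colorExp_shift (E : Finset (Sym2 V)) (u : V) (c : Fin q) (h : (V → Fin q) → ℝ) :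
    colorExp E (fun τ => h (shiftCluster E u c τ)) = colorExp E h := by
  rw [colorExp, colorExp]
  congr 1
  refine Finset.sum_bij' (fun τ _ => shiftCluster E u c τ) (fun τ _ => shiftCluster E u (-c) τ)
    (fun τ hτ => shiftCluster_mem u c hτ) (fun τ hτ => shiftCluster_mem u (-c) hτ)
    (fun τ _ => ?_) (fun τ _ => shiftCluster_shiftCluster_neg E u c τ) (fun _ _ => rfl)
  have := shiftCluster_shiftCluster_neg E u (-c) τ
  rwa [neg_neg] at this

lemma colorExp_cross {E : Finset (Sym2 V)} {ψ : Fin q → ℝ} (hψ : ∑ i, ψ i = 0) {g u v : V}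
    (hg : g ∉ cluster E {u}) (hv : v ∉ cluster E {u}) :
    colorExp E (fun τ : V → Fin q => ψ (τ u - τ g) * ψ (τ v - τ g)) = 0 := by
  have h1 : ∀ c : Fin q, colorExp E (fun τ : V → Fin q => ψ (τ u - τ g + c) * ψ (τ v - τ g)) =
      colorExp E (fun τ : V → Fin q => ψ (τ u - τ g) * ψ (τ v - τ g)) := by
    intro c
    rw [← colorExp_shift E u c (fun τ : V → Fin q => ψ (τ u - τ g) * ψ (τ v - τ g))]
    simp only [shiftCluster, if_neg hg, if_neg hv, if_pos (self_mem_cluster E u)]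
    congr 1
    funext τ
    congr 2
    abel
  have h2 : ∑ c : Fin q, colorExp E
      (fun τ : V → Fin q => ψ (τ u - τ g + c) * ψ (τ v - τ g)) = 0 := by
    rw [← colorExp_sum]
    have : ∀ τ : V → Fin q, ∑ c : Fin q, ψ (τ u - τ g + c) * ψ (τ v - τ g) = 0 := by
      intro τ
      have h := Equiv.sum_comp (Equiv.addLeft (τ u - τ g)) ψ
      simp only [Equiv.coe_addLeft] at h
      rw [← Finset.sum_mul, h, hψ, zero_mul]
    simp only [this, colorExp_const]
  rw [Finset.sum_congr rfl (fun c _ => h1 c), Finset.sum_const, nsmul_eq_mul] at h2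
  refine (mul_eq_zero.1 h2).resolve_left ?_
  simp [NeZero.ne q]

variable [DecidableEq V]

lemma colorExp_sq_le (E : Finset (Sym2 V)) {ψ : Fin q → ℝ} (hψ : ∑ i, ψ i = 0)
    (hψ1 : ∀ i, |ψ i| ≤ 1) (g : V) {w : V → ℝ} {K : ℝ} (hw : ∀ v, |w v| ≤ K) :
    colorExp E (fun τ : V → Fin q => (∑ v ∈ (cluster E {g})ᶜ, w v * ψ (τ v - τ g)) ^ 2) ≤
      K ^ 2 * ∑ v ∈ (cluster E {g})ᶜ, (#(cluster E {v}) : ℝ) := by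
  have hK : 0 ≤ K := (abs_nonneg _).trans (hw g)
  have e : ∀ τ : V → Fin q, (∑ v ∈ (cluster E {g})ᶜ, w v * ψ (τ v - τ g)) ^ 2 =
      ∑ u ∈ (cluster E {g})ᶜ, ∑ v ∈ (cluster E {g})ᶜ,
        w u * w v * (ψ (τ u - τ g) * ψ (τ v - τ g)) := by
    intro τ
    rw [sq, Finset.sum_mul_sum]
    exact Finset.sum_congr rfl fun u _ => Finset.sum_congr rfl fun v _ => by ring
  simp only [e]
  rw [colorExp_sum, Finset.mul_sum]
  refine Finset.sum_le_sum fun u hu => ?_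
  rw [colorExp_sum]
  have hgu : g ∉ cluster E {u} := by
    rw [mem_cluster_comm]; exact Finset.mem_compl.1 hu
  have hterm : ∀ v ∈ (cluster E {g})ᶜ, colorExp E (fun τ : V → Fin q =>
      w u * w v * (ψ (τ u - τ g) * ψ (τ v - τ g))) ≤ if v ∈ cluster E {u} then K ^ 2 else 0 := by
    intro v _
    split_ifs with hv
    · refine (colorExp_mono (h' := fun _ => K ^ 2) fun τ _ => ?_).trans (colorExp_const _ _).le
      refine (le_abs_self _).trans ?_
      rw [abs_mul, abs_mul, abs_mul, sq]
      have h1 : |w u| * |w v| ≤ K * K :=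
        mul_le_mul (hw u) (hw v) (abs_nonneg _) hK
      have h2 : |ψ (τ u - τ g)| * |ψ (τ v - τ g)| ≤ 1 * 1 :=
        mul_le_mul (hψ1 _) (hψ1 _) (abs_nonneg _) zero_le_one
      calc _ ≤ K * K * (1 * 1) := mul_le_mul h1 h2 (by positivity) (by positivity)
        _ = _ := by ring
    · rw [colorExp_mul_left, colorExp_cross hψ hgu hv, mul_zero]
  refine (Finset.sum_le_sum hterm).trans ?_
  rw [← Finset.sum_filter, Finset.sum_const, nsmul_eq_mul, mul_comm]
  refine mul_le_mul_of_nonneg_left ?_ (by positivity)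
  exact_mod_cast Finset.card_le_card fun v hv => (Finset.mem_filter.1 hv).2

/-- The color of `g` is the strictly most common one. -/
def StrictlyDominant (τ : V → Fin q) (g : V) : Prop :=
  ∀ j, j ≠ τ g → #(Finset.univ.filter fun v => τ v = j) < #(Finset.univ.filter fun v => τ v = τ g)

lemma card_color_sub {E : Finset (Sym2 V)} {τ : V → Fin q} (hτ : τ ∈ clusterColorings q E) (g : V)
    {c : Fin q} (hc : c ≠ 0) :
    (#(Finset.univ.filter fun v => τ v = τ g) : ℝ) - #(Finset.univ.filter fun v => τ v = τ g + c) =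
      #(cluster E {g}) + ∑ v ∈ (cluster E {g})ᶜ,
        1 * ((if τ v - τ g = 0 then 1 else 0) - if τ v - τ g = c then 1 else 0 : ℝ) := by
  rw [Finset.card_filter, Finset.card_filter, Nat.cast_sum, Nat.cast_sum, ← Finset.sum_sub_distrib,
    ← Finset.sum_add_sum_compl (cluster E {g})]
  congr 1
  · rw [Finset.cast_card]
    refine Finset.sum_congr rfl fun v hv => ?_
    rw [mem_clusterColorings.1 hτ g v hv]
    simp [hc]
  · refine Finset.sum_congr rfl fun v _ => ?_
    simp only [sub_eq_iff_eq_add', add_zero, one_mul]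
    push_cast
    ring

lemma colorExp_not_dominant_le (E : Finset (Sym2 V)) (g : V) :
    colorExp E (fun τ : V → Fin q => if StrictlyDominant τ g then 0 else 1) ≤
      q / (#(cluster E {g}) : ℝ) ^ 2 * ∑ v ∈ (cluster E {g})ᶜ, (#(cluster E {v}) : ℝ) := by
  set G := (#(cluster E {g}) : ℝ) with hG
  have hG0 : 0 < G := by
    rw [hG]; exact_mod_cast Finset.card_pos.2 ⟨g, self_mem_cluster E g⟩
  set S := ∑ v ∈ (cluster E {g})ᶜ, (#(cluster E {v}) : ℝ) with hS
  have hS0 : 0 ≤ S := Finset.sum_nonneg fun _ _ => by positivity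
  set ψ : Fin q → Fin q → ℝ := fun c i => (if i = 0 then 1 else 0) - if i = c then 1 else 0 with hψ
  have hψ0 : ∀ c, ∑ i, ψ c i = 0 := by intro c; simp [hψ]
  have hψ1 : ∀ c i, |ψ c i| ≤ 1 := by
    intro c i
    simp only [hψ]
    split_ifs <;> norm_num
  refine (colorExp_mono (h' := fun τ => ∑ c : Fin q,
    (G ^ 2)⁻¹ * (∑ v ∈ (cluster E {g})ᶜ, 1 * ψ c (τ v - τ g)) ^ 2) fun τ hτ => ?_).trans ?_
  · have hnn : ∀ c ∈ (Finset.univ : Finset (Fin q)),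
        0 ≤ (G ^ 2)⁻¹ * (∑ v ∈ (cluster E {g})ᶜ, 1 * ψ c (τ v - τ g)) ^ 2 :=
      fun c _ => by positivity
    split_ifs with hd
    · exact Finset.sum_nonneg hnn
    · rw [StrictlyDominant] at hd
      push Not at hd
      obtain ⟨j, hj, hle⟩ := hd
      refine le_trans ?_ (Finset.single_le_sum hnn (Finset.mem_univ (j - τ g)))
      have h1 := card_color_sub hτ g (sub_ne_zero.2 hj)
      rw [add_sub_cancel] at h1
      have h2 : (#(Finset.univ.filter fun v => τ v = τ g) : ℝ) ≤
        #(Finset.univ.filter fun v => τ v = j) := by exact_mod_cast hle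
      rw [inv_mul_eq_div, le_div_iff₀ (by positivity), one_mul]
      simp only [hψ]
      set Y := ∑ v ∈ (cluster E {g})ᶜ,
        1 * ((if τ v - τ g = 0 then 1 else 0) - if τ v - τ g = j - τ g then 1 else 0 : ℝ)
      nlinarith
  · rw [colorExp_sum]
    refine (Finset.sum_le_sum fun c _ => ?_).trans_eq (b := ∑ c : Fin q, (G ^ 2)⁻¹ * S) ?_
    · rw [colorExp_mul_left]
      refine mul_le_mul_of_nonneg_left ?_ (by positivity)
      have := colorExp_sq_le E (hψ0 c) (hψ1 c) g (w := fun _ => 1) (K := 1) (by simp)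
      rwa [one_pow, one_mul] at this
    · rw [Finset.sum_const, Finset.card_univ, Fintype.card_fin, nsmul_eq_mul]
      field_simp

/-- The weight of the color class of `g`, split into the cluster of `g` and a centred remainder. -/
lemma sum_color_eq {E : Finset (Sym2 V)} {τ : V → Fin q} (hτ : τ ∈ clusterColorings q E) (g : V)
    {w : V → ℝ} (hw : ∑ v, w v = 0) :
    ∑ v ∈ Finset.univ.filter (fun v => τ v = τ g), w v =
      (1 - 1 / (q : ℝ)) * ∑ v ∈ cluster E {g}, w v +
        ∑ v ∈ (cluster E {g})ᶜ, w v * ((if τ v - τ g = 0 then 1 else 0) - 1 / (q : ℝ)) := by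
  rw [Finset.sum_filter, ← Finset.sum_add_sum_compl (cluster E {g})]
  have h1 : ∑ v ∈ cluster E {g}, (if τ v = τ g then w v else 0) = ∑ v ∈ cluster E {g}, w v :=
    Finset.sum_congr rfl fun v hv => if_pos (mem_clusterColorings.1 hτ g v hv)
  have h2 := hw
  rw [← Finset.sum_add_sum_compl (cluster E {g})] at h2
  have h3 : ∑ v ∈ (cluster E {g})ᶜ, w v * ((if τ v - τ g = 0 then 1 else 0) - 1 / (q : ℝ)) =
      ∑ v ∈ (cluster E {g})ᶜ, (if τ v = τ g then w v else 0) -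
        (1 / (q : ℝ)) * ∑ v ∈ (cluster E {g})ᶜ, w v := by
    rw [Finset.mul_sum, ← Finset.sum_sub_distrib]
    refine Finset.sum_congr rfl fun v _ => ?_
    simp only [sub_eq_zero]
    split_ifs <;> ring
  rw [h1, h3]
  linear_combination (1 / (q : ℝ)) * h2

lemma colorExp_remainder_sq_le (hq : 2 ≤ q) (E : Finset (Sym2 V)) (g : V) {w : V → ℝ} {K : ℝ}
    (hw : ∀ v, |w v| ≤ K) :
    colorExp E (fun τ : V → Fin q => (∑ v ∈ (cluster E {g})ᶜ,
      w v * ((if τ v - τ g = 0 then 1 else 0) - 1 / (q : ℝ))) ^ 2) ≤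
      K ^ 2 * ∑ v ∈ (cluster E {g})ᶜ, (#(cluster E {v}) : ℝ) := by
  have hq0 : (0 : ℝ) < q := by exact_mod_cast (by omega : 0 < q)
  refine colorExp_sq_le E (ψ := fun i => (if i = 0 then 1 else 0) - 1 / (q : ℝ)) ?_ ?_ g hw
  · rw [Finset.sum_sub_distrib, Finset.sum_ite_eq', if_pos (Finset.mem_univ _), Finset.sum_const,
      Finset.card_univ, Fintype.card_fin, nsmul_eq_mul]
    field_simp
    ring
  · intro i
    have h1 : 1 / (q : ℝ) ≤ 1 := by
      rw [div_le_one hq0]; exact_mod_cast (by omega : 1 ≤ q)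
    have h0 : 0 ≤ 1 / (q : ℝ) := by positivity
    rw [abs_le]
    split_ifs <;> constructor <;> linarith

end coloring

section step

variable {V : Type*} [Fintype V] {q : ℕ}

/-- Vertices of color `j`. -/
def colorClass (x : V → Fin q) (j : Fin q) : Finset V := Finset.univ.filter fun v => x v = j

lemma mem_colorClass {x : V → Fin q} {j : Fin q} {v : V} : v ∈ colorClass x j ↔ x v = j := by
  simp [colorClass]

lemma sum_colorClass (x : V → Fin q) (f : V → ℝ) : ∑ j, ∑ v ∈ colorClass x j, f v = ∑ v, f v :=
  Finset.sum_fiberwise _ _ _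

/-- Total size of the clusters other than the large ones of color `i`, counted per vertex. -/
noncomputable def smallMass (x : V → Fin q) (i : Fin q) (t : ℝ) (E : Finset (Sym2 V)) : ℝ :=
  ∑ v ∈ colorClass x i, (if t ≤ #(cluster E {v}) then 0 else (#(cluster E {v}) : ℝ)) +
    ∑ j ∈ Finset.univ.erase i, ∑ v ∈ colorClass x j, (#(cluster E {v}) : ℝ)

lemma smallMass_nonneg (x : V → Fin q) (i : Fin q) (t : ℝ) (E : Finset (Sym2 V)) :
    0 ≤ smallMass x i t E := by
  unfold smallMass; positivity

variable [DecidableEq V]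

/-- Monochromatic edges. -/
def monoEdges (x : V → Fin q) : Finset (Sym2 V) :=
  Finset.univ.biUnion fun j => edgesIn (colorClass x j)

lemma mk_mem_monoEdges {x : V → Fin q} {a b : V} : s(a, b) ∈ monoEdges x ↔ x a = x b ∧ a ≠ b := by
  simp only [monoEdges, Finset.mem_biUnion, Finset.mem_univ, true_and, mk_mem_edgesIn,
    mem_colorClass]
  constructor
  · rintro ⟨j, ha, hb, h⟩
    exact ⟨ha.trans hb.symm, h⟩
  · rintro ⟨h, hab⟩
    exact ⟨x b, h, rfl, hab⟩

lemma edgesIn_subset_monoEdges (x : V → Fin q) (j : Fin q) :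
    edgesIn (colorClass x j) ⊆ monoEdges x :=
  Finset.subset_biUnion_of_mem (fun j => edgesIn (colorClass x j)) (Finset.mem_univ j)

lemma cluster_inter_edgesIn {x : V → Fin q} {E : Finset (Sym2 V)} (hE : E ⊆ monoEdges x)
    {j : Fin q} {v : V} (hv : v ∈ colorClass x j) :
    cluster (E ∩ edgesIn (colorClass x j)) {v} = cluster E {v} := by
  apply Finset.Subset.antisymm
  · refine cluster_subset (subset_cluster E {v}) fun a ha b hab => ?_
    exact mem_cluster_of_adj ha (Finset.mem_inter.1 hab).1
  · refine cluster_subset (subset_cluster _ {v}) fun a ha b hab => ?_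
    have haD := cluster_subset_of_edgesIn Finset.inter_subset_right
      (Finset.singleton_subset_iff.2 hv) ha
    have h := mk_mem_monoEdges.1 (hE hab)
    refine mem_cluster_of_adj ha (Finset.mem_inter.2 ⟨hab, mk_mem_edgesIn.2 ⟨haD, ?_, h.2⟩⟩)
    rw [mem_colorClass] at haD ⊢
    rw [← h.1, haD]

lemma largeSet_inter_edgesIn {x : V → Fin q} {E : Finset (Sym2 V)} (hE : E ⊆ monoEdges x)
    (j : Fin q) (t : ℝ) :
    largeSet (colorClass x j) t (E ∩ edgesIn (colorClass x j)) =
      largeSet (colorClass x j) t E := by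
  ext v
  rw [mem_largeSet, mem_largeSet]
  exact and_congr_right fun hv => by rw [cluster_inter_edgesIn hE hv]

lemma hasGiant_inter_edgesIn {x : V → Fin q} {E : Finset (Sym2 V)} (hE : E ⊆ monoEdges x)
    (j : Fin q) (t : ℝ) :
    HasGiant (colorClass x j) t (E ∩ edgesIn (colorClass x j)) ↔
      HasGiant (colorClass x j) t E := by
  rw [HasGiant, HasGiant, largeSet_inter_edgesIn hE]
  refine and_congr_right fun _ => forall₂_congr fun u hu => ?_
  rw [cluster_inter_edgesIn hE (mem_largeSet.1 hu).1]

/-- The expectation of a function of the clusters of one color class. -/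
lemma bernExp_monoEdges {p : ℝ} (x : V → Fin q) (j : Fin q) {f : Finset (Sym2 V) → ℝ}
    (hf : ∀ E ⊆ monoEdges x, f (E ∩ edgesIn (colorClass x j)) = f E) :
    bernExp p (monoEdges x) f = bernExp p (edgesIn (colorClass x j)) f := by
  rw [← bernExp_inter (edgesIn_subset_monoEdges x j) f]
  exact bernExp_congr fun E hE => (hf E hE).symm

lemma HasGiant.largeSet_colorClass {x : V → Fin q} {i : Fin q} {t : ℝ} {E : Finset (Sym2 V)}
    (hE : E ⊆ monoEdges x) (hG : HasGiant (colorClass x i) t E) {g : V}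
    (hg : g ∈ largeSet (colorClass x i) t E) :
    largeSet (colorClass x i) t E = cluster E {g} := by
  rw [← largeSet_inter_edgesIn hE] at hg ⊢
  rw [((hasGiant_inter_edgesIn hE i t).2 hG).largeSet_eq Finset.inter_subset_right hg,
    cluster_inter_edgesIn hE (mem_largeSet.1 hg).1]

lemma sum_compl_cluster_le {x : V → Fin q} {i : Fin q} {t : ℝ} {E : Finset (Sym2 V)} {g : V}
    (hL : largeSet (colorClass x i) t E = cluster E {g}) :
    ∑ v ∈ (cluster E {g})ᶜ, (#(cluster E {v}) : ℝ) ≤ smallMass x i t E := by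
  have h1 : ∑ v ∈ (cluster E {g})ᶜ, (#(cluster E {v}) : ℝ) =
      ∑ v, if v ∈ largeSet (colorClass x i) t E then 0 else (#(cluster E {v}) : ℝ) := by
    rw [hL, Finset.compl_eq_univ_sdiff, ← Finset.filter_notMem_eq_sdiff, Finset.sum_filter]
    exact Finset.sum_congr rfl fun v _ => by rw [ite_not]
  rw [h1, ← sum_colorClass x, ← Finset.add_sum_erase _ _ (Finset.mem_univ i), smallMass]
  refine add_le_add (Finset.sum_le_sum fun v hv => ?_)
    (Finset.sum_le_sum fun j _ => Finset.sum_le_sum fun v _ => ?_)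
  · simp only [mem_largeSet, hv, true_and, le_refl]
  · split_ifs
    · positivity
    · exact le_rfl

lemma colorExp_le_of_hasGiant (hq : 2 ≤ q) {x : V → Fin q} {i : Fin q} {t : ℝ} (ht : 0 < t)
    {E : Finset (Sym2 V)} (hE : E ⊆ monoEdges x) (hG : HasGiant (colorClass x i) t E)
    {w : V → ℝ} {K s : ℝ} (hw0 : ∑ v, w v = 0) (hw : ∀ v, |w v| ≤ K)
    {h : (V → Fin q) → ℝ} (h1 : ∀ τ, h τ ≤ 1) (hd : ∀ τ g, StrictlyDominant τ g →
      h τ ≤ (∑ v ∈ colorClass τ (τ g), w v - (1 - 1 / (q : ℝ)) * s) ^ 2) :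
    colorExp E h ≤ 2 * (∑ v ∈ largeSet (colorClass x i) t E, w v - s) ^ 2 +
      (q / t ^ 2 + 2 * K ^ 2) * smallMass x i t E := by
  have : NeZero q := ⟨by omega⟩
  obtain ⟨g, hg⟩ := hG.1
  have hL := hG.largeSet_colorClass hE hg
  have hgt : t ≤ #(cluster E {g}) := (mem_largeSet.1 hg).2
  have hS := sum_compl_cluster_le hL
  rw [hL]
  set S := ∑ v ∈ (cluster E {g})ᶜ, (#(cluster E {v}) : ℝ) with hSdef
  have hS0 : 0 ≤ S := Finset.sum_nonneg fun _ _ => by positivity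
  set A := ∑ v ∈ cluster E {g}, w v - s with hA
  have hq1 : |1 - 1 / (q : ℝ)| ≤ 1 := by
    have h2 : 1 / (q : ℝ) ≤ 1 := by
      rw [div_le_one (by positivity)]; exact_mod_cast (by omega : 1 ≤ q)
    have h0 : 0 ≤ 1 / (q : ℝ) := by positivity
    rw [abs_le]; constructor <;> linarith
  have hqA : ((1 - 1 / (q : ℝ)) * A) ^ 2 ≤ A ^ 2 := by
    rw [← sq_abs, abs_mul, ← sq_abs A]
    exact pow_le_pow_left₀ (by positivity) (mul_le_of_le_one_left (abs_nonneg _) hq1) 2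
  refine (colorExp_mono (h' := fun τ => (if StrictlyDominant τ g then 0 else 1) +
    (2 * A ^ 2 + 2 * (∑ v ∈ (cluster E {g})ᶜ,
      w v * ((if τ v - τ g = 0 then 1 else 0) - 1 / (q : ℝ))) ^ 2)) fun τ hτ => ?_).trans ?_
  · by_cases hτd : StrictlyDominant τ g
    · rw [if_pos hτd, zero_add]
      refine (hd τ g hτd).trans ?_
      rw [colorClass, sum_color_eq hτ g hw0]
      set R := ∑ v ∈ (cluster E {g})ᶜ,
        w v * ((if τ v - τ g = 0 then 1 else 0) - 1 / (q : ℝ)) with hR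
      have e : (1 - 1 / (q : ℝ)) * ∑ v ∈ cluster E {g}, w v + R - (1 - 1 / (q : ℝ)) * s =
          (1 - 1 / (q : ℝ)) * A + R := by rw [hA]; ring
      rw [e]
      nlinarith [sq_nonneg ((1 - 1 / (q : ℝ)) * A - R)]
    · rw [if_neg hτd]
      exact (h1 τ).trans (by linarith [sq_nonneg A, sq_nonneg (∑ v ∈ (cluster E {g})ᶜ,
        w v * ((if τ v - τ g = 0 then 1 else 0) - 1 / (q : ℝ)))])
  · rw [colorExp_add, colorExp_add, colorExp_const, colorExp_mul_left]
    have h2 := colorExp_not_dominant_le (q := q) E g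
    have h3 := colorExp_remainder_sq_le hq E g hw
    rw [← hSdef] at h2 h3
    have h4 : q / (#(cluster E {g}) : ℝ) ^ 2 * S ≤ q / t ^ 2 * S :=
      mul_le_mul_of_nonneg_right (div_le_div_of_nonneg_left (by positivity) (by positivity)
        (pow_le_pow_left₀ ht.le hgt 2)) hS0
    have h5 : (q / t ^ 2 + 2 * K ^ 2) * S ≤ (q / t ^ 2 + 2 * K ^ 2) * smallMass x i t E :=
      mul_le_mul_of_nonneg_left hS (by positivity)
    linarith

end step

section secondMoment

variable {q : ℕ} {β δ μ : ℝ}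

lemma card_le_mul_card_colorClass {V : Type*} [DecidableEq V] [Fintype V] {x : V → Fin q}
    {i : Fin q} (hi : ∀ j, #(colorClass x j) ≤ #(colorClass x i)) :
    (Fintype.card V : ℝ) ≤ q * #(colorClass x i) := by
  have h : Fintype.card V = ∑ j, #(colorClass x j) :=
    Finset.card_eq_sum_card_fiberwise (f := x) fun _ _ => Finset.mem_coe.2 (Finset.mem_univ _)
  have h2 : ∑ j, #(colorClass x j) ≤ q * #(colorClass x i) := by
    refine (Finset.sum_le_card_nsmul _ _ _ fun j _ => hi j).trans_eq ?_
    rw [Finset.card_univ, Fintype.card_fin, smul_eq_mul]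
  exact_mod_cast h.trans_le h2

lemma bernExp_smallMass (h : Supercritical (β / q) β δ) (hμ0 : 0 < μ) (hμ1 : μ < 1) :
    ∃ C : ℝ, 0 < C ∧ ∀ (V : Type) [DecidableEq V] [Fintype V] (x : V → Fin q) (i : Fin q) (y : ℝ),
      0 ≤ y → β / q ≤ y * #(colorClass x i) → y * #(colorClass x i) ≤ β →
      (∀ j, j ≠ i → y * #(colorClass x j) ≤ μ) →
      bernExp (1 - Real.exp (-y)) (monoEdges x)
        (smallMass x i (δ * #(colorClass x i))) ≤ C * (Fintype.card V : ℝ) := by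
  obtain ⟨C1, hC1, hsmall⟩ := h.small_sum
  obtain ⟨C2, hC2, hsub⟩ := subcritical_cluster_sum hμ0 hμ1
  refine ⟨C1 + q * C2, by positivity, fun V _ _ x i y hy hly hyβ hj => ?_⟩
  have hcard : ∀ j, (#(colorClass x j) : ℝ) ≤ Fintype.card V := fun j => by
    exact_mod_cast Finset.card_le_univ _
  unfold smallMass
  rw [bernExp_add, add_mul]
  refine add_le_add ?_ ?_
  · rw [bernExp_sum]
    refine (Finset.sum_le_card_nsmul _ _ C1 fun v hv => ?_).trans ?_
    · rw [bernExp_monoEdges x i (f := fun E => if δ * #(colorClass x i) ≤ #(cluster E {v}) then 0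
        else (#(cluster E {v}) : ℝ)) fun E hE => by simp only [cluster_inter_edgesIn hE hv]]
      exact hsmall V y _ hy hly hyβ v hv
    · rw [nsmul_eq_mul, mul_comm]
      exact mul_le_mul_of_nonneg_left (hcard i) hC1.le
  · rw [bernExp_sum]
    refine (Finset.sum_le_card_nsmul _ _ (C2 * Fintype.card V) fun j hji => ?_).trans ?_
    · rw [bernExp_monoEdges x j (f := fun E => ∑ v ∈ colorClass x j, (#(cluster E {v}) : ℝ))
        fun E hE => Finset.sum_congr rfl fun v hv => by rw [cluster_inter_edgesIn hE hv]]
      refine (hsub V y _ hy (hj j (Finset.ne_of_mem_erase hji))).trans ?_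
      exact mul_le_mul_of_nonneg_left (hcard j) hC2.le
    · have : (#(Finset.univ.erase i) : ℝ) ≤ q := by
        exact_mod_cast (Finset.card_le_univ _).trans (Fintype.card_fin q).le
      rw [nsmul_eq_mul, mul_assoc (q : ℝ)]
      exact mul_le_mul_of_nonneg_right this (by positivity)

/-- Second moment bound for one percolation and coloring step. -/
lemma bernExp_colorExp_le (hq : 2 ≤ q) (hβ : (q : ℝ) < β) (hμ0 : 0 < μ) (hμ1 : μ < 1) :
    ∃ C M : ℝ, 0 < C ∧ ∀ (V : Type) [DecidableEq V] [Fintype V] (x : V → Fin q) (i : Fin q),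
      M ≤ (Fintype.card V : ℝ) → (∀ j, #(colorClass x j) ≤ #(colorClass x i)) →
      (∀ j, j ≠ i → β / Fintype.card V * #(colorClass x j) ≤ μ) →
      ∀ (w : V → ℝ) (K : ℝ), ∑ v, w v = 0 → (∀ v, |w v| ≤ K) →
      ∀ h : (V → Fin q) → ℝ, (∀ τ, h τ ≤ 1) → (∀ τ g, StrictlyDominant τ g →
        h τ ≤ (∑ v ∈ colorClass τ (τ g), w v - (1 - 1 / (q : ℝ)) *
          (theta (β / Fintype.card V * #(colorClass x i)) * ∑ v ∈ colorClass x i, w v)) ^ 2) →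
      bernExp (1 - Real.exp (-(β / Fintype.card V))) (monoEdges x) (fun E => colorExp E h) ≤
        C * (1 / Fintype.card V + K ^ 2 * Fintype.card V) := by
  have : NeZero q := ⟨by omega⟩
  have hq0 : (0 : ℝ) < q := by positivity
  have hq1 : (1 : ℝ) ≤ q := by exact_mod_cast (by omega : 1 ≤ q)
  obtain ⟨δ, h⟩ := Supercritical.exists (l := β / q) (β := β) ((one_lt_div hq0).2 hβ)
    (by linarith)
  have hδ := h.pos
  obtain ⟨C1, hC1, hS⟩ := bernExp_smallMass h hμ0 hμ1
  obtain ⟨C2, M2, hC2, hM2, hW⟩ := h.largeSet_weight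
  obtain ⟨C3, M3, hC3, hM3, hG⟩ := h.giant
  refine ⟨C3 * q + 2 * C2 + (q ^ 3 / δ ^ 2 + 2) * C1, q * max M2 M3, by positivity,
    fun V _ _ x i hM hi hj w K hw0 hw ψ hψ1 hψ => ?_⟩
  have hnD := card_le_mul_card_colorClass hi
  set n : ℝ := (Fintype.card V : ℝ) with hn
  set D := colorClass x i with hD
  have hMD : max M2 M3 ≤ #D := le_of_mul_le_mul_left (hM.trans hnD) hq0
  have hD0 : (0 : ℝ) < #D := by have := (le_max_left M2 M3).trans hMD; linarith
  have hDn : (#D : ℝ) ≤ n := by rw [hn]; exact_mod_cast Finset.card_le_univ _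
  have hn0 : 0 < n := hD0.trans_le hDn
  have hβ0 : 0 < β := hq0.trans hβ
  set y := β / n with hy
  have hy0 : 0 ≤ y := by positivity
  have hly : β / q ≤ y * #D := by
    rw [hy, div_mul_eq_mul_div, div_le_div_iff₀ hq0 hn0]
    nlinarith
  have hyβ : y * #D ≤ β := by
    rw [hy, div_mul_eq_mul_div, div_le_iff₀ hn0]
    exact mul_le_mul_of_nonneg_left hDn hβ0.le
  have hp := one_sub_exp_neg_mem_Icc hy0
  set t := δ * #D with ht
  have ht0 : 0 < t := by positivity
  have h1 := hS V x i y hy0 hly hyβ hj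
  have h2 := hW V y D hy0 ((le_max_left _ _).trans hMD) hly hyβ w K hw
  have h3 := hG V y D hy0 ((le_max_right _ _).trans hMD) hly hyβ
  rw [← hD, ← ht] at h1
  rw [← ht] at h2 h3
  set s := theta (y * #D) * ∑ v ∈ D, w v with hs
  refine (bernExp_mono hp (g := fun E => (if HasGiant D t E then 0 else 1) +
    (2 * (∑ v ∈ largeSet D t E, w v - s) ^ 2 +
      (q / t ^ 2 + 2 * K ^ 2) * smallMass x i t E)) fun E hE => ?_).trans ?_
  · by_cases hg : HasGiant D t E
    · rw [if_pos hg, zero_add]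
      exact colorExp_le_of_hasGiant hq ht0 hE hg hw0 hw hψ1 hψ
    · rw [if_neg hg]
      have h4 : colorExp E ψ ≤ 1 := (colorExp_mono fun τ _ => hψ1 τ).trans (colorExp_const E 1).le
      have := mul_nonneg (by positivity : 0 ≤ q / t ^ 2 + 2 * K ^ 2) (smallMass_nonneg x i t E)
      linarith [sq_nonneg (∑ v ∈ largeSet D t E, w v - s)]
  · rw [bernExp_add, bernExp_add, bernExp_mul_left, bernExp_mul_left,
      bernExp_monoEdges x i (f := fun E => if HasGiant D t E then 0 else 1)
        fun E hE => by simp only [hD, hasGiant_inter_edgesIn hE],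
      bernExp_monoEdges x i (f := fun E => (∑ v ∈ largeSet D t E, w v - s) ^ 2)
        fun E hE => by simp only [hD, largeSet_inter_edgesIn hE]]
    have h5 : C3 / #D ≤ C3 * q * (1 / n) := by
      rw [mul_one_div, div_le_div_iff₀ hD0 hn0]
      nlinarith
    have h6 : C2 * K ^ 2 * #D ≤ C2 * (K ^ 2 * n) := by
      rw [mul_assoc]; gcongr
    have h7 : q / t ^ 2 ≤ q ^ 3 / δ ^ 2 / n ^ 2 := by
      rw [div_div, ht, mul_pow, div_le_div_iff₀ (by positivity) (by positivity)]
      have : n ^ 2 ≤ (q * #D) ^ 2 := pow_le_pow_left₀ hn0.le hnD 2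
      calc (q : ℝ) * (δ ^ 2 * n ^ 2) ≤ q * (δ ^ 2 * (q * #D) ^ 2) := by gcongr
        _ = _ := by ring
    have h8 : (q / t ^ 2 + 2 * K ^ 2) * bernExp (1 - Real.exp (-y)) (monoEdges x)
        (smallMass x i t) ≤ (q ^ 3 / δ ^ 2 / n ^ 2 + 2 * K ^ 2) * (C1 * n) :=
      mul_le_mul (by linarith) h1 (bernExp_nonneg hp fun E _ => smallMass_nonneg x i t E)
        (by positivity)
    have h9 : (q ^ 3 / δ ^ 2 / n ^ 2 + 2 * K ^ 2) * (C1 * n) =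
        q ^ 3 / δ ^ 2 * C1 * (1 / n) + 2 * C1 * (K ^ 2 * n) := by
      field_simp
    have a1 : 0 ≤ C3 * q * (K ^ 2 * n) := by positivity
    have a2 : 0 ≤ 2 * C2 * (1 / n) := by positivity
    have a3 : 0 ≤ 2 * C1 * (1 / n) := by positivity
    have a4 : 0 ≤ q ^ 3 / δ ^ 2 * C1 * (K ^ 2 * n) := by positivity
    linarith

end secondMoment

section swendsenWang

variable {n q : ℕ} {β : ℝ}

lemma theta_mem_Icc (L : ℝ) : theta L ∈ Set.Icc (0 : ℝ) 1 := by
  unfold theta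
  split_ifs
  · simp
  · exact ⟨Real.sSup_nonneg fun x hx => hx.1.1.le, Real.sSup_le (fun x hx => hx.1.2.le) zero_le_one⟩

lemma reachable_graphOf_iff {E : Finset (Fin n × Fin n)} (hE : ∀ p ∈ E, p.1 ≠ p.2) {u v : Fin n} :
    (graphOf E).Reachable u v ↔ v ∈ cluster (E.image fun p => s(p.1, p.2)) {u} := by
  have h : (graphOf E).Adj = fun a b => s(a, b) ∈ E.image fun p => s(p.1, p.2) := by
    funext a b
    rw [graphOf, SimpleGraph.fromRel_adj, Finset.mem_image, eq_iff_iff]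
    constructor
    · rintro ⟨-, h | h⟩
      · exact ⟨_, h, rfl⟩
      · exact ⟨_, h, Sym2.eq_swap⟩
    · rintro ⟨⟨c, d⟩, hp, hcd⟩
      have hne := hE _ hp
      rcases Sym2.eq_iff.1 hcd with ⟨rfl, rfl⟩ | ⟨rfl, rfl⟩
      · exact ⟨hne, Or.inl hp⟩
      · exact ⟨hne.symm, Or.inr hp⟩
  rw [SimpleGraph.reachable_iff_reflTransGen, mem_cluster_singleton, h]

lemma forall_reachable_iff {E : Finset (Fin n × Fin n)} (hE : ∀ p ∈ E, p.1 ≠ p.2)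
    {τ : Conf n q} : (∀ u v : Fin n, (graphOf E).Reachable u v → τ u = τ v) ↔
      τ ∈ clusterColorings q (E.image fun p => s(p.1, p.2)) := by
  simp only [mem_clusterColorings, reachable_graphOf_iff hE, eq_comm]

lemma card_clusterColorings {E : Finset (Fin n × Fin n)} (hE : ∀ p ∈ E, p.1 ≠ p.2) :
    #(clusterColorings q (E.image fun p => s(p.1, p.2))) = q ^ numComps E := by
  have : Fintype (graphOf E).ConnectedComponent := Fintype.ofFinite _
  have h : clusterColorings q (E.image fun p => s(p.1, p.2)) =
      (Finset.univ : Finset ((graphOf E).ConnectedComponent → Fin q)).image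
        fun f v => f ((graphOf E).connectedComponentMk v) := by
    ext τ
    rw [← forall_reachable_iff hE, Finset.mem_image]
    constructor
    · intro hτ
      exact ⟨SimpleGraph.ConnectedComponent.lift τ fun v w p _ => hτ v w ⟨p⟩,
        Finset.mem_univ _, rfl⟩
    · rintro ⟨f, -, rfl⟩ u v huv
      exact congrArg f (SimpleGraph.ConnectedComponent.sound huv)
  have hinj : Function.Injective fun (f : (graphOf E).ConnectedComponent → Fin q) v =>
      f ((graphOf E).connectedComponentMk v) := fun f g hfg => funext fun c => by
    induction c using SimpleGraph.ConnectedComponent.ind with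
    | _ v => exact congrFun hfg v
  rw [h, Finset.card_image_of_injective _ hinj, Finset.card_univ, Fintype.card_fun,
    Fintype.card_fin, numComps, Nat.card_eq_fintype_card]

lemma monoEdges_eq_image (x : Conf n q) :
    monoEdges x = (monoPairs x).image fun p => s(p.1, p.2) := by
  ext e
  induction e with | _ a b
  rw [mk_mem_monoEdges, Finset.mem_image]
  constructor
  · rintro ⟨h, hab⟩
    rcases lt_or_gt_of_ne hab with hlt | hlt
    · exact ⟨(a, b), by simp [monoPairs, h, hlt], rfl⟩
    · exact ⟨(b, a), by simp [monoPairs, h, hlt], Sym2.eq_swap⟩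
  · rintro ⟨⟨c, d⟩, hp, hcd⟩
    simp only [monoPairs, Finset.mem_filter, Finset.mem_univ, true_and] at hp
    rcases Sym2.eq_iff.1 hcd with ⟨rfl, rfl⟩ | ⟨rfl, rfl⟩
    · exact ⟨hp.2, hp.1.ne⟩
    · exact ⟨hp.2.symm, hp.1.ne'⟩

/-- A Swendsen–Wang step is percolation followed by coloring of the clusters. -/
lemma sum_mul_swStep (x : Conf n q) (f : Conf n q → ℝ) :
    ∑ τ, f τ * swStep n q β x τ =
      bernExp (1 - Real.exp (-(β / n))) (monoEdges x) (fun E => colorExp E f) := by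
  have hinj : Set.InjOn (fun p : Fin n × Fin n => s(p.1, p.2)) (monoPairs x) := by
    rintro ⟨a, b⟩ hp ⟨c, d⟩ hp' h
    simp only [monoPairs, Finset.coe_filter, Finset.mem_univ, true_and, Set.mem_ofPred_eq] at hp hp'
    rcases Sym2.eq_iff.1 h with ⟨h1, h2⟩ | ⟨h1, h2⟩
    · exact Prod.ext h1 h2
    · have h1 : a = d := h1
      have h2 : b = c := h2
      subst h1 h2
      exact absurd hp.1 hp'.1.asymm
  rw [monoEdges_eq_image, bernExp_image hinj, bernExp]
  simp only [swStep, Finset.mul_sum]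
  rw [Finset.sum_comm]
  refine Finset.sum_congr rfl fun E hE => ?_
  have hE' : ∀ p ∈ E, p.1 ≠ p.2 := fun p hp =>
    (Finset.mem_filter.1 (Finset.mem_powerset.1 hE hp)).2.1.ne
  rw [colorExp, card_clusterColorings hE', sub_sub_cancel, Finset.mul_sum, Finset.mul_sum,
    ← Finset.sum_subset (Finset.subset_univ (clusterColorings q (E.image fun p => s(p.1, p.2))))]
  · refine Finset.sum_congr rfl fun τ hτ => ?_
    rw [if_pos ((forall_reachable_iff hE').2 hτ)]
    push_cast
    rw [inv_pow]
    ring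
  · intro τ _ hτ
    rw [if_neg fun h => hτ ((forall_reachable_iff hE').1 h), mul_zero, mul_zero]

lemma swStep_nonneg (hβ : 0 ≤ β) (x τ : Conf n q) : 0 ≤ swStep n q β x τ := by
  have h := (one_sub_exp_neg_mem_Icc (y := β / n) (by positivity)).1
  refine Finset.sum_nonneg fun E _ => mul_nonneg (by positivity) ?_
  split_ifs <;> positivity

lemma exists_domIdx (hq : 0 < q) (x : Conf n q) :
    ∃ i : Fin q, (i : ℕ) = domIdx x ∧ ∀ j, #(colorClass x j) ≤ #(colorClass x i) := by
  have : Nonempty (Fin q) := ⟨⟨0, hq⟩⟩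
  obtain ⟨i, hi⟩ := Finite.exists_max (cntN x)
  obtain ⟨h1, h2⟩ := Nat.sInf_mem
    (s := {j : ℕ | ∃ hj : j < q, ∀ j' : Fin q, cntN x j' ≤ cntN x ⟨j, hj⟩}) ⟨i, i.2, hi⟩
  exact ⟨⟨_, h1⟩, rfl, h2⟩

lemma StrictlyDominant.domIdx_eq (hq : 0 < q) {τ : Conf n q} {g : Fin n}
    (h : StrictlyDominant τ g) : ((τ g : Fin q) : ℕ) = domIdx τ := by
  obtain ⟨i, hi, hmax⟩ := exists_domIdx hq τ
  by_cases hig : i = τ g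
  · rw [← hig, hi]
  · exact absurd (h i hig) (not_lt.2 (hmax (τ g)))

lemma alpha1_eq {x : Conf n q} {i : Fin q} (hi : (i : ℕ) = domIdx x) :
    alpha1 x = #(colorClass x i) / (n : ℝ) := by
  simp only [alpha1, colorClass, ← hi, Fin.val_inj]

lemma alpha1_mem_Icc (x : Conf n q) : alpha1 x ∈ Set.Icc (0 : ℝ) 1 := by
  refine ⟨by unfold alpha1; positivity, div_le_one_of_le₀ ?_ (Nat.cast_nonneg n)⟩
  exact_mod_cast (Finset.card_le_univ _).trans (Fintype.card_fin n).le

lemma alpha1In_mem_Icc (x : Conf n q) (A : Finset (Fin n)) :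
    alpha1In x A ∈ Set.Icc (0 : ℝ) 1 := by
  refine ⟨by unfold alpha1In; positivity, div_le_one_of_le₀ ?_ (Nat.cast_nonneg _)⟩
  exact_mod_cast Finset.card_filter_le _ _

/-- Vertex weights computing the discrepancy between `A` and the whole vertex set. -/
noncomputable def discWeight (A : Finset (Fin n)) (v : Fin n) : ℝ :=
  (n : ℝ)⁻¹ - if v ∈ A then (#A : ℝ)⁻¹ else 0

lemma sum_colorClass_discWeight {x : Conf n q} {i : Fin q} (hi : (i : ℕ) = domIdx x)
    (A : Finset (Fin n)) :
    ∑ v ∈ colorClass x i, discWeight A v = alpha1 x - alpha1In x A := by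
  rw [alpha1_eq hi, alpha1In]
  simp only [discWeight, ← hi, Fin.val_inj]
  rw [Finset.sum_sub_distrib, Finset.sum_const, nsmul_eq_mul, ← Finset.sum_filter, Finset.sum_const,
    nsmul_eq_mul, div_eq_mul_inv, div_eq_mul_inv]
  congr 4
  ext v
  simp [colorClass, and_comm]

lemma sum_discWeight {A : Finset (Fin n)} (hA : 0 < #A) (hn : 0 < n) :
    ∑ v, discWeight A v = 0 := by
  simp only [discWeight]
  rw [Finset.sum_sub_distrib, Finset.sum_const, Finset.sum_ite_mem, Finset.univ_inter,
    Finset.sum_const, Finset.card_univ, Fintype.card_fin, nsmul_eq_mul, nsmul_eq_mul,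
    mul_inv_cancel₀ (by positivity), mul_inv_cancel₀ (by positivity), sub_self]

lemma abs_discWeight_le {lam : ℝ} (hlam : lam ∈ Set.Ioo (0 : ℝ) 1) (hn : 0 < n)
    {A : Finset (Fin n)} (hA : lam * n ≤ #A) (v : Fin n) :
    |discWeight A v| ≤ (lam * n)⁻¹ := by
  have hln : 0 < lam * n := mul_pos hlam.1 (by exact_mod_cast hn)
  have h1 : (n : ℝ)⁻¹ ≤ (lam * n)⁻¹ :=
    inv_anti₀ hln (mul_le_of_le_one_left (Nat.cast_nonneg n) hlam.2.le)
  have h2 : (#A : ℝ)⁻¹ ≤ (lam * n)⁻¹ := inv_anti₀ hln hA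
  have h3 : 0 ≤ (n : ℝ)⁻¹ := by positivity
  have h4 : 0 ≤ (#A : ℝ)⁻¹ := by positivity
  rw [discWeight, abs_le]
  split_ifs <;> constructor <;> linarith

/-- All but the most common spin have density close to that in the majority vector. -/
lemma cntFrac_le_of_linf {x : Conf n q} {ε : ℝ} (h : linf (alphaVec x) (mVec q β) ≤ ε)
    {i : Fin q} (hi : ∀ j, cntFrac x j ≤ cntFrac x i) {j : Fin q} (hj : j ≠ i) :
    cntFrac x j ≤ (1 - aFix q β) / ((q : ℝ) - 1) + ε := by
  set σ := Tuple.sort (cntFrac x) with hσ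
  have key : ∀ j, ((σ.symm j).rev : ℕ) ≠ 0 →
      cntFrac x j ≤ (1 - aFix q β) / ((q : ℝ) - 1) + ε := by
    intro j hj0
    have h1 := (le_ciSup (Set.finite_range _).bddAbove (σ.symm j).rev).trans h
    rw [alphaVec, ← hσ, Fin.rev_rev, Equiv.apply_symm_apply, mVec, kappaVec, if_neg hj0] at h1
    linarith [(abs_le.1 h1).2]
  by_cases hj0 : ((σ.symm j).rev : ℕ) = 0
  · refine (hi j).trans (key i fun hi0 => hj ?_)
    exact σ.symm.injective (Fin.rev_injective (Fin.ext (hj0.trans hi0.symm)))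
  · exact key j hj0

end swendsenWang

/-- Lemma 5.1: one-step concentration of the in-class discrepancy
`d(·,k) = |α₁ - α_{1,k}|`: the fluctuation
`ξ̂ = |d(X',k) - (1-1/q) θ(β α₁(x)) d(x,k)|` exceeds `r/√n` with probability at most
`e^{-c₁ r} + C₁ r⁻²`. -/
theorem sw_step_concentration_partition (q : ℕ) (hq : 2 ≤ q) (β : ℝ)
    (hβ : (q : ℝ) < β) (lam : ℝ) (hlam : lam ∈ Set.Ioo (0 : ℝ) 1) :
    ∃ ε₀ γ₁ c₁ C₁ : ℝ, 0 < ε₀ ∧ 0 < γ₁ ∧ 0 < c₁ ∧ 0 < C₁ ∧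
      ∃ N : ℕ, ∀ n : ℕ, N ≤ n →
        ∀ P : Fin q → Finset (Fin n), IsLamPartition lam P →
        ∀ x : Conf n q, linf (alphaVec x) (mVec q β) ≤ ε₀ →
        ∀ k : Fin q, ∀ r : ℝ, γ₁ ≤ r →
          (∑ τ : Conf n q,
            if r / Real.sqrt n ≤
                abs (|alpha1 τ - alpha1In τ (P k)| -
                  (1 - 1 / (q : ℝ)) * theta (β * alpha1 x) *
                    |alpha1 x - alpha1In x (P k)|)
              then swStep n q β x τ else 0)
            ≤ Real.exp (-c₁ * r) + C₁ / r ^ 2 := by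
  have hq0 : (0 : ℝ) < q := by exact_mod_cast (by omega : 0 < q)
  have hqn : 0 < q := by omega
  have hβ0 : 0 < β := hq0.trans hβ
  obtain ⟨-, ha, -⟩ := aFix_spec hq hβ
  have hsub := minority_subcritical hq hβ
  set b := (1 - aFix q β) / ((q : ℝ) - 1) with hb
  have hb0 : 0 ≤ b := by
    have : (2 : ℝ) ≤ q := by exact_mod_cast hq
    exact div_nonneg (by linarith) (by linarith)
  obtain ⟨C, M, hC, hmain⟩ := bernExp_colorExp_le (μ := (1 + β * b) / 2) hq hβ (by positivity)
    (by linarith)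
  have hl0 := hlam.1
  refine ⟨(1 - β * b) / (2 * β), 1, 1, C * (1 + (lam ^ 2)⁻¹), div_pos (by linarith) (by positivity),
    one_pos, one_pos, by positivity, max 1 ⌈M⌉₊, fun n hn P hP x hx k r hr => ?_⟩
  have hn1 : 0 < n := (le_max_left _ _).trans hn
  have hn0 : (0 : ℝ) < n := by exact_mod_cast hn1
  have hMn : M ≤ n := (Nat.le_ceil M).trans (by exact_mod_cast (le_max_right _ _).trans hn)
  have hPk := hP.2 k
  have hPpos : 0 < #(P k) := by
    have : (0 : ℝ) < #(P k) := (mul_pos hl0 hn0).trans_le hPk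
    exact_mod_cast this
  obtain ⟨i, hi, hmax⟩ := exists_domIdx hqn x
  have hminor : ∀ j, j ≠ i → β / n * #(colorClass x j) ≤ (1 + β * b) / 2 := by
    intro j hj
    have h1 := cntFrac_le_of_linf hx (i := i) (fun j => by
      have : (cntN x j : ℝ) ≤ cntN x i := by exact_mod_cast hmax j
      exact div_le_div_of_nonneg_right this hn0.le) hj
    rw [← hb] at h1
    have h2 : β * cntFrac x j ≤ β * (b + (1 - β * b) / (2 * β)) :=
      mul_le_mul_of_nonneg_left h1 hβ0.le
    have h3 : β * (b + (1 - β * b) / (2 * β)) = (1 + β * b) / 2 := by field_simp; ring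
    have h4 : β / n * #(colorClass x j) = β * cntFrac x j := by
      change β / n * cntN x j = β * ((cntN x j : ℝ) / n)
      ring
    linarith
  set X : Conf n q → ℝ := fun τ => abs (|alpha1 τ - alpha1In τ (P k)| -
    (1 - 1 / (q : ℝ)) * theta (β * alpha1 x) * |alpha1 x - alpha1In x (P k)|) with hX
  have hc0 : 0 ≤ (1 - 1 / (q : ℝ)) * theta (β * alpha1 x) ∧
      (1 - 1 / (q : ℝ)) * theta (β * alpha1 x) ≤ 1 := by
    obtain ⟨h0, h1⟩ := theta_mem_Icc (β * alpha1 x)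
    have h2 : 1 / (q : ℝ) ≤ 1 := by
      rw [div_le_one hq0]; exact_mod_cast hqn
    have h3 : 0 ≤ 1 / (q : ℝ) := by positivity
    exact ⟨mul_nonneg (by linarith) h0, mul_le_one₀ (by linarith) h0 h1⟩
  have hd1 : ∀ τ : Conf n q, |alpha1 τ - alpha1In τ (P k)| ≤ 1 := fun τ => by
    obtain ⟨h0, h1⟩ := alpha1_mem_Icc τ
    obtain ⟨h2, h3⟩ := alpha1In_mem_Icc τ (P k)
    rw [abs_le]; constructor <;> linarith
  have hX1 : ∀ τ, X τ ^ 2 ≤ 1 := fun τ => by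
    refine pow_le_one₀ (abs_nonneg _) (abs_sub_le_iff.2 ⟨?_, ?_⟩)
    · linarith [hd1 τ, mul_nonneg hc0.1 (abs_nonneg (alpha1 x - alpha1In x (P k)))]
    · linarith [mul_le_one₀ hc0.2 (abs_nonneg _) (hd1 x), abs_nonneg (alpha1 τ - alpha1In τ (P k))]
  have hXd : ∀ τ g, StrictlyDominant τ g → X τ ^ 2 ≤
      (∑ v ∈ colorClass τ (τ g), discWeight (P k) v - (1 - 1 / (q : ℝ)) *
        (theta (β / n * #(colorClass x i)) * ∑ v ∈ colorClass x i, discWeight (P k) v)) ^ 2 := by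
    intro τ g hτ
    have e : β / n * #(colorClass x i) = β * alpha1 x := by rw [alpha1_eq hi]; ring
    rw [sum_colorClass_discWeight (hτ.domIdx_eq hqn), sum_colorClass_discWeight hi, e, ← mul_assoc]
    refine sq_le_sq.2 ?_
    rw [hX, abs_abs, ← abs_of_nonneg hc0.1, ← abs_mul, abs_of_nonneg hc0.1]
    exact abs_abs_sub_abs_le_abs_sub _ _
  have hsecond := hmain (Fin n) x i (by simpa using hMn) hmax (by simpa using hminor)
    (discWeight (P k)) (lam * n)⁻¹ (sum_discWeight hPpos hn1) (abs_discWeight_le hlam hn1 hPk)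
    (fun τ => X τ ^ 2) hX1 (by simpa only [Fintype.card_fin] using hXd)
  rw [Fintype.card_fin, ← sum_mul_swStep] at hsecond
  have hr0 : 0 < r := by linarith
  calc ∑ τ : Conf n q, (if r / Real.sqrt n ≤ X τ then swStep n q β x τ else 0)
      ≤ ∑ τ, n / r ^ 2 * (X τ ^ 2 * swStep n q β x τ) := by
        refine Finset.sum_le_sum fun τ _ => ?_
        have hs := swStep_nonneg hβ0.le x τ
        split_ifs with h
        · have h2 : (r / Real.sqrt n) ^ 2 ≤ X τ ^ 2 := pow_le_pow_left₀ (by positivity) h 2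
          rw [div_pow, Real.sq_sqrt hn0.le, div_le_iff₀ hn0] at h2
          rw [← mul_assoc]
          refine le_mul_of_one_le_left hs ?_
          rw [div_mul_eq_mul_div, one_le_div (by positivity)]
          linarith
        · positivity
    _ ≤ n / r ^ 2 * (C * (1 / n + (lam * n)⁻¹ ^ 2 * n)) := by
        rw [← Finset.mul_sum]
        exact mul_le_mul_of_nonneg_left hsecond (by positivity)
    _ = C * (1 + (lam ^ 2)⁻¹) / r ^ 2 := by field_simp
    _ ≤ _ := le_add_of_nonneg_left (Real.exp_pos _).le
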